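/- arXiv:2401.00836 — 3 statements merged into one kernel-verified Lean document; each statement's English description precedes it below -/
import Mathlib

section
/- For every (a,b) ∈ (0,1/M)², any ergodic f_{a,b}-invariant measure μ on Λ with central Lyapunov exponent zero has measure-theoretic entropy h(μ) ≤ log√(4M), which is strictly less than log(M+1). -/
open MeasureTheory

abbrev DyckAlphabet (M : ℕ) := Fin M ⊕ Fin M

noncomputable def faMap (M : ℕ) (a : ℝ) (p : ℝ × ℝ) : ℝ × ℝ :=
  if p.1 < M * a then
    (Int.fract (p.1 / a), p.2 / M + (⌊p.1 / a⌋ : ℝ) / M)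
  else
    ((p.1 - M * a) / (1 - M * a), if p.2 = 1 then 1 else Int.fract (M * p.2))

noncomputable def fabMap (M : ℕ) (a b : ℝ) (p : ℝ × ℝ × ℝ) : ℝ × ℝ × ℝ :=
  let q := faMap M a (p.1, p.2.1)
  if p.1 < M * a then
    (q.1, q.2, (1 - M * b) * p.2.2)
  else
    (q.1, q.2, b * p.2.2 + 1 +
      b * ((if p.2.1 = 1 then (M : ℝ) else (⌊(M : ℝ) * p.2.1⌋ : ℝ) + 1) - M - 1))

/-- The `2M` defining domains `Ω_γ ⊂ [0,1]³` of `f_{a,b}` (with zero-based indices: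
`Sum.inl k` is `Ω_{α_{k+1}}`, `Sum.inr k` is `Ω_{β_{k+1}}`). -/
noncomputable def OmDomain (M : ℕ) (a : ℝ) : DyckAlphabet M → Set (ℝ × ℝ × ℝ)
  | Sum.inl k =>
      Set.Ico ((k : ℝ) * a) (((k : ℝ) + 1) * a) ×ˢ Set.Icc (0 : ℝ) 1 ×ˢ Set.Icc (0 : ℝ) 1
  | Sum.inr k =>
      Set.Icc ((M : ℝ) * a) 1 ×ˢ
        (if (k : ℕ) = M - 1 then Set.Icc ((k : ℝ) / M) 1
          else Set.Ico ((k : ℝ) / M) (((k : ℝ) + 1) / M)) ×ˢ Set.Icc (0 : ℝ) 1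

/-- The maximal invariant set `Λ = ⋂_{n ∈ ℤ} f^{-n}(⋃_γ int Ω_γ)`, where for `n < 0`
the preimage is interpreted as a forward image. -/
noncomputable def LamSet (M : ℕ) (a b : ℝ) : Set (ℝ × ℝ × ℝ) :=
  (⋂ n : ℕ, (fabMap M a b)^[n] ⁻¹' (⋃ γ : DyckAlphabet M, interior (OmDomain M a γ))) ∩
    (⋂ n : ℕ, (fabMap M a b)^[n] '' (⋃ γ : DyckAlphabet M, interior (OmDomain M a γ)))

/-- The unstable potential: `-log a` on `Ω_α = {x_u < Ma}`, `-log (1-Ma)` on `Ω_β`. -/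
noncomputable def phiU (M : ℕ) (a : ℝ) (x : ℝ × ℝ × ℝ) : ℝ :=
  if x.1 < M * a then -Real.log a else -Real.log (1 - M * a)

/-- The central potential: `-log M` on `Ω_α = {x_u < Ma}`, `+log M` on `Ω_β`. -/
noncomputable def phiC (M : ℕ) (a : ℝ) (x : ℝ × ℝ × ℝ) : ℝ :=
  if x.1 < M * a then -Real.log M else Real.log M

/-- The entropy `∑_{s ∈ P} -μ(s) log μ(s)` of a finite family of sets. -/
noncomputable def partitionEntropy {X : Type*} [MeasurableSpace X]
    (μ : Measure X) (P : Finset (Set X)) : ℝ :=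
  ∑ s ∈ P, Real.negMulLog (μ s).toReal

open Classical in
/-- The join `P ∨ T⁻¹P ∨ ⋯ ∨ T^{-(n-1)}P`. -/
noncomputable def refineN {X : Type*} (T : X → X) (P : Finset (Set X)) (n : ℕ) :
    Finset (Set X) :=
  (Finset.univ : Finset (Fin n → {s // s ∈ P})).image
    fun s => ⋂ i : Fin n, (T^[(i : ℕ)]) ⁻¹' (s i : Set X)

/-- A finite measurable partition of the whole space. -/
def IsFinPartition {X : Type*} [MeasurableSpace X] (P : Finset (Set X)) : Prop :=
  (∀ s ∈ P, MeasurableSet s) ∧ ⋃₀ (↑P : Set (Set X)) = Set.univ ∧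
    (↑P : Set (Set X)).PairwiseDisjoint id

/-- Kolmogorov–Sinai (measure-theoretic) entropy of `T` with respect to `μ`:
the supremum over finite measurable partitions `P` of
`lim_n (1/n) H(P ∨ ⋯ ∨ T^{-(n-1)}P)`; by subadditivity the limit equals the infimum. -/
noncomputable def kolSinaiEntropy {X : Type*} [MeasurableSpace X]
    (T : X → X) (μ : Measure X) : ℝ :=
  ⨆ P : {P : Finset (Set X) // IsFinPartition P},
    ⨅ n : ℕ, partitionEntropy μ (refineN T P.1 (n + 1)) / (n + 1)

section EntropyAux
set_option linter.unusedSectionVars false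
open MeasureTheory

variable {X : Type*} [MeasurableSpace X] {ι κ : Type*} [Fintype ι] [Fintype κ]

noncomputable def Hf (μ : Measure X) (ξ : X → ι) : ℝ :=
  ∑ i, Real.negMulLog (μ.real (ξ ⁻¹' {i}))

lemma Hf_nonneg (μ : Measure X) [IsProbabilityMeasure μ] (ξ : X → ι) : 0 ≤ Hf μ ξ :=
  Finset.sum_nonneg fun _ _ => Real.negMulLog_nonneg measureReal_nonneg measureReal_le_one

/-- measurability of fibres -/
def FibM (ξ : X → ι) : Prop := ∀ i, MeasurableSet (ξ ⁻¹' {i})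

lemma FibM.preimage {ξ : X → ι} (h : FibM ξ) (s : Set ι) : MeasurableSet (ξ ⁻¹' s) := by
  have : ξ ⁻¹' s = ⋃ i ∈ s, ξ ⁻¹' {i} := by ext x; simp
  rw [this]
  exact MeasurableSet.biUnion (Set.to_countable s) fun i _ => h i

lemma FibM.prod {ξ : X → ι} {η : X → κ} (h : FibM ξ) (h' : FibM η) :
    FibM (fun x => (ξ x, η x)) := by
  rintro ⟨i, j⟩
  have : (fun x => (ξ x, η x)) ⁻¹' {(i, j)} = ξ ⁻¹' {i} ∩ η ⁻¹' {j} := by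
    ext x; simp
  rw [this]; exact (h i).inter (h' j)

lemma FibM.pi {n : ℕ} {ξ : Fin n → X → ι} (h : ∀ k, FibM (ξ k)) :
    FibM (fun x k => ξ k x) := by
  intro s
  have : (fun x k => ξ k x) ⁻¹' {s} = ⋂ k, ξ k ⁻¹' {s k} := by
    ext x; simp [funext_iff]
  rw [this]; exact MeasurableSet.iInter fun k => h k _

lemma FibM.comp {ξ : X → ι} (h : FibM ξ) {T : X → X} (hT : Measurable T) :
    FibM (fun x => ξ (T x)) := fun i => hT (h i)

lemma sum_fib (μ : Measure X) [IsFiniteMeasure μ] {ξ : X → ι} (h : FibM ξ) {A : Set X}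
    (hA : MeasurableSet A) :
    ∑ i, μ.real (A ∩ ξ ⁻¹' {i}) = μ.real A := by
  rw [← measureReal_biUnion_finset]
  · congr 1; ext x; simp
  · intro i _ j _ hij
    refine Set.disjoint_left.2 ?_
    rintro x ⟨_, hx⟩ ⟨_, hy⟩
    exact hij (hx.symm.trans hy)
  · intro i _; exact hA.inter (h i)

lemma sum_fib_univ (μ : Measure X) [IsProbabilityMeasure μ] {ξ : X → ι} (h : FibM ξ) :
    ∑ i, μ.real (ξ ⁻¹' {i}) = 1 := by
  simpa using sum_fib μ h MeasurableSet.univ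

lemma gibbs_term {p q : ℝ} (hp : 0 ≤ p) (hq : 0 ≤ q) (h : q = 0 → p = 0) :
    Real.negMulLog p ≤ -(p * Real.log q) + (q - p) := by
  rcases hp.eq_or_lt with rfl | hp
  · simpa using hq
  have hq' : 0 < q := lt_of_le_of_ne hq fun h' => hp.ne' (h h'.symm)
  have h1 := Real.log_le_sub_one_of_pos (div_pos hq' hp)
  rw [Real.log_div hq'.ne' hp.ne'] at h1
  have h2 := mul_le_mul_of_nonneg_left h1 hp.le
  have h3 : p * (q / p - 1) = q - p := by field_simp
  rw [h3] at h2
  unfold Real.negMulLog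
  nlinarith

lemma Hf_gibbs (μ : Measure X) [IsProbabilityMeasure μ] {ξ : X → ι} (h : FibM ξ) (q : ι → ℝ)
    (hq : ∀ i, 0 < q i) (hs : ∑ i, q i = 1) :
    Hf μ ξ ≤ ∑ i, -(μ.real (ξ ⁻¹' {i}) * Real.log (q i)) := by
  have : Hf μ ξ ≤ ∑ i, (-(μ.real (ξ ⁻¹' {i}) * Real.log (q i)) + (q i - μ.real (ξ ⁻¹' {i}))) :=
    Finset.sum_le_sum fun i _ => gibbs_term measureReal_nonneg (hq i).le
      fun h0 => absurd h0 (hq i).ne'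
  rwa [Finset.sum_add_distrib, Finset.sum_sub_distrib, hs, sum_fib_univ μ h, sub_self,
    add_zero] at this

lemma Hf_le_log_card (μ : Measure X) [IsProbabilityMeasure μ] [Nonempty ι] {ξ : X → ι}
    (h : FibM ξ) : Hf μ ξ ≤ Real.log (Fintype.card ι) := by
  have hc : (0 : ℝ) < Fintype.card ι := by exact_mod_cast Fintype.card_pos
  refine (Hf_gibbs μ h (fun _ => 1 / (Fintype.card ι : ℝ)) (fun _ => by positivity) ?_).trans ?_
  · simp
  · simp only [one_div, Real.log_inv, mul_neg, neg_neg]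
    rw [← Finset.sum_mul, sum_fib_univ μ h, one_mul]

lemma Hf_prod (μ : Measure X) [IsProbabilityMeasure μ] {ξ : X → ι} {η : X → κ}
    (h : FibM ξ) (h' : FibM η) :
    Hf μ (fun x => (ξ x, η x)) ≤ Hf μ ξ + Hf μ η := by
  set p : ι → κ → ℝ := fun i j => μ.real (ξ ⁻¹' {i} ∩ η ⁻¹' {j}) with hp
  have e0 : ∀ i j, (fun x => (ξ x, η x)) ⁻¹' {(i, j)} = ξ ⁻¹' {i} ∩ η ⁻¹' {j} := by
    intro i j; ext x; simp
  have e1 : ∀ i, ∑ j, p i j = μ.real (ξ ⁻¹' {i}) := fun i => sum_fib μ h' (h i)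
  have e2 : ∀ j, ∑ i, p i j = μ.real (η ⁻¹' {j}) := fun j => by
    rw [← sum_fib μ h (h' j)]; simp only [hp, Set.inter_comm]
  have key : ∀ i j, Real.negMulLog (p i j) ≤
      -(p i j * Real.log (μ.real (ξ ⁻¹' {i}))) + -(p i j * Real.log (μ.real (η ⁻¹' {j})))
        + (μ.real (ξ ⁻¹' {i}) * μ.real (η ⁻¹' {j}) - p i j) := by
    intro i j
    have hl : p i j ≤ μ.real (ξ ⁻¹' {i}) := measureReal_mono Set.inter_subset_left
    have hr : p i j ≤ μ.real (η ⁻¹' {j}) := measureReal_mono Set.inter_subset_right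
    have hp0 : 0 ≤ p i j := measureReal_nonneg
    have hz : μ.real (ξ ⁻¹' {i}) * μ.real (η ⁻¹' {j}) = 0 → p i j = 0 := by
      intro hz
      rcases mul_eq_zero.1 hz with hz | hz <;> linarith
    have := gibbs_term hp0 (mul_nonneg measureReal_nonneg measureReal_nonneg) hz
    rcases hp0.eq_or_lt with h0 | h0
    · rw [← h0] at this ⊢
      simpa using this
    · rw [Real.log_mul (by linarith) (by linarith)] at this
      linarith
  have s : Hf μ (fun x => (ξ x, η x)) = ∑ i, ∑ j, Real.negMulLog (p i j) := by
    unfold Hf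
    rw [Fintype.sum_prod_type]
    simp only [e0, hp]
  rw [s]
  refine (Finset.sum_le_sum fun i _ => Finset.sum_le_sum fun j _ => key i j).trans ?_
  simp only [Finset.sum_add_distrib, Finset.sum_sub_distrib]
  have t1 : ∑ i, ∑ j, -(p i j * Real.log (μ.real (ξ ⁻¹' {i}))) = Hf μ ξ := by
    unfold Hf
    refine Finset.sum_congr rfl fun i _ => ?_
    rw [Finset.sum_neg_distrib, ← Finset.sum_mul, e1, Real.negMulLog, neg_mul]
  have t2 : ∑ i, ∑ j, -(p i j * Real.log (μ.real (η ⁻¹' {j}))) = Hf μ η := by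
    rw [Finset.sum_comm]
    unfold Hf
    refine Finset.sum_congr rfl fun i _ => ?_
    rw [Finset.sum_neg_distrib, ← Finset.sum_mul, e2, Real.negMulLog, neg_mul]
  have t3 : ∑ i, ∑ j, μ.real (ξ ⁻¹' {i}) * μ.real (η ⁻¹' {j}) = 1 := by
    simp only [← Finset.mul_sum, sum_fib_univ μ h', mul_one, sum_fib_univ μ h]
  have t4 : ∑ i, ∑ j, p i j = 1 := by
    simp only [e1, sum_fib_univ μ h]
  rw [t1, t2, t3, t4]
  linarith

lemma negMulLog_sum_le {s : Finset κ} {q : κ → ℝ} (hq : ∀ j, 0 ≤ q j) :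
    Real.negMulLog (∑ j ∈ s, q j) ≤ ∑ j ∈ s, Real.negMulLog (q j) := by
  have : Real.negMulLog (∑ j ∈ s, q j) = ∑ j ∈ s, -(q j * Real.log (∑ j ∈ s, q j)) := by
    rw [Finset.sum_neg_distrib, ← Finset.sum_mul, Real.negMulLog, neg_mul]
  rw [this]
  refine Finset.sum_le_sum fun j hj => ?_
  rcases (hq j).eq_or_lt with h0 | h0
  · rw [← h0]; simp
  · have : q j ≤ ∑ j ∈ s, q j := Finset.single_le_sum (fun j _ => hq j) hj
    have := Real.log_le_log h0 this
    rw [Real.negMulLog]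
    nlinarith

lemma Hf_mono (μ : Measure X) [IsProbabilityMeasure μ] {ξ : X → ι} {η : X → κ}
    (h' : FibM η) (X0 : Set X) (hX : ∀ᵐ x ∂μ, x ∈ X0)
    (hd : ∀ x ∈ X0, ∀ y ∈ X0, η x = η y → ξ x = ξ y) : Hf μ ξ ≤ Hf μ η := by
  classical
  obtain ⟨x0, -⟩ : ∃ x, x ∈ X0 := hX.exists
  have : ∃ g : κ → ι, ∀ x ∈ X0, ξ x = g (η x) := by
    refine ⟨fun j => if h : ∃ x ∈ X0, η x = j then ξ h.choose else ξ x0, fun x hx => ?_⟩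
    have h : ∃ y ∈ X0, η y = η x := ⟨x, hx, rfl⟩
    simp only [dif_pos h]
    exact hd _ hx _ h.choose_spec.1 h.choose_spec.2.symm
  obtain ⟨g, hg⟩ := this
  have e : ∀ i, μ.real (ξ ⁻¹' {i}) =
      ∑ j ∈ Finset.univ.filter (fun j => g j = i), μ.real (η ⁻¹' {j}) := by
    intro i
    rw [← measureReal_biUnion_finset]
    · apply measureReal_congr
      filter_upwards [hX] with x hx
      apply propext
      change ξ x = i ↔ x ∈ (⋃ j ∈ Finset.univ.filter (fun j => g j = i), η ⁻¹' {j})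
      simp [hg x hx]
    · intro a _ b _ hab
      refine Set.disjoint_left.2 ?_
      intro x hx hy
      exact hab (hx.symm.trans hy)
    · intro j _; exact h' j
  unfold Hf
  simp only [e]
  rw [← Finset.sum_fiberwise (s := Finset.univ) (g := g) (f := fun j => Real.negMulLog (μ.real (η ⁻¹' {j})))]
  exact Finset.sum_le_sum fun i _ => negMulLog_sum_le fun j => measureReal_nonneg

lemma Hf_comp (μ : Measure X) {T : X → X} (hT : MeasurePreserving T μ μ) {ξ : X → ι}
    (h : FibM ξ) : Hf μ (fun x => ξ (T x)) = Hf μ ξ := by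
  unfold Hf
  refine Finset.sum_congr rfl fun i _ => ?_
  have : (fun x => ξ (T x)) ⁻¹' {i} = T ⁻¹' (ξ ⁻¹' {i}) := rfl
  rw [this, measureReal_def, measureReal_def, hT.measure_preimage (h i).nullMeasurableSet]

lemma Hf_pi (μ : Measure X) [IsProbabilityMeasure μ] {n : ℕ} {ξ : Fin n → X → ι}
    (h : ∀ k, FibM (ξ k)) : Hf μ (fun x k => ξ k x) ≤ ∑ k, Hf μ (ξ k) := by
  induction n with
  | zero =>
    refine (Hf_le_log_card μ (FibM.pi h)).trans ?_
    simp
  | succ n ih =>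
    have h1 : Hf μ (fun x k => ξ k x) ≤
        Hf μ (fun x => (ξ 0 x, fun k : Fin n => ξ k.succ x)) := by
      refine Hf_mono μ (FibM.prod (h 0) (FibM.pi fun k => h k.succ)) Set.univ (by simp) ?_
      intro x _ y _ hxy
      rw [Prod.mk.injEq] at hxy
      funext k
      refine Fin.cases hxy.1 (fun k => ?_) k
      exact congrFun hxy.2 k
    refine h1.trans ((Hf_prod μ (h 0) (FibM.pi fun k => h k.succ)).trans ?_)
    rw [Fin.sum_univ_succ]
    exact add_le_add le_rfl (ih fun k => h k.succ)

lemma FibM.option {ξ : X → ι} (h : FibM ξ) {A : Set X} (hA : MeasurableSet A)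
    [∀ x, Decidable (x ∈ A)] : FibM (fun x => if x ∈ A then some (ξ x) else none) := by
  intro o
  cases o with
  | none =>
    have : (fun x => if x ∈ A then some (ξ x) else none) ⁻¹' {none} = Aᶜ := by
      ext x; by_cases hx : x ∈ A <;> simp [hx]
    rw [this]; exact hA.compl
  | some i =>
    have : (fun x => if x ∈ A then some (ξ x) else none) ⁻¹' {some i} = A ∩ ξ ⁻¹' {i} := by
      ext x; by_cases hx : x ∈ A <;> simp [hx]
    rw [this]; exact hA.inter (h i)

/-- rarely revealed functions have small entropy -/
lemma Hf_option_small (ι : Type*) [Fintype ι] (ε : ℝ) (hε : 0 < ε) :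
    ∃ δ > 0, ∀ (μ : Measure X) [IsProbabilityMeasure μ] (ξ : X → ι) (_ : FibM ξ) (A : Set X)
      (_ : MeasurableSet A) [∀ x, Decidable (x ∈ A)], μ.real A ≤ δ →
      Hf μ (fun x => if x ∈ A then some (ξ x) else none) ≤ ε := by
  classical
  set c : ℝ := Fintype.card ι + 1 with hc
  have hc0 : 0 < c := by positivity
  have c0 := Real.continuous_negMulLog.tendsto 0
  have c1 := Real.continuous_negMulLog.tendsto 1
  rw [Real.negMulLog_zero] at c0
  rw [Real.negMulLog_one] at c1
  obtain ⟨d0, hd0, h0⟩ := Metric.tendsto_nhds_nhds.1 c0 (ε / c) (by positivity)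
  obtain ⟨d1, hd1, h1⟩ := Metric.tendsto_nhds_nhds.1 c1 (ε / c) (by positivity)
  refine ⟨min d0 d1 / 2, by positivity, ?_⟩
  intro μ _ ξ hξ A hA _ hAδ
  have m0 : min d0 d1 / 2 < d0 := by
    have := min_le_left d0 d1; have : 0 < min d0 d1 := by positivity
    linarith
  have m1 : min d0 d1 / 2 < d1 := by
    have := min_le_right d0 d1; have : 0 < min d0 d1 := by positivity
    linarith
  unfold Hf
  rw [Fintype.sum_option]
  have b0 : Real.negMulLog (μ.real ((fun x => if x ∈ A then some (ξ x) else none) ⁻¹' {none}))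
      ≤ ε / c := by
    have : (fun x => if x ∈ A then some (ξ x) else none) ⁻¹' {none} = Aᶜ := by
      ext x; by_cases hx : x ∈ A <;> simp [hx]
    rw [this, probReal_compl_eq_one_sub hA]
    have := @h1 (1 - μ.real A) (by
      rw [Real.dist_eq, abs_lt]
      have : 0 ≤ μ.real A := measureReal_nonneg
      constructor <;> linarith)
    rw [Real.dist_eq, sub_zero] at this
    exact (le_abs_self _).trans this.le
  have b1 : ∀ i, Real.negMulLog (μ.real ((fun x => if x ∈ A then some (ξ x) else none) ⁻¹' {some i}))
      ≤ ε / c := by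
    intro i
    have : (fun x => if x ∈ A then some (ξ x) else none) ⁻¹' {some i} ⊆ A := by
      intro x hx; by_contra hx'; simp [hx'] at hx
    have hle := measureReal_mono (μ := μ) this
    have := @h0 (μ.real ((fun x => if x ∈ A then some (ξ x) else none) ⁻¹' {some i})) (by
      rw [Real.dist_eq, sub_zero, abs_of_nonneg measureReal_nonneg]
      linarith)
    rw [Real.dist_eq, sub_zero] at this
    exact (le_abs_self _).trans this.le
  refine (add_le_add b0 (Finset.sum_le_sum fun i _ => b1 i)).trans ?_
  rw [Finset.sum_const, Finset.card_univ, nsmul_eq_mul]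
  have : ε / c + Fintype.card ι * (ε / c) = c * (ε / c) := by rw [hc]; ring
  rw [this, mul_div_cancel₀ _ hc0.ne']

end EntropyAux

section MeanErgAux
open MeasureTheory Filter Topology

lemma mean_erg {X : Type*} [MeasurableSpace X] {μ : Measure X} [IsProbabilityMeasure μ]
    {T : X → X} (hT : Ergodic T μ) {φ : X → ℝ} (hφ : Measurable φ) (hb : ∀ x, |φ x| ≤ 1)
    (h0 : ∫ x, φ x ∂μ = 0) (θ : ℝ) (hθ : 0 < θ) :
    ∃ q : ℕ, 0 < q ∧ ∫ x, |birkhoffSum T φ q x| ∂μ ≤ θ * q := by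
  have hmem : ∀ n, MemLp (φ ∘ T^[n]) 2 μ := fun n =>
    MemLp.of_bound (hφ.comp (hT.measurable.iterate n)).aestronglyMeasurable 1
      (Eventually.of_forall fun x => hb _)
  have hmem0 : MemLp φ 2 μ := hmem 0
  set F : Lp ℝ 2 μ := hmem0.toLp φ with hF
  set U : Lp ℝ 2 μ →L[ℝ] Lp ℝ 2 μ :=
    (Lp.compMeasurePreservingₗᵢ ℝ T hT.toMeasurePreserving).toContinuousLinearMap with hU
  have hU1 : ‖U‖ ≤ 1 := LinearIsometry.norm_toContinuousLinearMap_le _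
  have hUg : ∀ g, U g = Lp.compMeasurePreserving T hT.toMeasurePreserving g := fun g => rfl
  have hlim := U.tendsto_birkhoffAverage_orthogonalProjection hU1 F
  have hz : (U.eqLocus (1 : Lp ℝ 2 μ →L[ℝ] Lp ℝ 2 μ)).orthogonalProjectionOnto F = 0 := by
    rw [Submodule.orthogonalProjectionOnto_eq_zero_iff, Submodule.mem_orthogonal]
    intro g hg
    have hg' : U g = g := hg
    have hae : (g : X → ℝ) ∘ T =ᵐ[μ] g := by
      have := Lp.coeFn_compMeasurePreserving g hT.toMeasurePreserving
      rw [← hUg, hg'] at this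
      exact this.symm
    obtain ⟨c, hc⟩ := hT.ae_eq_const_of_ae_eq_comp_ae (Lp.aestronglyMeasurable g) hae
    rw [L2.inner_def]
    have : ∀ᵐ x ∂μ, inner ℝ (g x) (F x) = φ x * c := by
      filter_upwards [hc, hmem0.coeFn_toLp] with x h1 h2
      rw [h1, hF, h2]
      simp
    rw [integral_congr_ae this, integral_mul_const, h0, zero_mul]
  rw [hz] at hlim
  have hlim' : Tendsto (fun q => ‖birkhoffAverage ℝ U _root_.id q F‖) atTop (𝓝 0) := by
    simpa using hlim.norm
  have hit : ∀ n, U^[n] F = (hmem n).toLp (φ ∘ T^[n]) := by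
    intro n
    have : U^[n] F = (Lp.compMeasurePreserving T hT.toMeasurePreserving)^[n] F := rfl
    rw [this]
    have h2 := Lp.compMeasurePreserving_iterate (E := ℝ) (p := 2) hT.toMeasurePreserving n
    rw [h2, hF, Lp.toLp_compMeasurePreserving]
  obtain ⟨q, hq, hq1⟩ := ((hlim'.eventually (gt_mem_nhds hθ)).and (eventually_ge_atTop 1)).exists
  refine ⟨q, hq1, ?_⟩
  have hq0 : (0 : ℝ) < q := by exact_mod_cast hq1
  have hS : MemLp (birkhoffSum T φ q) 2 μ := by
    have : birkhoffSum T φ q = fun x => ∑ k ∈ Finset.range q, (φ ∘ T^[k]) x := rfl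
    rw [this]
    exact memLp_finsetSum _ fun k _ => hmem k
  have hsum : birkhoffSum U _root_.id q F = hS.toLp _ := by
    apply Lp.ext
    unfold birkhoffSum
    simp only [id, hit]
    refine (Lp.coeFn_fun_finsetSum _ _).trans ?_
    refine EventuallyEq.trans ?_ hS.coeFn_toLp.symm
    have : ∀ᵐ x ∂μ, ∀ k : ℕ, (hmem k).toLp (φ ∘ T^[k]) x = φ (T^[k] x) :=
      ae_all_iff.2 fun k => (hmem k).coeFn_toLp
    filter_upwards [this] with x hx
    simp [hx, birkhoffSum]
  have hn : ‖hS.toLp _‖ ≤ θ * q := by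
    rw [birkhoffAverage, hsum, norm_smul, norm_inv, Real.norm_natCast] at hq
    rw [inv_mul_lt_iff₀ hq0] at hq
    linarith
  refine le_trans ?_ hn
  rw [Lp.norm_toLp]
  have h1 : ∫ x, |birkhoffSum T φ q x| ∂μ = (eLpNorm (birkhoffSum T φ q) 1 μ).toReal := by
    rw [eLpNorm_one_eq_lintegral_enorm, ← integral_norm_eq_lintegral_enorm hS.1]
    rfl
  rw [h1]
  exact ENNReal.toReal_mono hS.2.ne (eLpNorm_le_eLpNorm_of_exponent_le (by norm_num) hS.1)

end MeanErgAux

section DepthAux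
open MeasureTheory Filter Topology

lemma birk_abs_le {X : Type*} {T : X → X} {φ : X → ℝ} (hb : ∀ x, |φ x| ≤ 1) (n : ℕ) (x : X) :
    |birkhoffSum T φ n x| ≤ n := by
  unfold birkhoffSum
  refine (Finset.abs_sum_le_sum_abs _ _).trans ?_
  refine (Finset.sum_le_sum fun k _ => hb _).trans ?_
  simp

lemma birk_block {X : Type*} {T : X → X} {φ : X → ℝ} (q t : ℕ) (x : X) :
    |birkhoffSum T φ (q * t) x| ≤ ∑ s ∈ Finset.range t, |birkhoffSum T φ q (T^[q * s] x)| := by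
  induction t with
  | zero => simp
  | succ t ih =>
    rw [Nat.mul_succ, birkhoffSum_add, Finset.sum_range_succ]
    exact (abs_add_le _ _).trans (add_le_add ih le_rfl)

lemma birk_meas {X : Type*} [MeasurableSpace X] {T : X → X} (hT : Measurable T) {φ : X → ℝ}
    (hφ : Measurable φ) (n : ℕ) : Measurable (birkhoffSum T φ n) := by
  unfold birkhoffSum
  exact Finset.measurable_sum _ fun k _ => hφ.comp (hT.iterate k)

lemma depth_est {X : Type*} [MeasurableSpace X] {μ : Measure X} [IsProbabilityMeasure μ]
    {T : X → X} (hT : MeasurePreserving T μ μ) {φ : X → ℝ} (hφ : Measurable φ)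
    (hb : ∀ x, |φ x| ≤ 1) {κ : ℝ} (hκ : 0 < κ) {q : ℕ} (hq : 0 < q)
    (hS : ∫ x, |birkhoffSum T φ q x| ∂μ ≤ κ ^ 2 * q) {N : ℕ} (hN : 0 < N) {t : ℝ}
    (ht : q + κ * N ≤ t) :
    μ.real {x | ∃ l ≤ N, birkhoffSum T φ l x ≤ -t} ≤ κ := by
  set Y : X → ℝ := fun x => ∑ s ∈ Finset.range (N / q), |birkhoffSum T φ q (T^[q * s] x)| with hY
  have hm : ∀ s, Measurable fun x => |birkhoffSum T φ q (T^[q * s] x)| := fun s =>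
    ((birk_meas hT.measurable hφ q).comp (hT.measurable.iterate _)).abs
  have hi : ∀ s, Integrable (fun x => |birkhoffSum T φ q (T^[q * s] x)|) μ := fun s => by
    refine Integrable.of_bound (hm s).aestronglyMeasurable q (Eventually.of_forall fun x => ?_)
    rw [Real.norm_eq_abs, abs_abs]
    exact birk_abs_le hb _ _
  have hYi : Integrable Y μ := integrable_finsetSum _ fun s _ => hi s
  have hY0 : ∀ x, 0 ≤ Y x := fun x => Finset.sum_nonneg fun _ _ => abs_nonneg _
  have hint : ∫ x, Y x ∂μ ≤ κ ^ 2 * N := by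
    rw [hY, integral_finsetSum _ fun s _ => hi s]
    have : ∀ s, ∫ x, |birkhoffSum T φ q (T^[q * s] x)| ∂μ = ∫ x, |birkhoffSum T φ q x| ∂μ := by
      intro s
      have hp := hT.iterate (q * s)
      have hmap := hp.map_eq
      have := integral_map (μ := μ) (φ := T^[q * s]) hp.measurable.aemeasurable
        (f := fun x => |birkhoffSum T φ q x|)
        (birk_meas hT.measurable hφ q).abs.aestronglyMeasurable
      rw [hmap] at this
      exact this.symm
    simp only [this, Finset.sum_const, Finset.card_range, nsmul_eq_mul]
    have h1 : ((N / q : ℕ) : ℝ) * q ≤ N := by exact_mod_cast Nat.div_mul_le_self N q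
    calc ((N / q : ℕ) : ℝ) * ∫ x, |birkhoffSum T φ q x| ∂μ
        ≤ ((N / q : ℕ) : ℝ) * (κ ^ 2 * q) := by gcongr
      _ = κ ^ 2 * (((N / q : ℕ) : ℝ) * q) := by ring
      _ ≤ _ := by gcongr
  have hsub : {x | ∃ l ≤ N, birkhoffSum T φ l x ≤ -t} ⊆ {x | κ * N ≤ Y x} := by
    rintro x ⟨l, hl, hx⟩
    have e : l = q * (l / q) + l % q := (Nat.div_add_mod l q).symm
    have h1 : |birkhoffSum T φ l x| ≤ Y x + q := by
      rw [e, birkhoffSum_add]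
      refine (abs_add_le _ _).trans (add_le_add ?_ ?_)
      · refine (birk_block _ _ _).trans ?_
        refine Finset.sum_le_sum_of_subset_of_nonneg ?_ fun _ _ _ => abs_nonneg _
        exact Finset.range_mono (Nat.div_le_div_right hl)
      · refine (birk_abs_le hb _ _).trans ?_
        exact_mod_cast (Nat.mod_lt _ hq).le
    have := neg_abs_le (birkhoffSum T φ l x)
    change κ * N ≤ Y x
    linarith
  have hmk := mul_meas_ge_le_integral_of_nonneg (Eventually.of_forall hY0) hYi (κ * N)
  have hle := measureReal_mono (μ := μ) hsub
  have hN' : (0 : ℝ) < N := by exact_mod_cast hN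
  have : κ * N * μ.real {x | κ * N ≤ Y x} ≤ κ * N * κ := by
    refine hmk.trans (hint.trans (le_of_eq (by ring)))
  exact hle.trans (le_of_mul_le_mul_left this (by positivity))

end DepthAux

section DynAux
open MeasureTheory

open Classical in
noncomputable def Qs (M : ℕ) (a : ℝ) (x : ℝ × ℝ × ℝ) : Option (ZMod M) :=
  if x ∈ {x : ℝ × ℝ × ℝ | x.1 < M * a} then some ((⌊x.1 / a⌋ : ℤ) : ZMod M) else none

noncomputable def dig (M : ℕ) (k : ℕ) (x : ℝ × ℝ × ℝ) : ZMod M :=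
  ((⌊(M : ℝ) ^ (k + 1) * x.2.1⌋ : ℤ) : ZMod M)

def agr (M : ℕ) (k : ℕ) (x y : ℝ × ℝ × ℝ) : Prop :=
  ⌊(M : ℝ) ^ k * x.2.1⌋ = ⌊(M : ℝ) ^ k * y.2.1⌋

noncomputable def sgm (M : ℕ) (a : ℝ) (x : ℝ × ℝ × ℝ) : ℤ := if x.1 < M * a then 1 else -1

def X1 : Set (ℝ × ℝ × ℝ) := {p | (0 ≤ p.1 ∧ p.1 ≤ 1) ∧ (0 ≤ p.2.1 ∧ p.2.1 < 1) ∧ 0 ≤ p.2.2 ∧ p.2.2 ≤ 1}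

def X0 (M : ℕ) (a b : ℝ) : Set (ℝ × ℝ × ℝ) := {x | ∀ n, (fabMap M a b)^[n] x ∈ X1}

lemma floor_pow_succ {M : ℕ} (hM : 2 ≤ M) (k : ℕ) (t : ℝ) :
    ⌊(M : ℝ) ^ k * t⌋ = ⌊(M : ℝ) ^ (k + 1) * t⌋ / (M : ℤ) := by
  have hM0 : (M : ℝ) ≠ 0 := by positivity
  have : (M : ℝ) ^ k * t = ((M : ℝ) ^ (k + 1) * t) / (M : ℝ) := by
    field_simp
    ring
  rw [this, Int.floor_div_natCast]

lemma agr_of_succ {M : ℕ} (hM : 2 ≤ M) {k : ℕ} {x y : ℝ × ℝ × ℝ} (h : agr M (k + 1) x y) :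
    agr M k x y := by
  unfold agr at *
  rw [floor_pow_succ hM k, floor_pow_succ hM k, h]

lemma agr_mono {M : ℕ} (hM : 2 ≤ M) {k l : ℕ} (hkl : k ≤ l) {x y : ℝ × ℝ × ℝ}
    (h : agr M l x y) : agr M k x y := by
  induction l, hkl using Nat.le_induction with
  | base => exact h
  | succ l _ ih => exact ih (agr_of_succ hM h)

lemma agr_succ {M : ℕ} (hM : 2 ≤ M) {k : ℕ} {x y : ℝ × ℝ × ℝ} (h : agr M k x y)
    (hd : dig M k x = dig M k y) : agr M (k + 1) x y := by
  unfold agr at *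
  unfold dig at hd
  rw [ZMod.intCast_eq_intCast_iff] at hd
  rw [floor_pow_succ hM k, floor_pow_succ hM k] at h
  rw [← Int.mul_ediv_add_emod ⌊(M : ℝ) ^ (k + 1) * x.2.1⌋ M, h, hd.eq, Int.mul_ediv_add_emod]

lemma agr_zero {M : ℕ} {x y : ℝ × ℝ × ℝ} (hx : x ∈ X1) (hy : y ∈ X1) : agr M 0 x y := by
  unfold agr
  simp only [pow_zero, one_mul]
  rw [Int.floor_eq_zero_iff.2 hx.2.1, Int.floor_eq_zero_iff.2 hy.2.1]

lemma Qs_side {M : ℕ} {a : ℝ} {x y : ℝ × ℝ × ℝ} (h : Qs M a x = Qs M a y) :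
    x.1 < M * a ↔ y.1 < M * a := by
  unfold Qs at h
  by_cases h1 : x.1 < M * a <;> by_cases h2 : y.1 < M * a <;> simp [h1, h2] at h ⊢

lemma Qs_floor {M : ℕ} (hM : 2 ≤ M) {a : ℝ} (ha : 0 < a) {x y : ℝ × ℝ × ℝ} (hx : x ∈ X1)
    (hy : y ∈ X1) (h : Qs M a x = Qs M a y) (hs : x.1 < M * a) :
    ⌊x.1 / a⌋ = ⌊y.1 / a⌋ := by
  have hs' := (Qs_side h).1 hs
  unfold Qs at h
  simp only [Set.mem_ofPred_eq, hs, hs', if_true, Option.some.injEq] at h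
  rw [ZMod.intCast_eq_intCast_iff] at h
  have aux : ∀ z : ℝ × ℝ × ℝ, z ∈ X1 → z.1 < M * a → ⌊z.1 / a⌋ % (M : ℤ) = ⌊z.1 / a⌋ := by
    intro z hz hzs
    apply Int.emod_eq_of_lt
    · exact Int.floor_nonneg.2 (div_nonneg hz.1.1 ha.le)
    · rw [Int.floor_lt]
      rw [div_lt_iff₀ ha]
      exact_mod_cast hzs
  rw [← aux x hx hs, ← aux y hy hs', h.eq]

lemma agr_push {M : ℕ} (hM : 2 ≤ M) {a b : ℝ} (ha : 0 < a) {x y : ℝ × ℝ × ℝ} (hx : x ∈ X1)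
    (hy : y ∈ X1) (h : Qs M a x = Qs M a y) (hs : x.1 < M * a) {k : ℕ} (hk : agr M k x y) :
    agr M (k + 1) (fabMap M a b x) (fabMap M a b y) := by
  have hs' := (Qs_side h).1 hs
  have hf := Qs_floor hM ha hx hy h hs
  have hM0 : (M : ℝ) ≠ 0 := by positivity
  unfold agr at *
  have e : ∀ z : ℝ × ℝ × ℝ, z.1 < M * a → (M : ℝ) ^ (k + 1) * (fabMap M a b z).2.1 =
      (M : ℝ) ^ k * z.2.1 + (((M : ℤ) ^ k * ⌊z.1 / a⌋ : ℤ) : ℝ) := by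
    intro z hz
    simp only [fabMap, faMap, hz, if_true]
    push_cast
    field_simp
    ring
  rw [e x hs, e y hs', Int.floor_add_intCast, Int.floor_add_intCast, hk, hf]

lemma agr_pop {M : ℕ} (hM : 2 ≤ M) {a b : ℝ} {x y : ℝ × ℝ × ℝ} (hx : x ∈ X1)
    (hy : y ∈ X1) (h : Qs M a x = Qs M a y) (hs : ¬ x.1 < M * a) {k : ℕ}
    (hk : agr M (k + 1) x y) :
    agr M k (fabMap M a b x) (fabMap M a b y) := by
  have hs' : ¬ y.1 < M * a := fun h' => hs ((Qs_side h).2 h')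
  have h1 : agr M 1 x y := agr_mono hM (by omega) hk
  unfold agr at *
  simp only [pow_one] at h1
  have e : ∀ z : ℝ × ℝ × ℝ, z ∈ X1 → ¬ z.1 < M * a → (M : ℝ) ^ k * (fabMap M a b z).2.1 =
      (M : ℝ) ^ (k + 1) * z.2.1 - (((M : ℤ) ^ k * ⌊(M : ℝ) * z.2.1⌋ : ℤ) : ℝ) := by
    intro z hz hzs
    simp only [fabMap, faMap, hzs, if_false, hz.2.1.2.ne, Int.fract]
    push_cast
    ring
  rw [e x hx hs, e y hy hs', Int.floor_sub_intCast, Int.floor_sub_intCast, hk, h1]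

lemma step_u {M : ℕ} (hM : 2 ≤ M) {a b lam : ℝ} (ha : 0 < a) (ha1 : M * a < 1)
    (hl1 : a ≤ lam) (hl2 : 1 - M * a ≤ lam) {x y : ℝ × ℝ × ℝ} (hx : x ∈ X1)
    (hy : y ∈ X1) (h : Qs M a x = Qs M a y) :
    |x.1 - y.1| ≤ lam * |(fabMap M a b x).1 - (fabMap M a b y).1| := by
  by_cases hs : x.1 < M * a
  · have hs' := (Qs_side h).1 hs
    have hf := Qs_floor hM ha hx hy h hs
    have : (fabMap M a b x).1 - (fabMap M a b y).1 = (x.1 - y.1) / a := by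
      simp only [fabMap, faMap, hs, hs', if_true, Int.fract, hf]
      ring
    rw [this, abs_div, abs_of_pos ha, mul_div_assoc', le_div_iff₀ ha, mul_comm]
    gcongr
  · have hs' : ¬ y.1 < M * a := fun h' => hs ((Qs_side h).2 h')
    have h0 : 0 < 1 - M * a := by linarith
    have : (fabMap M a b x).1 - (fabMap M a b y).1 = (x.1 - y.1) / (1 - M * a) := by
      simp only [fabMap, faMap, hs, hs', if_false]
      ring
    rw [this, abs_div, abs_of_pos h0, mul_div_assoc', le_div_iff₀ h0, mul_comm]
    gcongr

lemma step_s {M : ℕ} {a b lam : ℝ} (hb : 0 < b) (hb1 : M * b < 1)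
    (hl1 : b ≤ lam) (hl2 : 1 - M * b ≤ lam) {x y : ℝ × ℝ × ℝ} (hx : x ∈ X1)
    (hy : y ∈ X1) (h : Qs M a x = Qs M a y) (h1 : agr M 1 x y) :
    |(fabMap M a b x).2.2 - (fabMap M a b y).2.2| ≤ lam * |x.2.2 - y.2.2| := by
  unfold agr at h1
  simp only [pow_one] at h1
  by_cases hs : x.1 < M * a
  · have hs' := (Qs_side h).1 hs
    have h0 : 0 < 1 - M * b := by linarith
    have : (fabMap M a b x).2.2 - (fabMap M a b y).2.2 = (1 - M * b) * (x.2.2 - y.2.2) := by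
      simp only [fabMap, hs, hs', if_true]
      ring
    rw [this, abs_mul, abs_of_pos h0]
    gcongr
  · have hs' : ¬ y.1 < M * a := fun h' => hs ((Qs_side h).2 h')
    have : (fabMap M a b x).2.2 - (fabMap M a b y).2.2 = b * (x.2.2 - y.2.2) := by
      simp only [fabMap, hs, hs', if_false, hx.2.1.2.ne, hy.2.1.2.ne, h1]
      ring
    rw [this, abs_mul, abs_of_pos hb]
    gcongr

lemma dist_c {M : ℕ} (hM : 2 ≤ M) {j : ℕ} {x y : ℝ × ℝ × ℝ} (h : agr M j x y) :
    |x.2.1 - y.2.1| ≤ (1 / (M : ℝ)) ^ j := by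
  have := Int.abs_sub_lt_one_of_floor_eq_floor h
  have hM0 : (0 : ℝ) < (M : ℝ) ^ j := by positivity
  rw [← mul_sub, abs_mul, abs_of_pos hM0] at this
  rw [div_pow, one_pow, le_div_iff₀ hM0]
  linarith

lemma X0_it {M : ℕ} {a b : ℝ} {x : ℝ × ℝ × ℝ} (hx : x ∈ X0 M a b) (n : ℕ) :
    (fabMap M a b)^[n] x ∈ X1 := hx n

lemma agr_iter {M : ℕ} (hM : 2 ≤ M) {a b : ℝ} (ha : 0 < a) {x y : ℝ × ℝ × ℝ}
    (hx : x ∈ X0 M a b) (hy : y ∈ X0 M a b) {N j A : ℕ} (hj : 1 ≤ j)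
    (hQ : ∀ l < N, Qs M a ((fabMap M a b)^[l] x) = Qs M a ((fabMap M a b)^[l] y))
    (hA : agr M A x y)
    (hS : ∀ l ≤ N, (j : ℤ) ≤ A + birkhoffSum (fabMap M a b) (sgm M a) l x) (l : ℕ) (hl : l ≤ N) :
    agr M (A + birkhoffSum (fabMap M a b) (sgm M a) l x).toNat
      ((fabMap M a b)^[l] x) ((fabMap M a b)^[l] y) := by
  induction l with
  | zero => simpa using hA
  | succ l ih =>
    have ih := ih (by omega)
    have h1 := hS l (by omega)
    have h2 := hS (l + 1) hl
    rw [birkhoffSum_succ] at h2 ⊢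
    rw [Function.iterate_succ_apply', Function.iterate_succ_apply']
    set s := birkhoffSum (fabMap M a b) (sgm M a) l x with hs
    by_cases hside : ((fabMap M a b)^[l] x).1 < M * a
    · have e : sgm M a ((fabMap M a b)^[l] x) = 1 := by simp [sgm, hside]
      rw [e] at h2 ⊢
      have : ((A : ℤ) + (s + 1)).toNat = ((A : ℤ) + s).toNat + 1 := by omega
      rw [this]
      exact agr_push hM ha (hx l) (hy l) (hQ l (by omega)) hside ih
    · have e : sgm M a ((fabMap M a b)^[l] x) = -1 := by simp [sgm, hside]
      rw [e] at h2 ⊢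
      have : ((A : ℤ) + s).toNat = ((A : ℤ) + (s + -1)).toNat + 1 := by omega
      rw [this] at ih
      exact agr_pop hM (hx l) (hy l) (hQ l (by omega)) hside ih

def maskS (M : ℕ) (a b : ℝ) (N j i : ℕ) : Set (ℝ × ℝ × ℝ) :=
  {x | ∃ l ≤ N, (i : ℤ) + birkhoffSum (fabMap M a b) (sgm M a) l x < j}

open Classical in
noncomputable def Zs (M : ℕ) (a b : ℝ) (N j i : ℕ) (x : ℝ × ℝ × ℝ) : Option (ZMod M) :=
  if x ∈ maskS M a b N j i then some (dig M i x) else none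

lemma sgm_ge (M : ℕ) (a : ℝ) (x : ℝ × ℝ × ℝ) : |(sgm M a x : ℝ)| ≤ 1 := by
  unfold sgm; split_ifs <;> simp

lemma birk_int_ge (M : ℕ) (a b : ℝ) (l : ℕ) (x : ℝ × ℝ × ℝ) :
    -(l : ℤ) ≤ birkhoffSum (fabMap M a b) (sgm M a) l x := by
  induction l with
  | zero => simp
  | succ l ih =>
    rw [birkhoffSum_succ]
    have : -1 ≤ sgm M a ((fabMap M a b)^[l] x) := by unfold sgm; split_ifs <;> simp
    push_cast
    omega

lemma det_all {M : ℕ} (hM : 2 ≤ M) {a b lam : ℝ} (ha : 0 < a) (ha1 : M * a < 1)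
    (hb : 0 < b) (hb1 : M * b < 1) (hlam : 0 ≤ lam)
    (hl1 : a ≤ lam) (hl2 : 1 - M * a ≤ lam) (hl3 : b ≤ lam) (hl4 : 1 - M * b ≤ lam)
    {x y : ℝ × ℝ × ℝ}
    (hx : x ∈ X0 M a b) (hy : y ∈ X0 M a b) {N j : ℕ} (hj : 1 ≤ j)
    (hQ : ∀ l < N, Qs M a ((fabMap M a b)^[l] x) = Qs M a ((fabMap M a b)^[l] y))
    (hZ : ∀ i < N + j, Zs M a b N j i x = Zs M a b N j i y) {m i : ℕ} (hmi : m ≤ i)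
    (hiN : i + m ≤ N) :
    dist ((fabMap M a b)^[i] x) ((fabMap M a b)^[i] y) ≤ max (lam ^ m) ((1 / (M : ℝ)) ^ j) := by
  set T := fabMap M a b with hT
  obtain ⟨ls, hls, hmin⟩ := Finset.exists_min_image (Finset.range (N + 1))
    (fun l => birkhoffSum T (sgm M a) l x) ⟨0, by simp⟩
  have hlsN : ls ≤ N := by simpa [Nat.lt_succ_iff] using hls
  have h0 := hmin 0 (by simp)
  simp only [birkhoffSum_zero] at h0
  have hge := birk_int_ge M a b ls x
  rw [← hT] at hge
  obtain ⟨A, hA⟩ : ∃ A : ℕ, (A : ℤ) = j - birkhoffSum T (sgm M a) ls x :=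
    ⟨((j : ℤ) - birkhoffSum T (sgm M a) ls x).toNat, by omega⟩
  have hagr : ∀ k ≤ A, agr M k x y := by
    intro k
    induction k with
    | zero => intro _; exact agr_zero (hx 0) (hy 0)
    | succ k ih =>
      intro hk
      refine agr_succ hM (ih (by omega)) ?_
      have hz := hZ k (by omega)
      have hmx : x ∈ maskS M a b N j k := ⟨ls, hlsN, by rw [← hT]; omega⟩
      unfold Zs at hz
      rw [if_pos hmx] at hz
      by_cases hmy : y ∈ maskS M a b N j k
      · rw [if_pos hmy] at hz
        simpa using hz
      · rw [if_neg hmy] at hz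
        simp at hz
  have hit := agr_iter hM ha hx hy hj hQ (hagr A le_rfl) (fun l hl => by
    have := hmin l (by simpa [Nat.lt_succ_iff] using hl)
    rw [← hT]; omega)
  have hagj : ∀ l ≤ N, agr M j (T^[l] x) (T^[l] y) := by
    intro l hl
    refine agr_mono hM ?_ (hit l hl)
    have := hmin l (by simpa [Nat.lt_succ_iff] using hl)
    rw [← hT]
    omega
  have hu : ∀ k l, l + k ≤ N → |(T^[l] x).1 - (T^[l] y).1| ≤ lam ^ k := by
    intro k
    induction k with
    | zero =>
      intro l _
      have h1 := hx l
      have h2 := hy l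
      rw [pow_zero, abs_le]
      constructor <;> linarith [h1.1.1, h1.1.2, h2.1.1, h2.1.2]
    | succ k ih =>
      intro l hl
      have h1 := step_u (b := b) hM ha ha1 hl1 hl2 (hx l) (hy l) (hQ l (by omega))
      have h2 := ih (l + 1) (by omega)
      rw [Function.iterate_succ_apply', Function.iterate_succ_apply'] at h2
      rw [pow_succ']
      exact h1.trans (mul_le_mul_of_nonneg_left h2 hlam)
  have hs : ∀ k l, k ≤ l → l ≤ N → |(T^[l] x).2.2 - (T^[l] y).2.2| ≤ lam ^ k := by
    intro k
    induction k with
    | zero =>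
      intro l _ _
      have h1 := hx l
      have h2 := hy l
      rw [pow_zero, abs_le]
      constructor <;> linarith [h1.2.2.1, h1.2.2.2, h2.2.2.1, h2.2.2.2]
    | succ k ih =>
      intro l hl hlN
      obtain ⟨l, rfl⟩ : ∃ l', l = l' + 1 := ⟨l - 1, by omega⟩
      have h1 := step_s (a := a) hb hb1 hl3 hl4 (hx l) (hy l) (hQ l (by omega))
        (agr_mono hM hj (hagj l (by omega)))
      have h2 := ih l (by omega) (by omega)
      rw [Function.iterate_succ_apply', Function.iterate_succ_apply']
      rw [pow_succ']
      exact h1.trans (mul_le_mul_of_nonneg_left h2 hlam)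
  rw [Prod.dist_eq, Prod.dist_eq, Real.dist_eq, Real.dist_eq, Real.dist_eq]
  refine max_le ((hu m i hiN).trans (le_max_left _ _)) (max_le ?_ ?_)
  · exact (dist_c hM (hagj i (by omega))).trans (le_max_right _ _)
  · exact (hs m i hmi (by omega)).trans (le_max_left _ _)

end DynAux

section FinalAux
open MeasureTheory Filter Topology

lemma Om_sub {M : ℕ} (hM : 2 ≤ M) {a : ℝ} (ha : 0 < a) (ha1 : M * a < 1) (γ : DyckAlphabet M) :
    interior (OmDomain M a γ) ⊆ X1 := by
  have hM0 : (0 : ℝ) < M := by positivity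
  have h : OmDomain M a γ ⊆ Set.Icc (0 : ℝ) 1 ×ˢ Set.Icc (0 : ℝ) 1 ×ˢ Set.Icc (0 : ℝ) 1 := by
    rcases γ with k | k
    · refine Set.prod_mono ?_ subset_rfl
      intro t ht
      have hk : ((k : ℕ) : ℝ) + 1 ≤ M := by exact_mod_cast k.2
      refine ⟨le_trans (by positivity) ht.1, ht.2.le.trans ?_⟩
      exact (mul_le_mul_of_nonneg_right hk ha.le).trans ha1.le
    · refine Set.prod_mono ?_ (Set.prod_mono ?_ subset_rfl)
      · intro t ht
        exact ⟨le_trans (by positivity) ht.1, ht.2⟩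
      · have hk : ((k : ℕ) : ℝ) + 1 ≤ M := by exact_mod_cast k.2
        split_ifs
        · intro t ht
          exact ⟨le_trans (by positivity) ht.1, ht.2⟩
        · intro t ht
          exact ⟨le_trans (by positivity) ht.1, ht.2.le.trans ((div_le_one hM0).2 hk)⟩
  refine (interior_mono h).trans ?_
  rw [interior_prod_eq, interior_prod_eq, interior_Icc]
  rintro ⟨x, y, z⟩ ⟨h1, h2, h3⟩
  exact ⟨⟨h1.1.le, h1.2.le⟩, ⟨h2.1.le, h2.2⟩, h3.1.le, h3.2.le⟩

lemma X1_meas : MeasurableSet X1 := by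
  unfold X1
  refine MeasurableSet.inter ?_ (MeasurableSet.inter ?_ ?_)
  · exact (measurableSet_le measurable_const measurable_fst).inter
      (measurableSet_le measurable_fst measurable_const)
  · exact (measurableSet_le measurable_const (measurable_fst.comp measurable_snd)).inter
      (measurableSet_lt (measurable_fst.comp measurable_snd) measurable_const)
  · exact (measurableSet_le measurable_const (measurable_snd.comp measurable_snd)).inter
      (measurableSet_le (measurable_snd.comp measurable_snd) measurable_const)

lemma ae_X0 {M : ℕ} (hM : 2 ≤ M) {a b : ℝ} (ha : 0 < a) (ha1 : M * a < 1)
    {μ : Measure (ℝ × ℝ × ℝ)} [IsProbabilityMeasure μ] (hT : Measurable (fabMap M a b))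
    (hΛ : μ (LamSet M a b) = 1) : ∀ᵐ x ∂μ, x ∈ X0 M a b := by
  have hm : MeasurableSet (X0 M a b) := by
    have : X0 M a b = ⋂ n, (fabMap M a b)^[n] ⁻¹' X1 := by ext x; simp [X0]
    rw [this]
    exact MeasurableSet.iInter fun n => (hT.iterate n) X1_meas
  have hsub : LamSet M a b ⊆ X0 M a b := by
    intro x hx n
    have h1 := Set.mem_iInter.1 hx.1 n
    obtain ⟨γ, hγ⟩ := Set.mem_iUnion.1 h1
    exact Om_sub hM ha ha1 γ hγ
  have h1 : μ (X0 M a b) = 1 := le_antisymm prob_le_one (hΛ ▸ measure_mono hsub)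
  exact (mem_ae_iff_prob_eq_one hm).2 h1

lemma side_meas (M : ℕ) (a : ℝ) : MeasurableSet {x : ℝ × ℝ × ℝ | x.1 < M * a} :=
  measurableSet_lt measurable_fst measurable_const

lemma Qs_fib (M : ℕ) [NeZero M] (a : ℝ) : FibM (Qs M a) := by
  classical
  unfold Qs
  refine FibM.option ?_ (side_meas M a)
  intro i
  have : Measurable fun x : ℝ × ℝ × ℝ => ⌊x.1 / a⌋ :=
    Int.measurable_floor.comp (measurable_fst.div_const a)
  exact this (MeasurableSet.of_discrete (s := {z : ℤ | (z : ZMod M) = i}))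

lemma dig_fib (M : ℕ) [NeZero M] (k : ℕ) : FibM (dig M k) := by
  intro i
  have : Measurable fun x : ℝ × ℝ × ℝ => ⌊(M : ℝ) ^ (k + 1) * x.2.1⌋ :=
    Int.measurable_floor.comp ((measurable_fst.comp measurable_snd).const_mul _)
  exact this (MeasurableSet.of_discrete (s := {z : ℤ | (z : ZMod M) = i}))

lemma sgm_meas (M : ℕ) (a : ℝ) : Measurable (sgm M a) :=
  Measurable.ite (side_meas M a) measurable_const measurable_const

lemma birk_cast (M : ℕ) (a b : ℝ) (l : ℕ) (x : ℝ × ℝ × ℝ) :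
    birkhoffSum (fabMap M a b) (fun x => (sgm M a x : ℝ)) l x =
      ((birkhoffSum (fabMap M a b) (sgm M a) l x : ℤ) : ℝ) := by
  unfold birkhoffSum; push_cast; rfl

lemma sgmR_meas (M : ℕ) (a : ℝ) : Measurable fun x => (sgm M a x : ℝ) :=
  (measurable_from_top (f := fun z : ℤ => (z : ℝ))).comp (sgm_meas M a)

lemma mask_eq (M : ℕ) (a b : ℝ) (N j i : ℕ) : maskS M a b N j i =
    {x | ∃ l ≤ N, (i : ℝ) + birkhoffSum (fabMap M a b) (fun x => (sgm M a x : ℝ)) l x < j} := by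
  ext x
  unfold maskS
  simp only [birk_cast, Set.mem_ofPred_eq]
  refine exists_congr fun l => and_congr_right fun _ => ?_
  exact_mod_cast Iff.rfl

lemma mask_meas (M : ℕ) (a b : ℝ) (hT : Measurable (fabMap M a b)) (N j i : ℕ) :
    MeasurableSet (maskS M a b N j i) := by
  rw [mask_eq]
  have : {x | ∃ l ≤ N, (i : ℝ) + birkhoffSum (fabMap M a b) (fun x => (sgm M a x : ℝ)) l x < j}
      = ⋃ l, ⋃ (_ : l ≤ N),
        {x | (i : ℝ) + birkhoffSum (fabMap M a b) (fun x => (sgm M a x : ℝ)) l x < j} := by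
    ext x; simp
  rw [this]
  refine MeasurableSet.iUnion fun l => MeasurableSet.iUnion fun _ => ?_
  exact measurableSet_lt ((birk_meas hT (sgmR_meas M a) l).const_add _) measurable_const

lemma Zs_fib (M : ℕ) [NeZero M] (a b : ℝ) (hT : Measurable (fabMap M a b)) (N j i : ℕ) :
    FibM (Zs M a b N j i) := by
  classical
  unfold Zs
  exact FibM.option (dig_fib M i) (mask_meas M a b hT N j i)

lemma sgm_int {M : ℕ} (hM : 2 ≤ M) {a : ℝ} {μ : Measure (ℝ × ℝ × ℝ)}
    (hc : ∫ x, phiC M a x ∂μ = 0) : ∫ x, (sgm M a x : ℝ) ∂μ = 0 := by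
  have hl : Real.log M ≠ 0 := (Real.log_pos (by exact_mod_cast hM)).ne'
  have : ∀ x, phiC M a x = (-Real.log M) * (sgm M a x : ℝ) := by
    intro x; unfold phiC sgm; split_ifs <;> simp
  simp only [this] at hc
  rw [integral_const_mul] at hc
  rcases mul_eq_zero.1 hc with h | h
  · exact absurd (neg_eq_zero.1 h) hl
  · exact h

lemma side_half {M : ℕ} {a : ℝ} {μ : Measure (ℝ × ℝ × ℝ)} [IsProbabilityMeasure μ]
    (hc : ∫ x, (sgm M a x : ℝ) ∂μ = 0) : μ.real {x : ℝ × ℝ × ℝ | x.1 < M * a} = 1 / 2 := by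
  have : ∀ x, (sgm M a x : ℝ) =
      2 * Set.indicator {x : ℝ × ℝ × ℝ | x.1 < M * a} (fun _ => (1 : ℝ)) x - 1 := by
    intro x
    unfold sgm
    by_cases h : x.1 < M * a <;> simp [h] <;> norm_num
  simp only [this] at hc
  rw [integral_sub, integral_const_mul, integral_indicator_const _ (side_meas M a)] at hc
  · simp at hc
    linarith
  · exact ((integrable_const _).indicator (side_meas M a)).const_mul _
  · exact integrable_const _

lemma log_sqrt_eq {M : ℕ} (hM : 2 ≤ M) :
    Real.log (Real.sqrt (4 * M)) = 1 / 2 * Real.log 2 + 1 / 2 * Real.log (2 * M) := by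
  have hM0 : (0 : ℝ) < M := by positivity
  rw [Real.log_sqrt (by positivity), show (4 : ℝ) * M = 2 * (2 * M) by ring,
    Real.log_mul (by norm_num) (by positivity)]
  ring

lemma Hf_Q {M : ℕ} [NeZero M] (hM : 2 ≤ M) {a : ℝ} {μ : Measure (ℝ × ℝ × ℝ)}
    [IsProbabilityMeasure μ] (hc : ∫ x, (sgm M a x : ℝ) ∂μ = 0) :
    Hf μ (Qs M a) ≤ Real.log (Real.sqrt (4 * M)) := by
  have hM0 : (0 : ℝ) < M := by positivity
  have hh := side_half hc
  have hn : μ.real (Qs M a ⁻¹' {none}) = 1 / 2 := by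
    have : Qs M a ⁻¹' {none} = {x : ℝ × ℝ × ℝ | x.1 < M * a}ᶜ := by
      ext x; unfold Qs; by_cases hx : x.1 < M * a <;> simp [hx]
    rw [this, probReal_compl_eq_one_sub (side_meas M a), hh]; norm_num
  have hs := sum_fib_univ μ (Qs_fib M a)
  rw [Fintype.sum_option, hn] at hs
  have := Hf_gibbs μ (Qs_fib M a) (fun o => Option.elim o (1 / 2 : ℝ) fun _ => 1 / (2 * M))
    (by intro o; cases o <;> simp <;> positivity)
    (by
      rw [Fintype.sum_option]
      simp [ZMod.card]
      field_simp
      norm_num)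
  refine this.trans (le_of_eq ?_)
  rw [Fintype.sum_option, hn, log_sqrt_eq hM]
  simp only [Option.elim]
  rw [Finset.sum_neg_distrib, ← Finset.sum_mul]
  have hs' : ∑ i : ZMod M, μ.real (Qs M a ⁻¹' {some i}) = 1 / 2 := by linarith
  rw [hs', one_div (2 * (M : ℝ)), Real.log_inv, one_div, Real.log_inv]
  ring

lemma part_le {X : Type*} [MeasurableSpace X] (μ : Measure X) [IsProbabilityMeasure μ]
    (T : X → X) (P : Finset (Set X)) (R : X → {s // s ∈ P})
    (hR : ∀ x (s : {s // s ∈ P}), x ∈ s.1 ↔ R x = s) (n : ℕ) :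
    partitionEntropy μ (refineN T P n) ≤ Hf μ (fun x (i : Fin n) => R (T^[i] x)) := by
  classical
  unfold partitionEntropy refineN Hf
  refine (Finset.sum_image_le_of_nonneg ?_).trans (le_of_eq ?_)
  · intro s _
    exact Real.negMulLog_nonneg ENNReal.toReal_nonneg
      (measureReal_le_one (μ := μ))
  · refine Finset.sum_congr rfl fun s _ => ?_
    congr 2
    congr 1
    ext x
    simp [hR, funext_iff]

end FinalAux

section MainAux
open MeasureTheory Filter Topology

lemma compact_sep {P : Finset (Set (ℝ × ℝ × ℝ))} (hP : IsFinPartition P)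
    (μ : Measure (ℝ × ℝ × ℝ)) [IsProbabilityMeasure μ] (δ : ℝ) (hδ : 0 < δ) :
    ∃ (K : Set (ℝ × ℝ × ℝ)) (ρ : ℝ), MeasurableSet K ∧ 0 < ρ ∧ μ.real Kᶜ ≤ δ ∧
      ∀ x ∈ K, ∀ y ∈ K, dist x y ≤ ρ → ∀ s ∈ P, ∀ t ∈ P, x ∈ s → y ∈ t → s = t := by
  classical
  obtain ⟨hm, hU, hdj⟩ := hP
  have huniq : ∀ x, ∀ s ∈ P, ∀ t ∈ P, x ∈ s → x ∈ t → s = t := by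
    intro x s hs t ht hxs hxt
    by_contra hne
    exact Set.disjoint_left.1 (hdj hs ht hne) hxs hxt
  set c : ℝ := P.card + 1 with hc
  have hc0 : 0 < c := by positivity
  have hex : ∀ s : {s // s ∈ P}, ∃ K ⊆ s.1, IsCompact K ∧ μ (s.1 \ K) < ENNReal.ofReal (δ / c) :=
    fun s => (hm s.1 s.2).exists_isCompact_sdiff_lt (measure_ne_top _ _)
      (by simp only [ne_eq, ENNReal.ofReal_eq_zero, not_le]; positivity)
  choose K hKs hKc hKμ using hex
  have hsep : ∀ᶠ ρ in 𝓝[>] (0 : ℝ), ∀ s t : {s // s ∈ P}, s ≠ t → ∀ x ∈ K s, ∀ y ∈ K t,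
      ρ < dist x y := by
    rw [eventually_all]
    intro s
    rw [eventually_all]
    intro t
    by_cases hst : s = t
    · exact Eventually.of_forall fun ρ h => absurd hst h
    have hd : Disjoint (K s) (K t) :=
      (hdj s.2 t.2 (fun h => hst (Subtype.ext h))).mono (hKs s) (hKs t)
    obtain ⟨r, hr, h⟩ := Metric.exists_pos_forall_lt_edist (hKc s) (hKc t).isClosed hd
    filter_upwards [Ioo_mem_nhdsGT (show (0 : ℝ) < r from hr)] with ρ hρ _ x hx y hy
    have := h x hx y hy
    rw [edist_nndist, ENNReal.coe_lt_coe] at this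
    exact hρ.2.trans (by rw [dist_nndist]; exact_mod_cast this)
  obtain ⟨ρ, hρ, hρ0⟩ := (hsep.and self_mem_nhdsWithin).exists
  refine ⟨⋃ s, K s, ρ, MeasurableSet.iUnion fun s => (hKc s).measurableSet, hρ0, ?_, ?_⟩
  · have hsub : (⋃ s, K s)ᶜ ⊆ ⋃ s ∈ (Finset.univ : Finset {s // s ∈ P}), (s.1 \ K s) := by
      intro x hx
      have : x ∈ ⋃₀ (↑P : Set (Set (ℝ × ℝ × ℝ))) := by rw [hU]; trivial
      obtain ⟨s, hs, hxs⟩ := this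
      simp only [Set.mem_iUnion]
      exact ⟨⟨s, hs⟩, Finset.mem_univ _, hxs, fun hk => hx (Set.mem_iUnion.2 ⟨_, hk⟩)⟩
    refine (measureReal_mono hsub (measure_ne_top _ _)).trans ((measureReal_biUnion_finset_le _ _).trans ?_)
    have h1 : ∀ s, μ.real (s.1 \ K s) ≤ δ / c := fun s =>
      ENNReal.toReal_le_of_le_ofReal (by positivity) (hKμ s).le
    refine (Finset.sum_le_sum fun s _ => h1 s).trans ?_
    rw [Finset.sum_const, nsmul_eq_mul, Finset.card_univ, Fintype.card_coe, mul_div_assoc',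
      div_le_iff₀ hc0, hc]
    nlinarith
  · intro x hx y hy hxy s hs t ht hxs hyt
    obtain ⟨s', hs'⟩ := Set.mem_iUnion.1 hx
    obtain ⟨t', ht'⟩ := Set.mem_iUnion.1 hy
    have e1 := huniq x s hs s'.1 s'.2 hxs (hKs _ hs')
    have e2 := huniq y t ht t'.1 t'.2 hyt (hKs _ ht')
    by_contra hne
    have : s' ≠ t' := by
      intro h; apply hne; rw [e1, e2, h]
    exact absurd (hρ s' t' this x hs' y ht') (not_lt.2 hxy)

lemma sum_cut (n : ℕ) (c e l : ℝ) (hc : 0 ≤ c) (he : 0 ≤ e) (hl : 0 ≤ l) (f : ℕ → ℝ)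
    (h1 : ∀ i, f i ≤ l) (h2 : ∀ i : ℕ, c ≤ i → f i ≤ e) :
    ∑ i ∈ Finset.range n, f i ≤ n * e + (c + 1) * l := by
  have h : ∀ i, f i ≤ e + if i < ⌈c⌉₊ then l else 0 := by
    intro i
    split_ifs with hi
    · linarith [h1 i]
    · have := h2 i (Nat.ceil_le.1 (not_lt.1 hi)); linarith
  refine (Finset.sum_le_sum fun i _ => h i).trans ?_
  rw [Finset.sum_add_distrib, Finset.sum_const, Finset.card_range, nsmul_eq_mul,
    ← Finset.sum_filter, Finset.sum_const, nsmul_eq_mul]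
  have : ((Finset.range n).filter (fun i => i < ⌈c⌉₊)).card ≤ ⌈c⌉₊ := by
    calc _ ≤ (Finset.range ⌈c⌉₊).card := Finset.card_le_card (by
            intro i hi
            simp only [Finset.mem_filter] at hi
            exact Finset.mem_range.2 hi.2)
      _ = _ := Finset.card_range _
  have h3 : ((((Finset.range n).filter (fun i => i < ⌈c⌉₊)).card : ℕ) : ℝ) ≤ c + 1 :=
    (Nat.cast_le.2 this).trans (Nat.ceil_lt_add_one hc).le
  gcongr

lemma main_bound (M : ℕ) (hM : 2 ≤ M) (a b : ℝ)
    (ha : 0 < a) (ha1 : M * a < 1) (hb : 0 < b) (hb1 : M * b < 1)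
    (μ : Measure (ℝ × ℝ × ℝ)) [IsProbabilityMeasure μ]
    (herg : Ergodic (fabMap M a b) μ)
    (hΛ : μ (LamSet M a b) = 1)
    (hc : ∫ x, phiC M a x ∂μ = 0) (P : Finset (Set (ℝ × ℝ × ℝ))) (hP : IsFinPartition P)
    (ε : ℝ) (hε : 0 < ε) :
    ∃ n : ℕ, partitionEntropy μ (refineN (fabMap M a b) P (n + 1)) / (n + 1)
      ≤ Real.log (Real.sqrt (4 * M)) + ε := by
  classical
  haveI : NeZero M := ⟨by omega⟩
  have hM0 : (0 : ℝ) < M := by positivity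
  have hM2 : (2 : ℝ) ≤ M := by exact_mod_cast hM
  set T := fabMap M a b with hTdef
  have hT : MeasurePreserving T μ μ := herg.toMeasurePreserving
  have hTm : Measurable T := hT.measurable
  have hX0 := ae_X0 hM ha ha1 hTm hΛ
  have hsg := sgm_int hM hc
  set L := Real.log (Real.sqrt (4 * M)) with hL
  -- the partition function
  have hRex : ∀ x, ∃ s : {s // s ∈ P}, x ∈ s.1 := by
    intro x
    have : x ∈ ⋃₀ (↑P : Set (Set (ℝ × ℝ × ℝ))) := by rw [hP.2.1]; trivial
    obtain ⟨s, hs, hxs⟩ := this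
    exact ⟨⟨s, hs⟩, hxs⟩
  choose R hRmem using hRex
  have hR : ∀ x (s : {s // s ∈ P}), x ∈ s.1 ↔ R x = s := by
    intro x s
    constructor
    · intro hx
      by_contra hne
      exact Set.disjoint_left.1 (hP.2.2 (R x).2 s.2 (fun h => hne (Subtype.ext h))) (hRmem x) hx
    · rintro rfl; exact hRmem x
  have hRfib : FibM R := by
    intro s
    have : R ⁻¹' {s} = s.1 := by ext x; exact (hR x s).symm
    rw [this]; exact hP.1 s.1 s.2
  -- parameters
  obtain ⟨δE, hδE, hE⟩ := Hf_option_small (X := ℝ × ℝ × ℝ) {s // s ∈ P} (ε / 4) (by positivity)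
  obtain ⟨δZ, hδZ, hZ⟩ := Hf_option_small (X := ℝ × ℝ × ℝ) (ZMod M) (ε / 4) (by positivity)
  obtain ⟨K, ρ, hKm, hρ, hKμ, hK⟩ := compact_sep hP μ δE hδE
  set lam := max (max a (1 - M * a)) (max b (1 - M * b)) with hlam
  have hl1 : a ≤ lam := (le_max_left _ _).trans (le_max_left _ _)
  have hl2 : 1 - M * a ≤ lam := (le_max_right _ _).trans (le_max_left _ _)
  have hl3 : b ≤ lam := (le_max_left _ _).trans (le_max_right _ _)
  have hl4 : 1 - M * b ≤ lam := (le_max_right _ _).trans (le_max_right _ _)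
  have hlam0 : 0 ≤ lam := ha.le.trans hl1
  have hlam1 : lam < 1 := by
    refine max_lt (max_lt ?_ ?_) (max_lt ?_ ?_) <;> nlinarith
  obtain ⟨m, hm⟩ := exists_pow_lt_of_lt_one hρ hlam1
  have hMi : 1 / (M : ℝ) < 1 := by rw [div_lt_one hM0]; linarith
  obtain ⟨j0, hj0⟩ := exists_pow_lt_of_lt_one hρ hMi
  set j := j0 + 1 with hj
  have hjρ : (1 / (M : ℝ)) ^ j < ρ :=
    lt_of_le_of_lt (pow_le_pow_of_le_one (by positivity) hMi.le (by omega)) hj0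
  set ℓ := Real.log (Fintype.card (Option (ZMod M))) with hℓ
  have hℓ0 : 0 ≤ ℓ := Real.log_natCast_nonneg _
  set κ := min δZ (ε / (4 * (ℓ + 1))) with hκ
  have hκ0 : 0 < κ := lt_min hδZ (by positivity)
  have hκℓ : κ * ℓ ≤ ε / 4 := by
    have h1 : κ ≤ ε / (4 * (ℓ + 1)) := min_le_right _ _
    have h2 : κ * (ℓ + 1) ≤ ε / 4 := by
      rw [le_div_iff₀ (by positivity)] at h1
      linarith
    nlinarith
  obtain ⟨q, hq, hqS⟩ := mean_erg herg (sgmR_meas M a) (sgm_ge M a) hsg (κ ^ 2) (by positivity)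
  -- entropies of the pieces
  set E : ℝ × ℝ × ℝ → Option {s // s ∈ P} := fun x => if x ∈ Kᶜ then some (R x) else none with hEdef
  have hEfib : FibM E := FibM.option hRfib hKm.compl
  have hHE : Hf μ E ≤ ε / 4 := hE μ R hRfib Kᶜ hKm.compl hKμ
  have hHQ : Hf μ (Qs M a) ≤ L := Hf_Q hM hsg
  have hHZ1 : ∀ N i, Hf μ (Zs M a b N j i) ≤ ℓ := fun N i => Hf_le_log_card μ (Zs_fib M a b hTm N j i)
  have hHZ2 : ∀ N : ℕ, 0 < N → ∀ i : ℕ, j + q + κ * N ≤ i → Hf μ (Zs M a b N j i) ≤ ε / 4 := by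
    intro N hN i hi
    unfold Zs
    refine hZ μ (dig M i) (dig_fib M i) _ (mask_meas M a b hTm N j i) ?_
    refine le_trans ?_ (min_le_left δZ (ε / (4 * (ℓ + 1))))
    refine le_trans (measureReal_mono ?_) (depth_est hT (sgmR_meas M a) (sgm_ge M a) hκ0 hq hqS hN
      (t := i - j) (by linarith))
    rw [mask_eq]
    rintro x ⟨l, hl, hx⟩
    exact ⟨l, hl, by linarith⟩
  -- main estimate
  have main : ∀ n : ℕ, 0 < n → partitionEntropy μ (refineN T P n) ≤
      (n + 2 * m) * L + ((n + 2 * m + j) * (ε / 4) + (j + q + κ * (n + 2 * m) + 1) * ℓ)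
        + n * (ε / 4) := by
    intro n hn
    set N := n + 2 * m with hN
    have hTi : ∀ k, MeasurePreserving T^[k] μ μ := fun k => hT.iterate k
    have f1 : ∀ k : Fin N, FibM (fun x => Qs M a (T^[k] x)) := fun k =>
      (Qs_fib M a).comp (hTi k).measurable
    have f2 : ∀ k : Fin (N + j), FibM (Zs M a b N j k) := fun k => Zs_fib M a b hTm N j k
    have f3 : ∀ k : Fin n, FibM (fun x => E (T^[m + k] x)) := fun k =>
      hEfib.comp (hTi _).measurable
    have f4 : ∀ k : Fin n, FibM (fun x => R (T^[k] x)) := fun k =>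
      hRfib.comp (hTi _).measurable
    have s1 : Hf μ (fun x (k : Fin N) => Qs M a (T^[k] x)) ≤ N * L := by
      refine (Hf_pi μ f1).trans ?_
      refine (Finset.sum_le_sum (g := fun _ => L) fun k _ => ?_).trans (by simp)
      rw [Hf_comp μ (hTi k) (Qs_fib M a)]
      exact hHQ
    have s2 : Hf μ (fun x (k : Fin (N + j)) => Zs M a b N j k x) ≤
        ((N + j : ℕ) : ℝ) * (ε / 4) + (j + q + κ * N + 1) * ℓ := by
      refine (Hf_pi μ f2).trans ?_
      rw [Fin.sum_univ_eq_sum_range (fun k => Hf μ (Zs M a b N j k))]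
      exact sum_cut (N + j) (j + q + κ * N) (ε / 4) ℓ (by positivity) (by positivity) hℓ0 _
        (hHZ1 N) (hHZ2 N (by omega))
    have s3 : Hf μ (fun x (k : Fin n) => E (T^[m + k] x)) ≤ n * (ε / 4) := by
      refine (Hf_pi μ f3).trans ?_
      refine (Finset.sum_le_sum (g := fun _ => ε / 4) fun k _ => ?_).trans (by simp)
      rw [Hf_comp μ (hTi (m + k)) hEfib]
      exact hHE
    have hdet : Hf μ (fun x (k : Fin n) => R (T^[m + k] x)) ≤
        Hf μ (fun x => ((fun (k : Fin N) => Qs M a (T^[k] x),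
          fun (k : Fin (N + j)) => Zs M a b N j k x), fun (k : Fin n) => E (T^[m + k] x))) := by
      refine Hf_mono μ (((FibM.pi f1).prod (FibM.pi f2)).prod (FibM.pi f3)) _ hX0 ?_
      intro x hx y hy hxy
      simp only [Prod.mk.injEq] at hxy
      obtain ⟨⟨e1, e2⟩, e3⟩ := hxy
      funext k
      have hk := congrFun e3 k
      simp only [hEdef] at hk
      have hdist := det_all hM ha ha1 hb hb1 hlam0 hl1 hl2 hl3 hl4 hx hy (N := N) (j := j)
        (by omega) (fun l hl => congrFun e1 ⟨l, hl⟩) (fun i hi => congrFun e2 ⟨i, hi⟩)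
        (m := m) (i := m + k) (by omega) (by have := k.2; omega)
      rw [← hTdef] at hdist
      have hdist' := hdist.trans (max_le hm.le hjρ.le)
      by_cases hxk : T^[m + k] x ∈ K
      · by_cases hyk : T^[m + k] y ∈ K
        · exact Subtype.ext (hK _ hxk _ hyk hdist' _ (R _).2 _ (R _).2 (hRmem _) (hRmem _))
        · simp [hxk, hyk] at hk
      · by_cases hyk : T^[m + k] y ∈ K
        · simp [hxk, hyk] at hk
        · simpa [hxk, hyk] using hk
    have hshift : Hf μ (fun x (k : Fin n) => R (T^[k] x)) =
        Hf μ (fun x (k : Fin n) => R (T^[m + k] x)) := by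
      rw [← Hf_comp μ (hTi m) (FibM.pi f4)]
      simp only [← Function.iterate_add_apply, add_comm]
    have hfin := (part_le μ T P R hR n).trans (hshift.le.trans (hdet.trans
      ((Hf_prod μ ((FibM.pi f1).prod (FibM.pi f2)) (FibM.pi f3)).trans
        (add_le_add ((Hf_prod μ (FibM.pi f1) (FibM.pi f2)).trans (add_le_add s1 s2)) s3))))
    refine hfin.trans (le_of_eq ?_)
    rw [hN]
    push_cast
    ring
  -- choose n
  set C := 2 * m * L + (2 * m + j) * (ε / 4) + (j + q + κ * (2 * m) + 1) * ℓ with hC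
  obtain ⟨n, hn⟩ := exists_nat_gt (4 * C / ε)
  refine ⟨n, ?_⟩
  have hmn := main (n + 1) (by omega)
  have hn1 : (0 : ℝ) < n + 1 := by positivity
  rw [div_le_iff₀ hn1]
  refine hmn.trans ?_
  push_cast
  rw [div_lt_iff₀ hε] at hn
  have h5 : (n + 1 : ℝ) * (κ * ℓ) ≤ (n + 1) * (ε / 4) := by gcongr
  nlinarith

end MainAux

/-- every ergodic `f_{a,b}`-invariant measure on `Λ` with zero central
Lyapunov exponent has entropy at most `log √(4M)`, which is strictly less than
`log (M+1)`. -/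
theorem entropy_bound_zero_center (M : ℕ) (hM : 2 ≤ M) (a b : ℝ)
    (ha : a ∈ Set.Ioo (0 : ℝ) (1 / M)) (hb : b ∈ Set.Ioo (0 : ℝ) (1 / M))
    (μ : Measure (ℝ × ℝ × ℝ)) [IsProbabilityMeasure μ]
    (herg : Ergodic (fabMap M a b) μ)
    (hΛ : μ (LamSet M a b) = 1)
    (hc : ∫ x, phiC M a x ∂μ = 0) :
    kolSinaiEntropy (fabMap M a b) μ ≤ Real.log (Real.sqrt (4 * M)) ∧
      Real.log (Real.sqrt (4 * M)) < Real.log (M + 1) := by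
  have hM0 : (0 : ℝ) < M := by positivity
  have hM2 : (2 : ℝ) ≤ M := by exact_mod_cast hM
  have ha1 : M * a < 1 := by
    have := ha.2
    rw [lt_div_iff₀ hM0] at this; linarith
  have hb1 : M * b < 1 := by
    have := hb.2
    rw [lt_div_iff₀ hM0] at this; linarith
  constructor
  · have hL0 : 0 ≤ Real.log (Real.sqrt (4 * M)) := by
      apply Real.log_nonneg
      rw [Real.one_le_sqrt]
      linarith
    unfold kolSinaiEntropy
    refine Real.iSup_le (fun P => ?_) hL0
    refine le_of_forall_pos_le_add fun ε hε => ?_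
    obtain ⟨n, hn⟩ := main_bound M hM a b ha.1 ha1 hb.1 hb1 μ herg hΛ hc P.1 P.2 ε hε
    refine le_trans (ciInf_le ⟨0, ?_⟩ n) hn
    rintro _ ⟨k, rfl⟩
    refine div_nonneg (Finset.sum_nonneg fun s _ => ?_) (by positivity)
    exact Real.negMulLog_nonneg ENNReal.toReal_nonneg (measureReal_le_one (μ := μ))
  · apply Real.log_lt_log
    · positivity
    · rw [Real.sqrt_lt' (by positivity)]
      nlinarith
end

section
/- For every f_a-invariant Borel probability measure μ on [0,1]², there exists a unique f_{a,b}-invariant Borel probability measure μ̂ on [0,1]³ with p_*(μ̂) = μ, where p is the projection to the first two coordinates. -/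
open MeasureTheory

/-- The projection `p(x_u,x_c,x_s) = (x_u,x_c)`. -/
def projMap (x : ℝ × ℝ × ℝ) : ℝ × ℝ := (x.1, x.2.1)

open Filter Topology
open scoped BoundedContinuousFunction

def skewF {X : Type*} (T : X → X) (i : X → ℕ) (G : ℕ → ℝ → ℝ) (p : X × ℝ) : X × ℝ :=
  (T p.1, G (i p.1) p.2)

lemma skewF_iter {X : Type*} (T : X → X) (i : X → ℕ) (G : ℕ → ℝ → ℝ) (l : ℝ) (hl : 0 ≤ l)
    (hG : ∀ k s t, |G k s - G k t| ≤ l * |s - t|) (n : ℕ) (x : X) (s t : ℝ) :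
    ((skewF T i G)^[n] (x, s)).1 = ((skewF T i G)^[n] (x, t)).1 ∧
    |((skewF T i G)^[n] (x, s)).2 - ((skewF T i G)^[n] (x, t)).2| ≤ l ^ n * |s - t| := by
  induction n with
  | zero => simp
  | succ n ih =>
    obtain ⟨h1, h2⟩ := ih
    rw [Function.iterate_succ_apply', Function.iterate_succ_apply']
    simp only [skewF]
    refine ⟨by rw [h1], ?_⟩
    rw [h1]
    refine (hG _ _ _).trans ?_
    rw [pow_succ', mul_assoc]
    exact mul_le_mul_of_nonneg_left h2 hl

lemma skewF_meas {X : Type*} [MeasurableSpace X] (T : X → X) (hT : Measurable T) (i : X → ℕ)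
    (hi : Measurable i) (G : ℕ → ℝ → ℝ) (hG : ∀ k, Continuous (G k)) :
    Measurable (skewF T i G) := by
  refine (hT.comp measurable_fst).prodMk ?_
  have : Measurable (fun q : ℕ × ℝ => G q.1 q.2) :=
    measurable_from_prod_countable_right (fun k => (hG k).measurable)
  exact this.comp ((hi.comp measurable_fst).prodMk measurable_snd)

lemma G_cont {G : ℕ → ℝ → ℝ} {l : ℝ} (hl : 0 ≤ l)
    (hG : ∀ k s t, |G k s - G k t| ≤ l * |s - t|) (k : ℕ) : Continuous (G k) := by
  refine (LipschitzWith.of_dist_le_mul (K := ⟨l, hl⟩) ?_).continuous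
  intro s t
  rw [Real.dist_eq, Real.dist_eq]
  exact hG k s t

lemma diff_aux (h : ℝ →ᵇ ℝ) (u v : ℕ → ℝ) (hu : ∀ n, u n ∈ Set.Icc (0:ℝ) 1)
    (hv : ∀ n, v n ∈ Set.Icc (0:ℝ) 1) (huv : Tendsto (fun n => |u n - v n|) atTop (𝓝 0)) :
    Tendsto (fun n => h (u n) - h (v n)) atTop (𝓝 0) := by
  have hc := isCompact_Icc.uniformContinuousOn_of_continuous (s := Set.Icc (0:ℝ) 1)
    h.continuous.continuousOn
  rw [Metric.uniformContinuousOn_iff] at hc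
  rw [Metric.tendsto_atTop]
  intro ε hε
  obtain ⟨δ, hδ, H⟩ := hc ε hε
  obtain ⟨N, hN⟩ := Metric.tendsto_atTop.1 huv δ hδ
  refine ⟨N, fun n hn => ?_⟩
  have h1 := hN n hn
  have h2 := H (u n) (hu n) (v n) (hv n) (by simpa [Real.dist_eq] using h1)
  simpa [Real.dist_eq] using h2

lemma int_aux {X : Type*} [MeasurableSpace X] {ν : Measure (X × ℝ)} [IsProbabilityMeasure ν]
    {u : X → ℝ} (hu : Measurable u) {C : ℝ} (hC : ∀ x, |u x| ≤ C) (h : ℝ →ᵇ ℝ)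
    {g : X × ℝ → X × ℝ} (hg : Measurable g) :
    Integrable (fun p => u (g p).1 * h (g p).2) ν := by
  refine Integrable.of_bound (C := C * ‖h‖) ?_ (ae_of_all _ fun p => ?_)
  · exact ((hu.comp (measurable_fst.comp hg)).mul
      (h.continuous.measurable.comp (measurable_snd.comp hg))).aestronglyMeasurable
  · rw [norm_mul]
    exact mul_le_mul (hC _) (h.norm_coe_le_norm _) (norm_nonneg _) ((abs_nonneg _).trans (hC (g p).1))

lemma diff_one {X : Type*} [MeasurableSpace X] (T : X → X) (hT : Measurable T) (i : X → ℕ)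
    (hi : Measurable i) (G : ℕ → ℝ → ℝ) (l : ℝ) (hl : 0 ≤ l) (hl1 : l < 1)
    (hG : ∀ k s t, |G k s - G k t| ≤ l * |s - t|) (hG1 : ∀ k s, G k s ∈ Set.Icc (0:ℝ) 1)
    (μ : Measure X)
    (ν : Measure (X × ℝ)) [IsProbabilityMeasure ν] (hν : ν.map Prod.fst = μ)
    (u : X → ℝ) (hu : Measurable u) (C : ℝ) (hC : ∀ x, |u x| ≤ C) (h : ℝ →ᵇ ℝ) :
    Tendsto (fun n => ∫ p, u ((skewF T i G)^[n] p).1 * h ((skewF T i G)^[n] p).2 ∂ν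
      - ∫ x, u ((skewF T i G)^[n] (x, 0)).1 * h ((skewF T i G)^[n] (x, 0)).2 ∂μ) atTop (𝓝 0) := by
  have hF := skewF_meas T hT i hi G (G_cont hl hG)
  have hz : Measurable (fun p : X × ℝ => (p.1, (0:ℝ))) := by fun_prop
  have key : ∀ n, ∫ x, u ((skewF T i G)^[n] (x, 0)).1 * h ((skewF T i G)^[n] (x, 0)).2 ∂μ
      = ∫ p, u ((skewF T i G)^[n] (p.1, 0)).1 * h ((skewF T i G)^[n] (p.1, 0)).2 ∂ν := by
    intro n
    have hn := hF.iterate n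
    have hz' : Measurable (fun x : X => (x, (0:ℝ))) := by fun_prop
    rw [← hν, integral_map measurable_fst.aemeasurable]
    exact ((hu.comp (measurable_fst.comp (hn.comp hz'))).mul
      (h.continuous.measurable.comp (measurable_snd.comp (hn.comp hz')))).aestronglyMeasurable
  have hint1 := fun n => int_aux (ν := ν) hu hC h (hF.iterate n)
  have hint2 := fun n => int_aux (ν := ν) hu hC h ((hF.iterate n).comp hz)
  simp only [Function.comp_apply] at hint2
  simp_rw [key]
  have e : ∀ n, (∫ p, u ((skewF T i G)^[n] p).1 * h ((skewF T i G)^[n] p).2 ∂ν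
      - ∫ p, u ((skewF T i G)^[n] (p.1, 0)).1 * h ((skewF T i G)^[n] (p.1, 0)).2 ∂ν) =
      ∫ p, (u ((skewF T i G)^[n] p).1 * h ((skewF T i G)^[n] p).2 -
        u ((skewF T i G)^[n] (p.1, 0)).1 * h ((skewF T i G)^[n] (p.1, 0)).2) ∂ν :=
    fun n => (integral_sub (hint1 n) (hint2 n)).symm
  simp_rw [e]
  rw [show 𝓝 (0:ℝ) = 𝓝 (∫ p, (0:ℝ) ∂ν) by simp]
  refine tendsto_integral_of_dominated_convergence (fun _ => C * (2 * ‖h‖))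
    (fun n => ((hint1 n).sub (hint2 n)).aestronglyMeasurable) (integrable_const _) ?_ ?_
  · intro n
    refine ae_of_all _ fun p => ?_
    obtain ⟨x, s⟩ := p
    rw [(skewF_iter T i G l hl hG n x s 0).1, ← mul_sub, norm_mul]
    refine mul_le_mul (hC _) ?_ (norm_nonneg _) ((abs_nonneg _).trans (hC x))
    refine (norm_sub_le _ _).trans ?_
    linarith [h.norm_coe_le_norm ((skewF T i G)^[n] (x, s)).2,
      h.norm_coe_le_norm ((skewF T i G)^[n] (x, 0)).2]
  · refine ae_of_all _ fun p => ?_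
    obtain ⟨x, s⟩ := p
    have hd : Tendsto (fun n => |((skewF T i G)^[n+1] (x, s)).2 -
        ((skewF T i G)^[n+1] (x, 0)).2|) atTop (𝓝 0) := by
      refine squeeze_zero (fun _ => abs_nonneg _)
        (fun n => (skewF_iter T i G l hl hG (n+1) x s 0).2) ?_
      have := ((tendsto_pow_atTop_nhds_zero_of_lt_one hl hl1).comp (tendsto_add_atTop_nat 1)).mul_const |s - 0|
      simpa using this
    have hin : ∀ q n, ((skewF T i G)^[n+1] q).2 ∈ Set.Icc (0:ℝ) 1 := by
      intro q n
      rw [Function.iterate_succ_apply']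
      exact hG1 _ _
    have hd2 := diff_aux h _ _ (hin (x, s)) (hin (x, 0)) hd
    rw [← tendsto_add_atTop_iff_nat 1]
    have hd3 : Tendsto (fun n => C * |h ((skewF T i G)^[n+1] (x, s)).2 - h ((skewF T i G)^[n+1] (x, 0)).2|)
      atTop (𝓝 0) := by simpa using hd2.abs.const_mul C
    refine squeeze_zero_norm (fun n => ?_) hd3
    dsimp only
    rw [(skewF_iter T i G l hl hG (n+1) x s 0).1, ← mul_sub, norm_mul]
    exact mul_le_mul_of_nonneg_right (hC _) (abs_nonneg _)

lemma conv_aux {X : Type*} [MetricSpace X] [SecondCountableTopology X] [MeasurableSpace X]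
    [BorelSpace X] (μ : Measure X) [IsProbabilityMeasure μ]
    (ν : ℕ → ProbabilityMeasure (X × ℝ)) (ν0 : ProbabilityMeasure (X × ℝ))
    (hlim : Tendsto ν atTop (𝓝 ν0)) (hν : ∀ n, (ν n : Measure (X × ℝ)).map Prod.fst = μ) 
    (hν0 : (ν0 : Measure (X × ℝ)).map Prod.fst = μ) 
    (u : X → ℝ) (hu : Measurable u) (C : ℝ) (hC : ∀ x, |u x| ≤ C) (h : ℝ →ᵇ ℝ) :
    Tendsto (fun n => ∫ p, u p.1 * h p.2 ∂(ν n : Measure (X × ℝ))) atTop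
      (𝓝 (∫ p, u p.1 * h p.2 ∂(ν0 : Measure (X × ℝ)))) := by
  have hui : Integrable u μ := Integrable.of_bound hu.aestronglyMeasurable C (ae_of_all _ hC)
  have approx : ∀ (v : X →ᵇ ℝ) (ρ : ProbabilityMeasure (X × ℝ)),
      (ρ : Measure (X × ℝ)).map Prod.fst = μ →
      |∫ p, u p.1 * h p.2 ∂(ρ : Measure (X × ℝ)) - ∫ p, v p.1 * h p.2 ∂(ρ : Measure (X × ℝ))|
        ≤ ‖h‖ * ∫ x, ‖u x - v x‖ ∂μ := by
    intro v ρ hρ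
    have i1 := int_aux (ν := (ρ : Measure (X × ℝ))) hu hC h measurable_id
    have i2 := int_aux (ν := (ρ : Measure (X × ℝ))) v.continuous.measurable
      v.norm_coe_le_norm h measurable_id
    simp only [id] at i1 i2
    have e1 : ∫ x, ‖u x - v x‖ ∂μ = ∫ p, ‖u p.1 - v p.1‖ ∂(ρ : Measure (X × ℝ)) := by
      rw [← hρ, integral_map measurable_fst.aemeasurable]
      exact (hu.sub v.continuous.measurable).norm.aestronglyMeasurable
    rw [← integral_sub i1 i2, e1, ← integral_const_mul]
    · rw [← Real.norm_eq_abs]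
      refine (norm_integral_le_integral_norm _).trans ?_
      have i3 : Integrable (fun x => ‖u x - v x‖) μ := (hui.sub (v.integrable μ)).norm
      rw [← hρ] at i3
      refine integral_mono (i1.sub i2).norm ((i3.comp_measurable measurable_fst).const_mul _) ?_
      intro p
      dsimp
      rw [← sub_mul, abs_mul, mul_comm]
      exact mul_le_mul_of_nonneg_right (h.norm_coe_le_norm _) (abs_nonneg _)
  rw [Metric.tendsto_atTop]
  intro ε hε
  have hpos : 0 < ‖h‖ + 1 := by positivity
  obtain ⟨v, hv, -⟩ := hui.exists_boundedContinuous_integral_sub_le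
    (ε := ε / 4 / (‖h‖ + 1)) (by positivity)
  let w : (X × ℝ) →ᵇ ℝ := (v.compContinuous ⟨Prod.fst, continuous_fst⟩) *
    (h.compContinuous ⟨Prod.snd, continuous_snd⟩)
  have hw := (ProbabilityMeasure.tendsto_iff_forall_integral_tendsto.1 hlim) w
  obtain ⟨N, hN⟩ := Metric.tendsto_atTop.1 hw (ε / 4) (by positivity)
  refine ⟨N, fun n hn => ?_⟩
  have h1 := hN n hn
  have hw' : ∀ p, w p = v p.1 * h p.2 := fun p => rfl
  simp only [hw', Real.dist_eq] at h1
  have h2 := approx v _ (hν n)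
  have h3 := approx v _ hν0
  have h4 : ‖h‖ * ∫ x, ‖u x - v x‖ ∂μ ≤ ε / 4 := by
    calc ‖h‖ * ∫ x, ‖u x - v x‖ ∂μ ≤ (‖h‖ + 1) * (ε / 4 / (‖h‖ + 1)) :=
        mul_le_mul (by linarith) hv (integral_nonneg fun _ => norm_nonneg _) hpos.le
      _ = ε / 4 := by field_simp
  rw [Real.dist_eq]
  rw [abs_le] at h2 h3
  rw [abs_lt] at h1 ⊢
  constructor <;> linarith [h1.1, h1.2, h2.1, h2.2, h3.1, h3.2]

theorem lift_abs {X : Type*} [MetricSpace X] [CompleteSpace X] [SecondCountableTopology X]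
    [MeasurableSpace X] [BorelSpace X]
    (T : X → X) (hT : Measurable T) (i : X → ℕ)
    (hi : Measurable i) (M : ℕ) (hiM : ∀ x, i x ≤ M)
    (G : ℕ → ℝ → ℝ) (l : ℝ) (hl : 0 ≤ l) (hl1 : l < 1)
    (hG : ∀ k s t, |G k s - G k t| ≤ l * |s - t|) (hG1 : ∀ k s, G k s ∈ Set.Icc (0:ℝ) 1)
    (μ : Measure X) [IsProbabilityMeasure μ] (hμ : μ.map T = μ) :
    ∃ ν : Measure (X × ℝ), IsProbabilityMeasure ν ∧ ν.map (skewF T i G) = ν ∧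
      ν.map Prod.fst = μ := by
  have hGc := G_cont hl hG
  have hF := skewF_meas T hT i hi G hGc
  have marg : ∀ ρ : Measure (X × ℝ), ρ.map Prod.fst = μ →
      (ρ.map (skewF T i G)).map Prod.fst = μ := by
    intro ρ hρ
    rw [Measure.map_map measurable_fst hF]
    have : Prod.fst ∘ skewF T i G = T ∘ Prod.fst := rfl
    rw [this, ← Measure.map_map hT measurable_fst, hρ, hμ]
  let ρ : Measure (X × ℝ) := μ.prod (Measure.dirac 0)
  have hρ : ρ.map Prod.fst = μ := by simp [ρ, ← Measure.fst.eq_1]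
  let N : ℕ → ProbabilityMeasure (X × ℝ) := fun n =>
    ⟨ρ.map ((skewF T i G)^[n]), Measure.isProbabilityMeasure_map (hF.iterate n).aemeasurable⟩
  have hN : ∀ n, (N n : Measure (X × ℝ)) = ρ.map ((skewF T i G)^[n]) := fun n => rfl
  have hNs : ∀ n, (N (n+1) : Measure (X × ℝ)) = (N n : Measure (X × ℝ)).map (skewF T i G) := by
    intro n
    rw [hN, hN, Measure.map_map hF (hF.iterate n), Function.iterate_succ']
  have hNm : ∀ n, (N n : Measure (X × ℝ)).map Prod.fst = μ := by
    intro n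
    induction n with
    | zero => rw [hN]; simpa using hρ
    | succ n ih => rw [hNs]; exact marg _ ih
  have hNI : ∀ n, (N (n+1) : Measure (X × ℝ)) (Prod.snd ⁻¹' (Set.Icc (0:ℝ) 1)ᶜ) = 0 := by
    intro n
    rw [hNs, Measure.map_apply hF (measurable_snd measurableSet_Icc.compl)]
    convert measure_empty (μ := (N n : Measure (X × ℝ)))
    ext p
    simpa [skewF] using hG1 (i p.1) p.2
  have tight : IsTightMeasureSet {x : Measure (X × ℝ) | ∃ m ∈ Set.range (fun n => N (n+1)),
      (m : Measure (X × ℝ)) = x} := by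
    rw [isTightMeasureSet_iff_exists_isCompact_measure_compl_le]
    intro ε hε
    obtain ⟨K, hK, hKε⟩ := isTightMeasureSet_iff_exists_isCompact_measure_compl_le.1
      (isTightMeasureSet_singleton (μ := μ)) ε hε
    refine ⟨K ×ˢ Set.Icc (0:ℝ) 1, hK.prod isCompact_Icc, ?_⟩
    rintro _ ⟨_, ⟨n, rfl⟩, rfl⟩
    have hsub : (K ×ˢ Set.Icc (0:ℝ) 1)ᶜ ⊆ Prod.fst ⁻¹' Kᶜ ∪ Prod.snd ⁻¹' (Set.Icc (0:ℝ) 1)ᶜ := by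
      intro p hp
      simp only [Set.mem_compl_iff, Set.mem_prod, not_and_or] at hp
      exact hp
    refine (measure_mono hsub).trans ((measure_union_le _ _).trans ?_)
    dsimp only
    rw [hNI, add_zero, ← Measure.map_apply measurable_fst hK.measurableSet.compl, hNm]
    exact hKε μ rfl
  obtain ⟨ν0, -, φ, hφ, hlim⟩ := (isCompact_closure_of_isTightMeasureSet tight).tendsto_subseq
    (x := fun n => N (n+1)) (fun n => subset_closure ⟨n, rfl⟩)
  have hν0 : (ν0 : Measure (X × ℝ)).map Prod.fst = μ := by
    have h1 := ProbabilityMeasure.tendsto_map_of_tendsto_of_continuous _ _ hlim continuous_fst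
    have h2 : ∀ n, (((fun n => N (n+1)) ∘ φ) n).map (f := Prod.fst) measurable_fst.aemeasurable
        = (⟨μ, inferInstance⟩ : ProbabilityMeasure X) := by
      intro n
      apply Subtype.ext
      exact hNm _
    simp_rw [h2] at h1
    have h3 := tendsto_nhds_unique h1 tendsto_const_nhds
    exact congrArg Subtype.val h3
  refine ⟨ν0, inferInstance, ?_, hν0⟩
  have hp : IsProbabilityMeasure ((ν0 : Measure (X × ℝ)).map (skewF T i G)) :=
    Measure.isProbabilityMeasure_map hF.aemeasurable
  refine Measure.ext_of_integral_mul_boundedContinuousFunction fun u h => ?_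
  have hum := u.continuous.measurable
  have mm : Measurable (fun p : X × ℝ => u p.1 * h p.2) :=
    (hum.comp measurable_fst).mul (h.continuous.measurable.comp measurable_snd)
  rw [integral_map hF.aemeasurable mm.aestronglyMeasurable]
  have lim1 := conv_aux μ _ ν0 hlim (fun n => hNm _) hν0 u hum ‖u‖ u.norm_coe_le_norm h
  -- the limit for the composed test function
  let U : ℕ → X → ℝ := fun k => (i ⁻¹' {k}).indicator (fun x => u (T x))
  have hU : ∀ k, Measurable (U k) := fun k =>
    (hum.comp hT).indicator (hi (measurableSet_singleton k))
  have hUb : ∀ k x, |U k x| ≤ ‖u‖ := by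
    intro k x
    simp only [U, Set.indicator]
    split_ifs
    · exact u.norm_coe_le_norm _
    · simp
  let H : ℕ → ℝ →ᵇ ℝ := fun k => h.compContinuous ⟨G k, hGc k⟩
  have decomp : ∀ p : X × ℝ, u (skewF T i G p).1 * h (skewF T i G p).2 =
      ∑ k ∈ Finset.range (M+1), U k p.1 * H k p.2 := by
    intro p
    rw [Finset.sum_eq_single (i p.1)]
    · simp [U, H, skewF]
    · intro k _ hk
      have : i p.1 ≠ k := fun h => hk h.symm
      simp [U, this]
    · intro hk
      exact absurd (Finset.mem_range.2 (Nat.lt_succ_of_le (hiM p.1))) hk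
  have dint : ∀ m : ProbabilityMeasure (X × ℝ),
      ∫ p, u (skewF T i G p).1 * h (skewF T i G p).2 ∂(m : Measure (X × ℝ)) =
      ∑ k ∈ Finset.range (M+1), ∫ p, U k p.1 * H k p.2 ∂(m : Measure (X × ℝ)) := by
    intro m
    simp_rw [decomp]
    exact integral_finsetSum _ fun k _ =>
      int_aux (ν := (m : Measure (X × ℝ))) (hU k) (hUb k) (H k) measurable_id
  have lim2 : Tendsto (fun n => ∫ p, u (skewF T i G p).1 * h (skewF T i G p).2
      ∂(((fun n => N (n+1)) ∘ φ) n : Measure (X × ℝ))) atTop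
      (𝓝 (∫ p, u (skewF T i G p).1 * h (skewF T i G p).2 ∂(ν0 : Measure (X × ℝ)))) := by
    simp_rw [dint]
    exact tendsto_finsetSum _ fun k _ =>
      conv_aux μ _ ν0 hlim (fun n => hNm _) hν0 (U k) (hU k) ‖u‖ (hUb k) (H k)
  have hp1 : IsProbabilityMeasure (ρ.map (skewF T i G)) :=
    Measure.isProbabilityMeasure_map hF.aemeasurable
  have d1 := diff_one T hT i hi G l hl hl1 hG hG1 μ ρ hρ u hum ‖u‖ u.norm_coe_le_norm h
  have d2 := diff_one T hT i hi G l hl hl1 hG hG1 μ _ (marg ρ hρ) u hum ‖u‖ u.norm_coe_le_norm h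
  have d3 : Tendsto (fun n => ∫ p, u (skewF T i G p).1 * h (skewF T i G p).2
      ∂(N n : Measure (X × ℝ)) - ∫ p, u p.1 * h p.2 ∂(N n : Measure (X × ℝ))) atTop (𝓝 0) := by
    have d4 := d2.sub d1
    rw [sub_zero] at d4
    refine d4.congr fun n => ?_
    have mn : Measurable (fun p : X × ℝ => u ((skewF T i G)^[n] p).1 *
      h ((skewF T i G)^[n] p).2) := mm.comp (hF.iterate n)
    have mF : Measurable (fun p : X × ℝ => u (skewF T i G p).1 *
      h (skewF T i G p).2) := mm.comp hF
    rw [hN, integral_map hF.aemeasurable mn.aestronglyMeasurable,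
      integral_map (hF.iterate n).aemeasurable mF.aestronglyMeasurable,
      integral_map (hF.iterate n).aemeasurable mm.aestronglyMeasurable]
    simp_rw [← Function.iterate_succ_apply' (skewF T i G), Function.iterate_succ_apply]
    ring
  have d5 := (d3.comp (tendsto_add_atTop_nat 1)).comp hφ.tendsto_atTop
  have d6 := tendsto_nhds_unique d5 (lim2.sub lim1)
  linarith

theorem lift_unique {X : Type*} [MetricSpace X] [SecondCountableTopology X]
    [MeasurableSpace X] [BorelSpace X]
    (T : X → X) (hT : Measurable T) (i : X → ℕ)
    (hi : Measurable i)
    (G : ℕ → ℝ → ℝ) (l : ℝ) (hl : 0 ≤ l) (hl1 : l < 1)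
    (hG : ∀ k s t, |G k s - G k t| ≤ l * |s - t|) (hG1 : ∀ k s, G k s ∈ Set.Icc (0:ℝ) 1)
    (μ : Measure X)
    (ν ν' : Measure (X × ℝ)) [IsProbabilityMeasure ν] [IsProbabilityMeasure ν']
    (h1 : ν.map (skewF T i G) = ν) (h1' : ν'.map (skewF T i G) = ν')
    (h2 : ν.map Prod.fst = μ) (h2' : ν'.map Prod.fst = μ) : ν = ν' := by
  have hF := skewF_meas T hT i hi G (G_cont hl hG)
  refine Measure.ext_of_integral_mul_boundedContinuousFunction fun u h => ?_
  have hum := u.continuous.measurable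
  have mm : Measurable (fun p : X × ℝ => u p.1 * h p.2) :=
    (hum.comp measurable_fst).mul (h.continuous.measurable.comp measurable_snd)
  have inv : ∀ m : Measure (X × ℝ), m.map (skewF T i G) = m → ∀ n,
      ∫ p, u ((skewF T i G)^[n] p).1 * h ((skewF T i G)^[n] p).2 ∂m = ∫ p, u p.1 * h p.2 ∂m := by
    intro m hm n
    have hmp : MeasurePreserving (skewF T i G) m m := ⟨hF, hm⟩
    have := (hmp.iterate n).map_eq
    conv_rhs => rw [← this]
    rw [integral_map (hF.iterate n).aemeasurable mm.aestronglyMeasurable]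
  have d1 := diff_one T hT i hi G l hl hl1 hG hG1 μ ν h2 u hum ‖u‖ u.norm_coe_le_norm h
  have d2 := diff_one T hT i hi G l hl hl1 hG hG1 μ ν' h2' u hum ‖u‖ u.norm_coe_le_norm h
  simp_rw [inv ν h1] at d1
  simp_rw [inv ν' h1'] at d2
  have d3 := d1.sub d2
  simp only [sub_sub_sub_cancel_right, sub_zero] at d3
  have := tendsto_nhds_unique d3 tendsto_const_nhds
  linarith

lemma faMap_meas (M : ℕ) (a : ℝ) : Measurable (faMap M a) := by
  unfold faMap
  refine Measurable.ite (measurableSet_lt measurable_fst measurable_const) ?_ ?_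
  · refine Measurable.prodMk (measurable_fst.div_const a).fract ?_
    exact (measurable_snd.div_const _).add
      (((measurable_from_top (f := fun z : ℤ => (z:ℝ))).comp
        (measurable_fst.div_const a).floor).div_const _)
  · refine Measurable.prodMk (by fun_prop) ?_
    exact Measurable.ite (measurable_snd (measurableSet_singleton (1:ℝ))) measurable_const
      (measurable_snd.const_mul _).fract

lemma fabMap_meas (M : ℕ) (a b : ℝ) : Measurable (fabMap M a b) := by
  have hp : Measurable (fun p : ℝ × ℝ × ℝ => faMap M a (p.1, p.2.1)) :=
    (faMap_meas M a).comp (by fun_prop)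
  unfold fabMap
  refine Measurable.ite (measurableSet_lt measurable_fst measurable_const) ?_ ?_
  · exact (measurable_fst.comp hp).prodMk ((measurable_snd.comp hp).prodMk (by fun_prop))
  · refine (measurable_fst.comp hp).prodMk ((measurable_snd.comp hp).prodMk ?_)
    have hs : Measurable (fun p : ℝ × ℝ × ℝ => p.2.1) := by fun_prop
    have : Measurable (fun p : ℝ × ℝ × ℝ => 
      (if p.2.1 = 1 then (M : ℝ) else (⌊(M : ℝ) * p.2.1⌋ : ℝ) + 1)) :=
      Measurable.ite (hs (measurableSet_singleton (1:ℝ))) measurable_const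
       (((measurable_from_top (f := fun z : ℤ => (z:ℝ))).comp (hs.const_mul _).floor).add_const _)
    exact ((measurable_snd.comp measurable_snd).const_mul b |>.add_const 1).add
      (((this.sub_const _).sub_const _).const_mul b)

noncomputable def idx (M : ℕ) (a : ℝ) (x : ℝ × ℝ) : ℕ :=
  if x.1 < M * a then 0 else if x.2 = 1 then M else min (⌊(M:ℝ) * x.2⌋₊ + 1) M

lemma idx_meas (M : ℕ) (a : ℝ) : Measurable (idx M a) := by
  unfold idx
  refine Measurable.ite (measurableSet_lt measurable_fst measurable_const) measurable_const ?_
  refine Measurable.ite (measurable_snd (measurableSet_singleton (1:ℝ))) measurable_const ?_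
  exact ((measurable_snd.const_mul _).nat_floor.add_const 1).min measurable_const

lemma idx_le (M : ℕ) (a : ℝ) (x) : idx M a x ≤ M := by
  unfold idx
  split_ifs <;> simp

/-- clamp to the unit interval -/
noncomputable def clam (s : ℝ) : ℝ := max 0 (min 1 s)

lemma clam_mem (s : ℝ) : 0 ≤ clam s ∧ clam s ≤ 1 := by
  unfold clam
  exact ⟨le_max_left _ _, max_le zero_le_one (min_le_left _ _)⟩

lemma clam_eq (s : ℝ) (h0 : 0 ≤ s) (h1 : s ≤ 1) : clam s = s := by
  unfold clam
  rw [min_eq_right h1, max_eq_right h0]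

lemma clam_lip (s t : ℝ) : |clam s - clam t| ≤ |s - t| := by
  unfold clam
  have h1 := abs_max_sub_max_le_abs (min 1 s) (min 1 t) 0
  have h2 := abs_inf_sub_inf_le_abs s t 1
  rw [max_comm 0, max_comm 0]
  refine h1.trans ?_
  rw [min_comm 1, min_comm 1]
  exact h2

noncomputable def fibG (M : ℕ) (b : ℝ) (k : ℕ) (s : ℝ) : ℝ :=
  if k = 0 then (1 - M * b) * clam s else b * clam s + 1 + b * ((min k M : ℕ) - M - 1)

lemma fibG_mem (M : ℕ) (hM : 2 ≤ M) (b : ℝ) (hb : 0 < b) (hb1 : M * b < 1) (k : ℕ) (s : ℝ) :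
    fibG M b k s ∈ Set.Icc (0:ℝ) 1 := by
  obtain ⟨h0, h1⟩ := clam_mem s
  unfold fibG
  have hM' : (2:ℝ) ≤ M := by exact_mod_cast hM
  split_ifs with hk
  · constructor
    · exact mul_nonneg (by linarith) h0
    · have : 0 ≤ M * b := by positivity
      nlinarith
  · have k1 : (1:ℝ) ≤ (min k M : ℕ) := by
      exact_mod_cast (by omega : 1 ≤ min k M)
    have k2 : ((min k M : ℕ) : ℝ) ≤ M := by exact_mod_cast min_le_right k M
    constructor <;> nlinarith

lemma fibG_lip (M : ℕ) (b : ℝ) (hb : 0 < b) (hb1 : M * b < 1) (k : ℕ)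
    (s t : ℝ) : |fibG M b k s - fibG M b k t| ≤ max b (1 - M * b) * |s - t| := by
  have h := clam_lip s t
  unfold fibG
  split_ifs with hk
  · rw [← mul_sub, abs_mul, abs_of_pos (by linarith)]
    exact mul_le_mul (le_max_right _ _) h (abs_nonneg _) (hb.le.trans (le_max_left _ _))
  · have : ∀ z : ℝ, b * clam s + 1 + z - (b * clam t + 1 + z) = b * (clam s - clam t) := by
      intro z; ring
    rw [this, abs_mul, abs_of_pos hb]
    exact mul_le_mul (le_max_left _ _) h (abs_nonneg _) (hb.le.trans (le_max_left _ _))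

lemma fab_eq (M : ℕ) (hM : 2 ≤ M) (a b : ℝ) (x y s : ℝ) (hy0 : 0 ≤ y) (hy1 : y ≤ 1)
    (hs0 : 0 ≤ s) (hs1 : s ≤ 1) :
    fabMap M a b (x, y, s) =
      MeasurableEquiv.prodAssoc (skewF (faMap M a) (idx M a) (fibG M b) ((x, y), s)) := by
  have hM' : (2:ℝ) ≤ M := by exact_mod_cast hM
  have e : ∀ q : (ℝ × ℝ) × ℝ, MeasurableEquiv.prodAssoc q = (q.1.1, q.1.2, q.2) := fun _ => rfl
  rw [e]
  simp only [fabMap, skewF, fibG, clam_eq s hs0 hs1, idx]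
  by_cases hx : x < M * a
  · simp [hx]
  · by_cases hy : y = 1
    · simp [hx, hy, show M ≠ 0 by omega]
    · have hlt : y < 1 := lt_of_le_of_ne hy1 hy
      have hnn : 0 ≤ (M:ℝ) * y := by positivity
      have hfl : ⌊(M:ℝ) * y⌋₊ < M := by
        rw [Nat.floor_lt hnn]
        nlinarith
      have hmin : min (⌊(M:ℝ) * y⌋₊ + 1) M = ⌊(M:ℝ) * y⌋₊ + 1 := min_eq_left hfl
      have hc : (⌊(M:ℝ) * y⌋ : ℝ) = (⌊(M:ℝ) * y⌋₊ : ℝ) := (natCast_floor_eq_intCast_floor hnn).symm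
      simp [hx, hy, hmin, hc]

/-- every `f_a`-invariant Borel probability measure `μ` on `[0,1]²` has a
unique `f_{a,b}`-invariant Borel probability lift `μ̂` on `[0,1]³` with `p_* μ̂ = μ`. -/
theorem exists_unique_invariant_lift (M : ℕ) (hM : 2 ≤ M) (a b : ℝ)
    (ha : a ∈ Set.Ioo (0 : ℝ) (1 / M)) (hb : b ∈ Set.Ioo (0 : ℝ) (1 / M))
    (μ : Measure (ℝ × ℝ)) [IsProbabilityMeasure μ]
    (hμsq : μ (Set.Icc 0 1 ×ˢ Set.Icc (0:ℝ) 1) = 1)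
    (hμinv : μ.map (faMap M a) = μ) :
    ∃! μhat : Measure (ℝ × ℝ × ℝ),
      IsProbabilityMeasure μhat ∧
      μhat (Set.Icc 0 1 ×ˢ Set.Icc 0 1 ×ˢ Set.Icc (0:ℝ) 1) = 1 ∧
      μhat.map (fabMap M a b) = μhat ∧
      μhat.map projMap = μ := by
  obtain ⟨hb0, hb2⟩ := hb
  have hM' : (2:ℝ) ≤ M := by exact_mod_cast hM
  have hb1 : M * b < 1 := by
    rw [lt_div_iff₀ (by linarith)] at hb2
    linarith
  have hlt : max b (1 - M * b) < 1 := by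
    refine max_lt ?_ ?_ <;> nlinarith
  have hl0 : 0 ≤ max b (1 - M * b) := hb0.le.trans (le_max_left _ _)
  have hT := faMap_meas M a
  have hf := fabMap_meas M a b
  have hi := idx_meas M a
  have hG := fibG_lip M b hb0 hb1
  have hG1 := fibG_mem M hM b hb0 hb1
  have hF := skewF_meas (faMap M a) hT (idx M a) hi (fibG M b) (G_cont hl0 hG)
  have hproj : Measurable projMap := by unfold projMap; fun_prop
  let e : (ℝ × ℝ) × ℝ ≃ᵐ ℝ × ℝ × ℝ := MeasurableEquiv.prodAssoc
  have he : ∀ q, e q = (q.1.1, q.1.2, q.2) := fun _ => rfl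
  have hes : ∀ x y s, e.symm (x, y, s) = ((x, y), s) := fun _ _ _ => rfl
  obtain ⟨ν, hνp, hνF, hνm⟩ := lift_abs (faMap M a) hT (idx M a) hi M (idx_le M a) (fibG M b)
    _ hl0 hlt hG hG1 μ hμinv
  have hsq : MeasurableSet (Set.Icc 0 1 ×ˢ Set.Icc (0:ℝ) 1 : Set (ℝ × ℝ)) :=
    measurableSet_Icc.prod measurableSet_Icc
  have hcube : MeasurableSet
      (Set.Icc 0 1 ×ˢ Set.Icc 0 1 ×ˢ Set.Icc (0:ℝ) 1 : Set (ℝ × ℝ × ℝ)) :=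
    measurableSet_Icc.prod hsq
  have ae1 : ∀ᵐ x ∂μ, x ∈ (Set.Icc 0 1 ×ˢ Set.Icc (0:ℝ) 1 : Set (ℝ × ℝ)) :=
    (prob_compl_eq_zero_iff hsq).2 hμsq
  have ae2 : ∀ᵐ q ∂ν, q.1 ∈ (Set.Icc 0 1 ×ˢ Set.Icc (0:ℝ) 1 : Set (ℝ × ℝ)) := by
    rw [← hνm] at ae1
    exact ae_of_ae_map measurable_fst.aemeasurable ae1
  have ae3 : ∀ᵐ q ∂ν, q.2 ∈ Set.Icc (0:ℝ) 1 := by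
    rw [← hνF, ae_map_iff hF.aemeasurable (measurable_snd measurableSet_Icc)]
    exact ae_of_all _ fun q => hG1 _ _
  refine ⟨ν.map e, ⟨Measure.isProbabilityMeasure_map e.measurable.aemeasurable, ?_, ?_, ?_⟩, ?_⟩
  · rw [Measure.map_apply e.measurable hcube, ← prob_compl_eq_zero_iff (e.measurable hcube)]
    change ∀ᵐ q ∂ν, q ∈ e ⁻¹' _
    filter_upwards [ae2, ae3] with q h1 h2
    exact ⟨h1.1, h1.2, h2⟩
  · rw [Measure.map_map hf e.measurable]
    have : fabMap M a b ∘ e =ᵐ[ν] e ∘ skewF (faMap M a) (idx M a) (fibG M b) := by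
      filter_upwards [ae2, ae3] with q h1 h2
      exact fab_eq M hM a b q.1.1 q.1.2 q.2 h1.2.1 h1.2.2 h2.1 h2.2
    rw [Measure.map_congr this, ← Measure.map_map e.measurable hF, hνF]
  · rw [Measure.map_map hproj e.measurable]
    exact hνm
  · rintro m ⟨hmp, hmc, hmf, hmm⟩
    have hp' : IsProbabilityMeasure (m.map e.symm) :=
      Measure.isProbabilityMeasure_map e.symm.measurable.aemeasurable
    have aem : ∀ᵐ x ∂m, x ∈ (Set.Icc 0 1 ×ˢ Set.Icc 0 1 ×ˢ Set.Icc (0:ℝ) 1 : Set (ℝ × ℝ × ℝ)) :=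
      (prob_compl_eq_zero_iff hcube).2 hmc
    have i1 : (m.map e.symm).map (skewF (faMap M a) (idx M a) (fibG M b)) = m.map e.symm := by
      rw [Measure.map_map hF e.symm.measurable]
      have : skewF (faMap M a) (idx M a) (fibG M b) ∘ e.symm =ᵐ[m] e.symm ∘ fabMap M a b := by
        filter_upwards [aem] with q h
        have := fab_eq M hM a b q.1 q.2.1 q.2.2 h.2.1.1 h.2.1.2 h.2.2.1 h.2.2.2
        change _ = e.symm (fabMap M a b (q.1, q.2.1, q.2.2))
        rw [this]
        exact (e.symm_apply_apply _).symm
      rw [Measure.map_congr this, ← Measure.map_map e.symm.measurable hf, hmf]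
    have i2 : (m.map e.symm).map Prod.fst = μ := by
      rw [Measure.map_map measurable_fst e.symm.measurable]
      exact hmm
    have := lift_unique (faMap M a) hT (idx M a) hi (fibG M b) _ hl0 hlt hG hG1 μ
      (m.map e.symm) ν i1 hνF i2 hνm
    rw [← this, Measure.map_map e.measurable e.symm.measurable]
    simp
end

section
/- The entropy of the Lebesgue measure with respect to the heterochaos baker map F_a equals -(1-Ma)·log((1-Ma)/M) - Ma·log(Ma) for a ∈ (0, 1/(2M)), and equals -Ma·log a - (1-Ma)·log(1-Ma) for a ∈ (1/(2M), 1/M). Moreover, on (0,1/(2M)) this entropy equals log(M+1) if and only if a = 1/(M(M+1)), and on (1/(2M),1/M) it equals log(M+1) if and only if a = 1/(M+1). -/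
open MeasureTheory

namespace HB

noncomputable def H {X ι : Type*} [MeasurableSpace X] [Fintype ι] (μ : Measure X) (f : X → ι) : ℝ :=
  ∑ i, Real.negMulLog (μ.real (f ⁻¹' {i}))

def fN {X ι : Type*} (T : X → X) (f : X → ι) (n : ℕ) (x : X) : Fin n → ι :=
  fun i => f (T^[(i : ℕ)] x)

lemma gibbs {p s : ℝ} (hp : 0 ≤ p) (hs : 0 ≤ s) (h : s = 0 → p = 0) :
    Real.negMulLog p ≤ -p * Real.log s + (s - p) := by
  rcases hp.eq_or_lt with rfl | hp
  · simp [hs]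
  · have hs' : 0 < s := lt_of_le_of_ne hs (fun h' => by have := h h'.symm; linarith)
    have := Real.log_le_sub_one_of_pos (div_pos hs' hp)
    rw [Real.log_div hs'.ne' hp.ne'] at this
    have h2 := mul_le_mul_of_nonneg_left this hp.le
    have h3 : p * (s / p - 1) = s - p := by field_simp
    rw [h3] at h2
    unfold Real.negMulLog
    nlinarith

lemma negMulLog_sum_le {κ : Type*} (s : Finset κ) (a : κ → ℝ) (h : ∀ k ∈ s, 0 ≤ a k) :
    Real.negMulLog (∑ k ∈ s, a k) ≤ ∑ k ∈ s, Real.negMulLog (a k) := by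
  unfold Real.negMulLog
  rw [neg_mul, Finset.sum_mul, ← Finset.sum_neg_distrib]
  apply Finset.sum_le_sum
  intro k hk
  rcases (h k hk).eq_or_lt with h0 | h0
  · simp [← h0]
  · have : Real.log (a k) ≤ Real.log (∑ k ∈ s, a k) :=
      Real.log_le_log h0 (Finset.single_le_sum h hk)
    nlinarith

section
variable {X ι κ : Type*} [MeasurableSpace X] [Fintype ι] [Fintype κ]
  [MeasurableSpace ι] [MeasurableSingletonClass ι] [MeasurableSpace κ] [MeasurableSingletonClass κ]

lemma sum_fibre (μ : Measure X) [IsFiniteMeasure μ] {g : X → κ} (hg : Measurable g) (A : Set X) :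
    ∑ k, μ.real (A ∩ g ⁻¹' {k}) = μ.real A := by
  have h : A = ⋃ k ∈ (Finset.univ : Finset κ), (A ∩ g ⁻¹' {k}) := by
    ext x; simp
  have hd : (↑(Finset.univ : Finset κ) : Set κ).PairwiseDisjoint (fun k => g ⁻¹' {k}) := by
    intro i _ j _ hij
    refine Set.disjoint_left.2 ?_
    intro x hx hx'
    simp at hx hx'
    exact hij (hx.symm.trans hx')
  have hU : (⋃ k ∈ (Finset.univ : Finset κ), g ⁻¹' {k}) = Set.univ := by ext; simp
  have := measureReal_biUnion_finset (μ := μ.restrict A) hd (fun k _ => hg (measurableSet_singleton k))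
  rw [hU] at this
  simp only [measureReal_restrict_apply MeasurableSet.univ, Set.univ_inter] at this
  rw [this]
  refine Finset.sum_congr rfl fun k _ => ?_
  rw [measureReal_restrict_apply (hg (measurableSet_singleton k)), Set.inter_comm]

lemma H_nonneg (μ : Measure X) [IsProbabilityMeasure μ] (f : X → ι) : 0 ≤ H μ f :=
  Finset.sum_nonneg fun _ _ => Real.negMulLog_nonneg measureReal_nonneg measureReal_le_one

lemma real_inter_G (μ : Measure X) [IsProbabilityMeasure μ] {G : Set X} (hG : μ Gᶜ = 0) (A : Set X) :
    μ.real (A ∩ G) = μ.real A := by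
  unfold Measure.real
  rw [measure_inter_conull hG]

lemma H_le (μ : Measure X) [IsProbabilityMeasure μ] {G : Set X} (hG : μ Gᶜ = 0)
    {f : X → ι} {g : X → κ} (hf : Measurable f) (hg : Measurable g)
    (h : ∀ x ∈ G, ∀ y ∈ G, g x = g y → f x = f y) : H μ f ≤ H μ g := by
  classical
  unfold H
  calc ∑ i, Real.negMulLog (μ.real (f ⁻¹' {i}))
      = ∑ i, Real.negMulLog (∑ k, μ.real (f ⁻¹' {i} ∩ g ⁻¹' {k})) := by
        simp_rw [sum_fibre μ hg]
    _ ≤ ∑ i, ∑ k, Real.negMulLog (μ.real (f ⁻¹' {i} ∩ g ⁻¹' {k})) :=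
        Finset.sum_le_sum fun i _ => negMulLog_sum_le _ _ fun _ _ => measureReal_nonneg
    _ = ∑ k, ∑ i, Real.negMulLog (μ.real (f ⁻¹' {i} ∩ g ⁻¹' {k})) := Finset.sum_comm
    _ ≤ ∑ k, Real.negMulLog (μ.real (g ⁻¹' {k})) := by
        refine Finset.sum_le_sum fun k _ => ?_
        by_cases hk : ∃ x ∈ G, g x = k
        · obtain ⟨x, hx, rfl⟩ := hk
          have h0 : ∀ i ≠ f x, μ.real (f ⁻¹' {i} ∩ g ⁻¹' {g x}) = 0 := by
            intro i hi
            rw [← real_inter_G μ hG]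
            have : (f ⁻¹' {i} ∩ g ⁻¹' {g x} ∩ G) = ∅ := by
              ext y
              simp only [Set.mem_inter_iff, Set.mem_preimage, Set.mem_singleton_iff,
                Set.mem_empty_iff_false, iff_false]
              rintro ⟨⟨h1, h2⟩, h3⟩
              exact hi (h1 ▸ h y h3 x hx h2)
            rw [this]; simp
          have h1 : μ.real (f ⁻¹' {f x} ∩ g ⁻¹' {g x}) = μ.real (g ⁻¹' {g x}) := by
            have := sum_fibre μ hf (g ⁻¹' {g x})
            rw [Finset.sum_eq_single (f x)] at this
            · rw [Set.inter_comm]; exact this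
            · intro i _ hi; rw [Set.inter_comm]; exact h0 i hi
            · simp
          rw [Finset.sum_eq_single (f x), h1]
          · intro i _ hi; rw [h0 i hi]; simp
          · simp
        · have h0 : ∀ i, μ.real (f ⁻¹' {i} ∩ g ⁻¹' {k}) = 0 := by
            intro i
            rw [← real_inter_G μ hG]
            have : (f ⁻¹' {i} ∩ g ⁻¹' {k} ∩ G) = ∅ := by
              ext y
              simp only [Set.mem_inter_iff, Set.mem_preimage, Set.mem_singleton_iff,
                Set.mem_empty_iff_false, iff_false]
              rintro ⟨⟨h1, h2⟩, h3⟩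
              exact hk ⟨y, h3, h2⟩
            rw [this]; simp
          simp only [h0, Real.negMulLog_zero, Finset.sum_const_zero]
          exact Real.negMulLog_nonneg measureReal_nonneg measureReal_le_one

lemma preimage_pair (f : X → ι) (g : X → κ) (i : ι) (k : κ) :
    (fun x => (f x, g x)) ⁻¹' {(i, k)} = f ⁻¹' {i} ∩ g ⁻¹' {k} := by
  ext; simp

lemma H_pair (μ : Measure X) [IsProbabilityMeasure μ]
    {f : X → ι} {g : X → κ} (hf : Measurable f) (hg : Measurable g) :
    H μ (fun x => (f x, g x)) ≤ H μ f + H μ g := by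
  have hr : ∀ i, ∑ k, μ.real (f ⁻¹' {i} ∩ g ⁻¹' {k}) = μ.real (f ⁻¹' {i}) :=
    fun i => sum_fibre μ hg _
  have hc : ∀ k, ∑ i, μ.real (f ⁻¹' {i} ∩ g ⁻¹' {k}) = μ.real (g ⁻¹' {k}) := by
    intro k
    rw [← sum_fibre μ hf (g ⁻¹' {k})]
    exact Finset.sum_congr rfl fun i _ => by rw [Set.inter_comm]
  have hf1 : ∑ i, μ.real (f ⁻¹' {i}) = 1 := by
    have := sum_fibre μ hf Set.univ; simpa using this
  have hg1 : ∑ i, μ.real (g ⁻¹' {i}) = 1 := by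
    have := sum_fibre μ hg Set.univ; simpa using this
  unfold H
  rw [Fintype.sum_prod_type]
  simp_rw [preimage_pair]
  have key : ∀ i k, Real.negMulLog (μ.real (f ⁻¹' {i} ∩ g ⁻¹' {k})) ≤
      -(μ.real (f ⁻¹' {i} ∩ g ⁻¹' {k})) * Real.log (μ.real (f ⁻¹' {i}))
      + -(μ.real (f ⁻¹' {i} ∩ g ⁻¹' {k})) * Real.log (μ.real (g ⁻¹' {k}))
      + (μ.real (f ⁻¹' {i}) * μ.real (g ⁻¹' {k}) - μ.real (f ⁻¹' {i} ∩ g ⁻¹' {k})) := by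
    intro i k
    have l1 : μ.real (f ⁻¹' {i} ∩ g ⁻¹' {k}) ≤ μ.real (f ⁻¹' {i}) :=
      measureReal_mono Set.inter_subset_left
    have l2 : μ.real (f ⁻¹' {i} ∩ g ⁻¹' {k}) ≤ μ.real (g ⁻¹' {k}) :=
      measureReal_mono Set.inter_subset_right
    have l0 : 0 ≤ μ.real (f ⁻¹' {i} ∩ g ⁻¹' {k}) := measureReal_nonneg
    generalize μ.real (f ⁻¹' {i} ∩ g ⁻¹' {k}) = p at *
    generalize μ.real (f ⁻¹' {i}) = r at *
    generalize μ.real (g ⁻¹' {k}) = c at *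
    have hz : r * c = 0 → p = 0 := by
      intro h
      rcases mul_eq_zero.1 h with h | h <;> linarith
    have := gibbs l0 (mul_nonneg (l0.trans l1) (l0.trans l2)) hz
    by_cases h0 : r * c = 0
    · have := hz h0
      subst this
      simp [h0]
    · rw [Real.log_mul (left_ne_zero_of_mul h0) (right_ne_zero_of_mul h0)] at this
      linarith
  calc _ ≤ ∑ i, ∑ k, _ := Finset.sum_le_sum fun i _ => Finset.sum_le_sum fun k _ => key i k
    _ = _ := by
      simp only [Finset.sum_add_distrib, Finset.sum_sub_distrib]
      have e1 : ∑ i, ∑ k, -(μ.real (f ⁻¹' {i} ∩ g ⁻¹' {k})) * Real.log (μ.real (f ⁻¹' {i}))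
        = ∑ i, Real.negMulLog (μ.real (f ⁻¹' {i})) := by
        refine Finset.sum_congr rfl fun i _ => ?_
        rw [← Finset.sum_mul, Finset.sum_neg_distrib, hr]; rfl
      have e2 : ∑ i, ∑ k, -(μ.real (f ⁻¹' {i} ∩ g ⁻¹' {k})) * Real.log (μ.real (g ⁻¹' {k}))
        = ∑ i, Real.negMulLog (μ.real (g ⁻¹' {i})) := by
        rw [Finset.sum_comm]
        refine Finset.sum_congr rfl fun i _ => ?_
        rw [← Finset.sum_mul, Finset.sum_neg_distrib, hc]; rfl
      have e3 : ∑ i, ∑ k, μ.real (f ⁻¹' {i}) * μ.real (g ⁻¹' {k}) = 1 := by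
        simp_rw [← Finset.mul_sum, hg1, mul_one, hf1]
      rw [e1, e2, e3]
      simp_rw [hr, hf1]
      ring

lemma H_count (μ : Measure X) [IsProbabilityMeasure μ] {G : Set X} (hG : μ Gᶜ = 0)
    {f : X → ι} {g : X → κ} (hf : Measurable f) (hg : Measurable g)
    (V : ι → Finset κ) (N : ι → ℝ) (hN : ∀ i, 0 < N i) (hV : ∀ i, ((V i).card : ℝ) ≤ N i)
    (h : ∀ x ∈ G, g x ∈ V (f x)) :
    H μ (fun x => (f x, g x)) ≤ H μ f + ∑ i, μ.real (f ⁻¹' {i}) * Real.log (N i) := by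
  unfold H
  rw [Fintype.sum_prod_type, ← Finset.sum_add_distrib]
  simp_rw [preimage_pair]
  refine Finset.sum_le_sum fun i _ => ?_
  have hr : ∑ k, μ.real (f ⁻¹' {i} ∩ g ⁻¹' {k}) = μ.real (f ⁻¹' {i}) := sum_fibre μ hg _
  have h0 : ∀ k ∉ V i, μ.real (f ⁻¹' {i} ∩ g ⁻¹' {k}) = 0 := by
    intro k hk
    rw [← real_inter_G μ hG]
    have : (f ⁻¹' {i} ∩ g ⁻¹' {k} ∩ G) = ∅ := by
      ext y
      simp only [Set.mem_inter_iff, Set.mem_preimage, Set.mem_singleton_iff,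
        Set.mem_empty_iff_false, iff_false]
      rintro ⟨⟨h1, h2⟩, h3⟩
      apply hk
      rw [← h1, ← h2]; exact h y h3
    rw [this]; simp
  have hr' : ∑ k ∈ V i, μ.real (f ⁻¹' {i} ∩ g ⁻¹' {k}) = μ.real (f ⁻¹' {i}) := by
    rw [← hr]
    exact Finset.sum_subset (Finset.subset_univ _) fun k _ hk => h0 k hk
  rw [← Finset.sum_subset (Finset.subset_univ (V i)) (fun k _ hk => by rw [h0 k hk]; simp)]
  set r := μ.real (f ⁻¹' {i}) with hrdef
  have hr0 : 0 ≤ r := measureReal_nonneg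
  rcases hr0.eq_or_lt with hz | hpos
  · have : ∀ k, μ.real (f ⁻¹' {i} ∩ g ⁻¹' {k}) = 0 := by
      intro k
      have l1 : μ.real (f ⁻¹' {i} ∩ g ⁻¹' {k}) ≤ r :=
        measureReal_mono Set.inter_subset_left
      have l0 : 0 ≤ μ.real (f ⁻¹' {i} ∩ g ⁻¹' {k}) := measureReal_nonneg
      linarith
    simp [this, ← hz]
  calc _ ≤ ∑ k ∈ V i, (-(μ.real (f ⁻¹' {i} ∩ g ⁻¹' {k})) * Real.log (r / N i) +
        (r / N i - μ.real (f ⁻¹' {i} ∩ g ⁻¹' {k}))) := by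
        refine Finset.sum_le_sum fun k _ => ?_
        exact gibbs measureReal_nonneg (div_pos hpos (hN i)).le
          (fun h => absurd h (div_pos hpos (hN i)).ne')
    _ = -r * Real.log (r / N i) + ((V i).card * (r / N i) - r) := by
        rw [Finset.sum_add_distrib, ← Finset.sum_mul, Finset.sum_neg_distrib,
          Finset.sum_sub_distrib, hr']
        simp
    _ ≤ _ := by
        rw [Real.log_div hpos.ne' (hN i).ne']
        have : (V i).card * (r / N i) ≤ r := by
          rw [mul_div_assoc', div_le_iff₀ (hN i)]
          nlinarith [hV i]
        unfold Real.negMulLog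
        linarith

lemma measurable_fN {T : X → X} (hT : Measurable T) {f : X → ι} (hf : Measurable f) (n : ℕ) :
    Measurable (fN T f n) :=
  measurable_pi_lambda _ fun i => hf.comp (hT.iterate i)

lemma fN_succ_preimage (T : X → X) (f : X → ι) (n : ℕ) (v : Fin (n + 1) → ι) :
    fN T f (n+1) ⁻¹' {v} = f ⁻¹' {v 0} ∩ T ⁻¹' (fN T f n ⁻¹' {Fin.tail v}) := by
  ext x
  simp only [Set.mem_preimage, Set.mem_singleton_iff, Set.mem_inter_iff]
  constructor
  · rintro rfl
    refine ⟨rfl, ?_⟩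
    funext i
    simp [fN, Fin.tail]
  · rintro ⟨h1, h2⟩
    funext i
    refine Fin.cases ?_ (fun j => ?_) i
    · simpa [fN] using h1
    · have := congrFun h2 j
      simpa [fN, Fin.tail] using this

lemma bern_prod (μ : Measure X) [IsProbabilityMeasure μ] {T : X → X} (hT : Measurable T)
    {f : X → ι} (hf : Measurable f) (p : ι → ℝ)
    (h : ∀ i, ∀ B, MeasurableSet B → μ.real (f ⁻¹' {i} ∩ T ⁻¹' B) = p i * μ.real B) (n : ℕ) :
    ∀ v : Fin n → ι, μ.real (fN T f n ⁻¹' {v}) = ∏ i, p (v i) := by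
  induction n with
  | zero =>
    intro v
    have : fN T f 0 ⁻¹' {v} = Set.univ := by
      ext x; simp only [Set.mem_preimage, Set.mem_singleton_iff, Set.mem_univ, iff_true]
      exact Subsingleton.elim _ _
    rw [this]; simp
  | succ n ih =>
    intro v
    rw [fN_succ_preimage, h _ _ (measurable_fN hT hf n (measurableSet_singleton _)), ih,
      Fin.prod_univ_succ]
    rfl

lemma sum_prod_eq (n : ℕ) (p : Fin n → ι → ℝ) :
    ∑ v : Fin n → ι, ∏ i, p i (v i) = ∏ i, ∑ k, p i k := by
  classical
  rw [Finset.prod_univ_sum, Fintype.piFinset_univ]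

lemma bern_sum (p : ι → ℝ) (hp : ∑ i, p i = 1) (n : ℕ) :
    ∑ v : Fin n → ι, Real.negMulLog (∏ i, p (v i)) = n * ∑ i, Real.negMulLog (p i) := by
  induction n with
  | zero => simp
  | succ n ih =>
    rw [← (Fin.consEquiv (fun _ => ι)).sum_comp, Fintype.sum_prod_type]
    simp only [Fin.consEquiv, Equiv.coe_fn_mk, Fin.prod_univ_succ, Fin.cons_zero, Fin.cons_succ,
      Real.negMulLog_mul, Finset.sum_add_distrib]
    have h1 : ∑ v : Fin n → ι, ∏ i, p (v i) = 1 := by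
      rw [sum_prod_eq n (fun _ => p)]; simp [hp]
    simp_rw [← Finset.sum_mul, ← Finset.mul_sum, h1, ← Finset.sum_mul, hp, ih]
    push_cast; ring

lemma bern_H (μ : Measure X) [IsProbabilityMeasure μ] {T : X → X} (hT : Measurable T)
    {f : X → ι} (hf : Measurable f) (p : ι → ℝ) (hp : ∑ i, p i = 1)
    (h : ∀ i, ∀ B, MeasurableSet B → μ.real (f ⁻¹' {i} ∩ T ⁻¹' B) = p i * μ.real B) (n : ℕ) :
    H μ (fN T f n) = n * ∑ i, Real.negMulLog (p i) := by
  unfold H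
  simp_rw [bern_prod μ hT hf p h n]
  exact bern_sum p hp n

lemma H_comp (μ : Measure X) {T : X → X} (hT : MeasurePreserving T μ μ) {f : X → ι}
    (hf : Measurable f) : H μ (f ∘ T) = H μ f := by
  unfold H
  refine Finset.sum_congr rfl fun i _ => ?_
  rw [Set.preimage_comp, hT.measureReal_preimage (hf (measurableSet_singleton i)).nullMeasurableSet]

lemma H_fN_le (μ : Measure X) [IsProbabilityMeasure μ] {T : X → X} (hT : MeasurePreserving T μ μ)
    {f : X → ι} (hf : Measurable f) (n : ℕ) : H μ (fN T f n) ≤ n * H μ f := by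
  induction n with
  | zero =>
    unfold H
    have : ∀ v : Fin 0 → ι, fN T f 0 ⁻¹' {v} = Set.univ := by
      intro v
      ext x; simp only [Set.mem_preimage, Set.mem_singleton_iff, Set.mem_univ, iff_true]
      exact Subsingleton.elim _ _
    simp [this]
  | succ n ih =>
    have h1 : H μ (fN T f (n+1)) ≤ H μ (fun x => (fN T f n x, (f ∘ T^[n]) x)) := by
      apply H_le μ (G := Set.univ) (by simp) (measurable_fN hT.measurable hf _)
        ((measurable_fN hT.measurable hf _).prodMk (hf.comp (hT.measurable.iterate n)))
      intro x _ y _ hxy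
      simp only [Prod.mk.injEq] at hxy
      funext i
      refine Fin.lastCases ?_ (fun j => ?_) i
      · simpa [fN] using hxy.2
      · simpa [fN] using congrFun hxy.1 j
    have h2 := H_pair μ (measurable_fN hT.measurable hf n) (hf.comp (hT.measurable.iterate n))
    rw [H_comp μ (hT.iterate n) hf] at h2
    push_cast
    linarith

end

open Classical in
lemma link {X ι : Type*} [MeasurableSpace X] [Fintype ι] (μ : Measure X) (T : X → X) (f : X → ι)
    (n : ℕ) : partitionEntropy μ (refineN T (Finset.univ.image fun i => f ⁻¹' {i}) n)
      = H μ (fN T f n) := by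
  have h : refineN T (Finset.univ.image fun i => f ⁻¹' {i}) n =
      (Finset.univ : Finset (Fin n → ι)).image (fun v => fN T f n ⁻¹' {v}) := by
    ext A
    simp only [refineN, Finset.mem_image, Finset.mem_univ, true_and]
    have aux : ∀ v : Fin n → ι, fN T f n ⁻¹' {v} = ⋂ i : Fin n, (T^[(i : ℕ)]) ⁻¹' (f ⁻¹' {v i}) := by
      intro v; ext x
      simp [fN, funext_iff]
    constructor
    · rintro ⟨s, rfl⟩
      have hs : ∀ i, ∃ k, f ⁻¹' {k} = (s i : Set X) := by
        intro i
        have := (s i).2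
        simpa only [Finset.mem_image, Finset.mem_univ, true_and] using this
      choose v hv using hs
      refine ⟨v, ?_⟩
      rw [aux]
      simp_rw [hv]
    · rintro ⟨v, rfl⟩
      refine ⟨fun i => ⟨f ⁻¹' {v i}, Finset.mem_image_of_mem _ (Finset.mem_univ _)⟩, ?_⟩
      rw [aux]
  unfold partitionEntropy H
  rw [h]
  rw [Finset.sum_image_of_disjoint]
  · rfl
  · simp
  · intro i _ j _ hij
    refine Set.disjoint_left.2 ?_
    intro x hx hx'
    simp at hx hx'
    exact hij (hx.symm.trans hx')

lemma exists_fun {X : Type*} [MeasurableSpace X] (P : Finset (Set X)) (hP : IsFinPartition P) :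
    ∃ (k : ℕ) (f : X → Fin k), Measurable f ∧
      ∀ (μ : Measure X) (T : X → X) n, partitionEntropy μ (refineN T P n) = H μ (fN T f n) := by
  classical
  obtain ⟨h1, h2, h3⟩ := hP
  have hx : ∀ x : X, ∃ s : {s // s ∈ P}, x ∈ (s : Set X) := by
    intro x
    have : x ∈ ⋃₀ (↑P : Set (Set X)) := by rw [h2]; trivial
    obtain ⟨s, hs, hx⟩ := this
    exact ⟨⟨s, hs⟩, hx⟩
  choose c hc using hx
  let e := Fintype.equivFin {s // s ∈ P}
  have hfib : ∀ i, (fun x => e (c x)) ⁻¹' {i} = ((e.symm i : {s // s ∈ P}) : Set X) := by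
    intro i
    ext x
    simp only [Set.mem_preimage, Set.mem_singleton_iff]
    constructor
    · rintro rfl
      simpa using hc x
    · intro hx
      rw [← Equiv.eq_symm_apply]
      by_contra hne
      have : Disjoint ((c x : {s // s ∈ P}) : Set X) ((e.symm i : {s // s ∈ P}) : Set X) :=
        h3 (c x).2 (e.symm i).2 (fun h => hne (Subtype.ext h))
      exact Set.disjoint_left.1 this (hc x) hx
  refine ⟨_, fun x => e (c x), ?_, ?_⟩
  · refine measurable_to_countable' fun i => ?_
    rw [hfib]; exact h1 _ (e.symm i).2
  · intro μ T n
    rw [← link]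
    congr 2
    ext s
    simp only [Finset.mem_image, Finset.mem_univ, true_and, hfib]
    constructor
    · intro hs; exact ⟨e ⟨s, hs⟩, by simp⟩
    · rintro ⟨i, rfl⟩; exact (e.symm i).2

lemma isFin {X : Type*} [MeasurableSpace X] {ι : Type*} [Fintype ι] [MeasurableSpace ι]
    [MeasurableSingletonClass ι] [DecidableEq (Set X)] (f : X → ι) (hf : Measurable f) :
    IsFinPartition (Finset.univ.image fun i => f ⁻¹' {i}) := by
  refine ⟨?_, ?_, ?_⟩
  · intro s hs
    simp only [Finset.mem_image, Finset.mem_univ, true_and] at hs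
    obtain ⟨i, rfl⟩ := hs
    exact hf (measurableSet_singleton i)
  · ext x; simp
  · intro s hs t ht hst
    simp only [Finset.coe_image, Finset.coe_univ, Set.image_univ, Set.mem_range] at hs ht
    obtain ⟨i, rfl⟩ := hs
    obtain ⟨j, rfl⟩ := ht
    refine Set.disjoint_left.2 ?_
    intro x hx hx'
    simp at hx hx'
    exact hst (by rw [← hx, ← hx'])

lemma KS_eq {X : Type*} [MeasurableSpace X] (μ : Measure X) [IsProbabilityMeasure μ]
    (T : X → X) (hT : Measurable T) (h : ℝ)
    (hup : ∀ (k : ℕ) (f : X → Fin k), Measurable f → ∀ ε > 0, ∃ n : ℕ,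
      H μ (fN T f (n+1)) ≤ (h + ε) * (n + 1))
    (hlow : ∃ (k : ℕ) (f : X → Fin k), Measurable f ∧ ∀ n : ℕ, H μ (fN T f n) = n * h) :
    kolSinaiEntropy T μ = h := by
  classical
  have hup' : ∀ P : {P : Finset (Set X) // IsFinPartition P},
      ⨅ n : ℕ, partitionEntropy μ (refineN T P.1 (n + 1)) / (n + 1) ≤ h := by
    rintro ⟨P, hP⟩
    obtain ⟨k, f, hf, hE⟩ := exists_fun P hP
    simp only [hE]
    refine le_of_forall_pos_le_add fun ε hε => ?_
    obtain ⟨n, hn⟩ := hup k f hf ε hε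
    refine (ciInf_le ⟨0, ?_⟩ n).trans ?_
    · rintro _ ⟨n, rfl⟩
      exact div_nonneg (H_nonneg _ _) (by positivity)
    · rw [div_le_iff₀ (by positivity)]; exact hn
  obtain ⟨k, f, hf, hn⟩ := hlow
  have hne : Nonempty {P : Finset (Set X) // IsFinPartition P} := ⟨⟨_, isFin f hf⟩⟩
  apply le_antisymm
  · exact ciSup_le hup'
  · refine le_ciSup_of_le ⟨h, ?_⟩ ⟨_, isFin f hf⟩ ?_
    · rintro _ ⟨P, rfl⟩; exact hup' P
    · refine le_ciInf fun n => ?_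
      have := link μ T f (n+1)
      rw [hn] at this
      rw [le_div_iff₀ (by positivity)]
      apply le_of_eq
      rw [this]
      push_cast; ring

end HB
namespace HB

noncomputable def tmap (M : ℕ) (a : ℝ) (x : ℝ) : ℝ :=
  if x < M * a then Int.fract (x / a) else (x - M * a) / (1 - M * a)

noncomputable def lab (M : ℕ) (a : ℝ) (x : ℝ) : Fin (M + 1) :=
  ⟨min ⌊x / a⌋₊ M, by omega⟩

noncomputable def ylab (M : ℕ) (y : ℝ) : Fin (M + 1) :=
  ⟨min ⌊M * y⌋₊ M, by omega⟩

noncomputable def glab (M : ℕ) (a : ℝ) (p : ℝ × ℝ) : Fin (M + 1) :=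
  if p.1 < M * a then Fin.last M else ylab M p.2

def G : Set (ℝ × ℝ) := Set.Ico 0 1 ×ˢ Set.Ico 0 1

noncomputable def mu : Measure (ℝ × ℝ) := volume.restrict G
noncomputable def nu : Measure ℝ := volume.restrict (Set.Ico 0 1)

lemma mG : MeasurableSet G := measurableSet_Ico.prod measurableSet_Ico

instance : IsProbabilityMeasure nu := ⟨by simp [nu]⟩

lemma mu_prod : mu = nu.prod nu := by
  unfold mu nu G
  rw [Measure.prod_restrict, Measure.volume_eq_prod]

instance : IsProbabilityMeasure mu := by rw [mu_prod]; infer_instance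

lemma mu_compl : mu Gᶜ = 0 := by
  unfold mu
  rw [Measure.restrict_apply mG.compl]; simp

lemma mu_eq : volume.restrict (Set.Icc 0 1 ×ˢ Set.Icc (0:ℝ) 1) = mu := by
  rw [mu_prod]
  unfold nu
  rw [restrict_Ico_eq_restrict_Icc, Measure.prod_restrict, Measure.volume_eq_prod]

lemma fract_meas : Measurable (Int.fract : ℝ → ℝ) := measurable_fract

lemma meas_fa (M : ℕ) (a : ℝ) : Measurable (faMap M a) := by
  unfold faMap
  refine Measurable.ite (measurableSet_lt measurable_fst measurable_const) ?_ ?_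
  · refine (measurable_fract.comp (measurable_fst.div_const _)).prodMk ?_
    refine (measurable_snd.div_const _).add (Measurable.div_const ?_ _)
    exact (measurable_from_top (f := fun z : ℤ => (z : ℝ))).comp
      (Int.measurable_floor.comp (measurable_fst.div_const _))
  · refine ((measurable_fst.sub_const _).div_const _).prodMk ?_
    refine Measurable.ite (measurable_snd (measurableSet_singleton 1)) measurable_const ?_
    exact measurable_fract.comp (measurable_snd.const_mul _)

lemma meas_t (M : ℕ) (a : ℝ) : Measurable (tmap M a) := by
  unfold tmap
  refine Measurable.ite (measurableSet_lt measurable_id measurable_const) ?_ ?_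
  · exact measurable_fract.comp (measurable_id.div_const _)
  · exact (measurable_id.sub_const _).div_const _

lemma meas_fin {X : Type*} [MeasurableSpace X] {M : ℕ} {f : X → ℕ} (hf : Measurable f)
    (h : ∀ x, f x < M + 1) : Measurable (fun x => (⟨f x, h x⟩ : Fin (M+1))) := by
  refine measurable_to_countable' fun i => ?_
  have : (fun x => (⟨f x, h x⟩ : Fin (M+1))) ⁻¹' {i} = f ⁻¹' {(i : ℕ)} := by
    ext x; simp [Fin.ext_iff]
  rw [this]
  exact hf (measurableSet_singleton _)

lemma meas_lab (M : ℕ) (a : ℝ) : Measurable (lab M a) := by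
  apply meas_fin
  exact (Nat.measurable_floor.comp (measurable_id.div_const a)).min measurable_const

lemma meas_ylab (M : ℕ) : Measurable (ylab M) := by
  apply meas_fin
  exact (Nat.measurable_floor.comp (measurable_id.const_mul (M : ℝ))).min measurable_const

lemma meas_glab (M : ℕ) (a : ℝ) : Measurable (glab M a) := by
  unfold glab
  exact Measurable.ite (measurableSet_lt measurable_fst measurable_const) measurable_const
    ((meas_ylab M).comp measurable_snd)

lemma fst_fa (M : ℕ) (a : ℝ) (p : ℝ × ℝ) : (faMap M a p).1 = tmap M a p.1 := by
  unfold faMap tmap; split_ifs <;> rfl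

lemma fst_fa_iter (M : ℕ) (a : ℝ) (n : ℕ) (p : ℝ × ℝ) :
    ((faMap M a)^[n] p).1 = (tmap M a)^[n] p.1 := by
  induction n generalizing p with
  | zero => rfl
  | succ n ih => rw [Function.iterate_succ_apply, Function.iterate_succ_apply, ih, fst_fa]

lemma map_aff (α β : ℝ) (hα : 0 < α) :
    Measure.map (fun x : ℝ => α * x + β) volume = ENNReal.ofReal α⁻¹ • volume := by
  have h1 : (fun x : ℝ => α * x + β) = (fun x => x + β) ∘ (fun x => α * x) := rfl
  rw [h1, ← Measure.map_map (measurable_add_const β) (measurable_const_mul α),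
    Real.map_volume_mul_left hα.ne', Measure.map_smul, abs_of_pos (inv_pos.2 hα),
    MeasureTheory.map_add_right_eq_self]

lemma scale1 (α β : ℝ) (hα : 0 < α) {B : Set ℝ} (hB : MeasurableSet B) :
    (volume : Measure ℝ).real ((fun x : ℝ => α * x + β) ⁻¹' B) = α⁻¹ * (volume : Measure ℝ).real B := by
  unfold Measure.real
  rw [← Measure.map_apply (by fun_prop) hB, map_aff α β hα]
  simp [ENNReal.toReal_ofReal, hα.le]

lemma scale2 (α β γ δ : ℝ) (hα : 0 < α) (hγ : 0 < γ) {B : Set (ℝ × ℝ)} (hB : MeasurableSet B) :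
    (volume : Measure (ℝ × ℝ)).real ((fun p : ℝ × ℝ => (α * p.1 + β, γ * p.2 + δ)) ⁻¹' B)
      = α⁻¹ * γ⁻¹ * (volume : Measure (ℝ × ℝ)).real B := by
  have h1 : (fun p : ℝ × ℝ => (α * p.1 + β, γ * p.2 + δ)) =
    Prod.map (fun x : ℝ => α * x + β) (fun x : ℝ => γ * x + δ) := rfl
  unfold Measure.real
  rw [← Measure.map_apply (by fun_prop) hB, h1, Measure.volume_eq_prod,
    ← Measure.map_prod_map _ _ (by fun_prop) (by fun_prop), map_aff α β hα, map_aff γ δ hγ,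
    Measure.prod_smul_left, Measure.prod_smul_right, smul_smul]
  simp [ENNReal.toReal_ofReal, hα.le, hγ.le]

section
variable {M : ℕ} (hM : 2 ≤ M) {a : ℝ} (ha : a ∈ Set.Ioo (0 : ℝ) (1 / M))

lemma Mpos (hM : 2 ≤ M) : (0:ℝ) < M := by positivity

include hM ha

lemma Ma_lt : M * a < 1 := by
  have := ha.2
  rw [lt_div_iff₀ (Mpos hM)] at this
  linarith

lemma Ma_pos : 0 < M * a := mul_pos (Mpos hM) ha.1

lemma a_lt : a < 1 := by
  have h1 := Ma_lt hM ha
  have h2 : (2:ℝ) ≤ M := by exact_mod_cast hM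
  nlinarith [ha.1]

/-- on the left -/
lemma lab_left {x : ℝ} (hx : 0 ≤ x) (k : ℕ) (hk : k < M) :
    ((lab M a x : Fin (M+1)) : ℕ) = k ↔ k * a ≤ x ∧ x < (k+1) * a := by
  have h0 : 0 ≤ x / a := div_nonneg hx ha.1.le
  simp only [lab]
  have : min ⌊x / a⌋₊ M = k ↔ ⌊x / a⌋₊ = k := by omega
  rw [this, Nat.floor_eq_iff h0, le_div_iff₀ ha.1, div_lt_iff₀ ha.1]

lemma lab_right {x : ℝ} (hx : 0 ≤ x) :
    ((lab M a x : Fin (M+1)) : ℕ) = M ↔ M * a ≤ x := by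
  have h0 : 0 ≤ x / a := div_nonneg hx ha.1.le
  simp only [lab]
  have : min ⌊x / a⌋₊ M = M ↔ M ≤ ⌊x / a⌋₊ := by omega
  rw [this, Nat.le_floor_iff h0, le_div_iff₀ ha.1]

lemma floor_left {x : ℝ} (k : ℕ) (h1 : k * a ≤ x) (h2 : x < (k+1) * a) : ⌊x / a⌋ = (k : ℤ) := by
  rw [Int.floor_eq_iff, le_div_iff₀ ha.1, div_lt_iff₀ ha.1]
  exact ⟨by exact_mod_cast h1, by exact_mod_cast h2⟩

lemma left_lt {x : ℝ} (k : ℕ) (hk : k < M) (h2 : x < (k+1) * a) : x < M * a := by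
  have : ((k:ℝ)+1) ≤ M := by exact_mod_cast hk
  nlinarith [ha.1]

lemma ylab_iff {y : ℝ} (hy : 0 ≤ y) (k : ℕ) (hk : k < M) :
    ((ylab M y : Fin (M+1)) : ℕ) = k ↔ k ≤ M * y ∧ M * y < (k+1) := by
  have h0 : 0 ≤ M * y := mul_nonneg (Mpos hM).le hy
  simp only [ylab]
  have : min ⌊M * y⌋₊ M = k ↔ ⌊M * y⌋₊ = k := by omega
  rw [this, Nat.floor_eq_iff h0]

lemma ylab_ne {y : ℝ} (hy : 0 ≤ y) (hy1 : y < 1) : ((ylab M y : Fin (M+1)) : ℕ) < M := by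
  have h0 : 0 ≤ M * y := mul_nonneg (Mpos hM).le hy
  have : ⌊M * y⌋₊ < M := by
    rw [Nat.floor_lt h0]; nlinarith [Mpos hM]
  simp only [ylab]; omega

lemma bern1 (k : Fin (M+1)) (B : Set ℝ) (hB : MeasurableSet B) :
    nu.real (lab M a ⁻¹' {k} ∩ tmap M a ⁻¹' B) =
      (if k = Fin.last M then 1 - M * a else a) * nu.real B := by
  have hlt := Ma_lt hM ha
  have hap := ha.1
  have hm : MeasurableSet (lab M a ⁻¹' {k} ∩ tmap M a ⁻¹' B) :=
    (meas_lab M a (measurableSet_singleton k)).inter (meas_t M a hB)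
  unfold nu
  rw [measureReal_restrict_apply hm, measureReal_restrict_apply hB]
  split_ifs with hk
  · have hs : lab M a ⁻¹' {k} ∩ tmap M a ⁻¹' B ∩ Set.Ico 0 1 =
        (fun x : ℝ => (1 - M * a)⁻¹ * x + -(M * a) / (1 - M * a)) ⁻¹' (B ∩ Set.Ico 0 1) := by
      ext x
      have he : (1 - M * a)⁻¹ * x + -(M * a) / (1 - M * a) = (x - M * a) / (1 - M * a) := by
        field_simp; ring
      simp only [Set.mem_inter_iff, Set.mem_preimage, Set.mem_singleton_iff, Set.mem_Ico, he]
      rw [le_div_iff₀ (by linarith), div_lt_iff₀ (by linarith)]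
      constructor
      · rintro ⟨⟨h1, h2⟩, h3, h4⟩
        have h5 : M * a ≤ x := (lab_right hM ha h3).1 (by rw [h1, hk]; simp)
        rw [tmap, if_neg (by linarith)] at h2
        exact ⟨h2, by linarith, by linarith⟩
      · rintro ⟨h1, h2, h3⟩
        have h5 : M * a ≤ x := by linarith
        have h6 : 0 ≤ x := by have := Ma_pos hM ha; linarith
        refine ⟨⟨?_, ?_⟩, h6, by linarith⟩
        · rw [hk]; apply Fin.ext; simpa using (lab_right hM ha h6).2 h5
        · rw [tmap, if_neg (by linarith)]; exact h1
    rw [hs, scale1 _ _ (inv_pos.2 (by linarith)) (hB.inter measurableSet_Ico), inv_inv]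
  · have hkM : (k : ℕ) < M := by
      have := k.2
      have : (k : ℕ) ≠ M := fun h => hk (Fin.ext (by simpa using h))
      omega
    have hs : lab M a ⁻¹' {k} ∩ tmap M a ⁻¹' B ∩ Set.Ico 0 1 =
        (fun x : ℝ => a⁻¹ * x + -(k : ℕ)) ⁻¹' (B ∩ Set.Ico 0 1) := by
      ext x
      have he : a⁻¹ * x + -((k : ℕ) : ℝ) = (x - (k : ℕ) * a) / a := by
        field_simp; ring
      simp only [Set.mem_inter_iff, Set.mem_preimage, Set.mem_singleton_iff, Set.mem_Ico]
      constructor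
      · rintro ⟨⟨h1, h2⟩, h3, h4⟩
        have h5 := (lab_left hM ha h3 k hkM).1 (by rw [h1])
        rw [tmap, if_pos (left_lt hM ha k hkM h5.2), Int.fract, floor_left hM ha k h5.1 h5.2] at h2
        have e2 : x / a - (((k : ℕ) : ℤ) : ℝ) = a⁻¹ * x + -((k : ℕ) : ℝ) := by
          push_cast; ring
        rw [e2] at h2
        refine ⟨h2, ?_, ?_⟩
        · rw [he, le_div_iff₀ hap]; linarith
        · rw [he, div_lt_iff₀ hap]; linarith
      · rintro ⟨h1, h2, h3⟩
        have h2' := h2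
        have h3' := h3
        rw [he, le_div_iff₀ hap] at h2'
        rw [he, div_lt_iff₀ hap] at h3'
        have h6 : 0 ≤ x := by have : 0 ≤ ((k:ℕ):ℝ) * a := by positivity
                              linarith
        have h7 : x < M * a := left_lt hM ha k hkM (by linarith)
        refine ⟨⟨?_, ?_⟩, h6, by linarith⟩
        · apply Fin.ext; exact (lab_left hM ha h6 k hkM).2 ⟨by linarith, by linarith⟩
        · rw [tmap, if_pos h7, Int.fract, floor_left hM ha k (by linarith) (by linarith)]
          have e2 : x / a - (((k : ℕ) : ℤ) : ℝ) = a⁻¹ * x + -((k : ℕ) : ℝ) := by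
            push_cast; ring
          rw [e2]; exact h1
    rw [hs, scale1 _ _ (inv_pos.2 hap) (hB.inter measurableSet_Ico), inv_inv]

lemma left_piece (k : Fin (M+1)) (B : Set (ℝ × ℝ)) (hB : MeasurableSet B) :
    mu.real (glab M a ⁻¹' {Fin.last M} ∩ faMap M a ⁻¹' B ∩ (fun p => lab M a p.1) ⁻¹' {k}) =
      M * a * mu.real (B ∩ (fun p => ylab M p.2) ⁻¹' {k}) := by
  have hlt := Ma_lt hM ha
  have hap := ha.1
  have hMp := Mpos hM
  have hm : MeasurableSet (glab M a ⁻¹' {Fin.last M} ∩ faMap M a ⁻¹' B ∩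
      (fun p : ℝ × ℝ => lab M a p.1) ⁻¹' {k}) :=
    ((meas_glab M a (measurableSet_singleton _)).inter (meas_fa M a hB)).inter
      (((meas_lab M a).comp measurable_fst) (measurableSet_singleton k))
  have hm2 : MeasurableSet (B ∩ (fun p : ℝ × ℝ => ylab M p.2) ⁻¹' {k}) :=
    hB.inter (((meas_ylab M).comp measurable_snd) (measurableSet_singleton k))
  have hgl : ∀ x y : ℝ, 0 ≤ y → y < 1 → (glab M a (x, y) = Fin.last M ↔ x < M * a) := by
    intro x y hy hy1
    unfold glab
    split_ifs with h
    · simp [h]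
    · have := ylab_ne hM ha hy hy1
      simp only [h, iff_false]
      intro h'; rw [h'] at this; simp at this
  unfold mu
  rw [measureReal_restrict_apply hm, measureReal_restrict_apply hm2]
  by_cases hk : k = Fin.last M
  · have e1 : glab M a ⁻¹' {Fin.last M} ∩ faMap M a ⁻¹' B ∩
      (fun p : ℝ × ℝ => lab M a p.1) ⁻¹' {k} ∩ G = ∅ := by
      ext ⟨x, y⟩
      simp only [Set.mem_inter_iff, Set.mem_preimage, Set.mem_singleton_iff, G, Set.mem_prod,
        Set.mem_Ico, Set.mem_empty_iff_false, iff_false]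
      rintro ⟨⟨⟨h1, h2⟩, h3⟩, ⟨h4, h5⟩, h6, h7⟩
      rw [hgl x y h6 h7] at h1
      have := (lab_right hM ha h4).1 (by rw [h3, hk]; simp)
      linarith
    have e2 : B ∩ (fun p : ℝ × ℝ => ylab M p.2) ⁻¹' {k} ∩ G = ∅ := by
      ext ⟨x, y⟩
      simp only [Set.mem_inter_iff, Set.mem_preimage, Set.mem_singleton_iff, G, Set.mem_prod,
        Set.mem_Ico, Set.mem_empty_iff_false, iff_false]
      rintro ⟨⟨h1, h3⟩, ⟨h4, h5⟩, h6, h7⟩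
      have := ylab_ne hM ha h6 h7
      rw [h3, hk] at this; simp at this
    rw [e1, e2]; simp
  · have hkM : (k : ℕ) < M := by
      have := k.2
      have : (k : ℕ) ≠ M := fun h => hk (Fin.ext (by simpa using h))
      omega
    have hs : glab M a ⁻¹' {Fin.last M} ∩ faMap M a ⁻¹' B ∩
      (fun p : ℝ × ℝ => lab M a p.1) ⁻¹' {k} ∩ G =
        (fun p : ℝ × ℝ => (a⁻¹ * p.1 + -(k : ℕ), (M:ℝ)⁻¹ * p.2 + (k : ℕ) / M)) ⁻¹'
          (B ∩ (fun p : ℝ × ℝ => ylab M p.2) ⁻¹' {k} ∩ G) := by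
      ext ⟨x, y⟩
      have he : a⁻¹ * x + -((k : ℕ) : ℝ) = (x - (k : ℕ) * a) / a := by
        field_simp; ring
      have he2 : (M:ℝ)⁻¹ * y + ((k : ℕ) : ℝ) / M = (y + (k : ℕ)) / M := by
        field_simp
      have hfa : (k : ℕ) * a ≤ x → x < ((k:ℕ) + 1) * a →
          faMap M a (x, y) = (a⁻¹ * x + -(k : ℕ), (M:ℝ)⁻¹ * y + (k : ℕ) / M) := by
        intro h1 h2
        unfold faMap
        simp only [if_pos (left_lt hM ha k hkM h2), Int.fract, floor_left hM ha k h1 h2]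
        push_cast
        congr 1 <;> ring
      have hk1 : ((k : ℕ) : ℝ) + 1 ≤ M := by exact_mod_cast hkM
      simp only [Set.mem_inter_iff, Set.mem_preimage, Set.mem_singleton_iff, G, Set.mem_prod,
        Set.mem_Ico]
      constructor
      · rintro ⟨⟨⟨h1, h2⟩, h3⟩, ⟨h4, h5⟩, h6, h7⟩
        have h8 := (lab_left hM ha h4 k hkM).1 (by rw [h3])
        rw [hfa h8.1 h8.2] at h2
        have h9 : 0 ≤ (M:ℝ)⁻¹ * y + ((k : ℕ) : ℝ) / M := by positivity
        refine ⟨⟨h2, ?_⟩, ⟨?_, ?_⟩, h9, ?_⟩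
        · apply Fin.ext; rw [ylab_iff hM ha h9 k hkM, he2]
          rw [mul_div_cancel₀ _ hMp.ne']
          exact ⟨by linarith, by linarith⟩
        · rw [he, le_div_iff₀ hap]; linarith
        · rw [he, div_lt_iff₀ hap]; linarith
        · rw [he2, div_lt_iff₀ hMp]; linarith
      · rintro ⟨⟨h1, h2⟩, ⟨h3, h4⟩, h5, h6⟩
        rw [he, le_div_iff₀ hap] at h3
        rw [he, div_lt_iff₀ hap] at h4
        have h7 := (ylab_iff hM ha h5 k hkM).1 (by rw [h2])
        rw [he2, mul_div_cancel₀ _ hMp.ne'] at h7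
        have h8 : 0 ≤ x := by have : 0 ≤ ((k:ℕ):ℝ) * a := by positivity
                              linarith
        have h9 : x < M * a := left_lt hM ha k hkM (by linarith)
        refine ⟨⟨⟨?_, ?_⟩, ?_⟩, ⟨h8, by linarith⟩, by linarith, by linarith⟩
        · rw [hgl x y (by linarith) (by linarith)]; exact h9
        · rw [hfa (by linarith) (by linarith)]; exact h1
        · apply Fin.ext; exact (lab_left hM ha h8 k hkM).2 ⟨by linarith, by linarith⟩
    rw [hs, scale2 _ _ _ _ (inv_pos.2 hap) (inv_pos.2 hMp) (hm2.inter mG), inv_inv, inv_inv]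
    ring

lemma bern2 (k : Fin (M+1)) (B : Set (ℝ × ℝ)) (hB : MeasurableSet B) :
    mu.real (glab M a ⁻¹' {k} ∩ faMap M a ⁻¹' B) =
      (if k = Fin.last M then M * a else (1 - M * a) / M) * mu.real B := by
  have hlt := Ma_lt hM ha
  have hap := ha.1
  have hMp := Mpos hM
  split_ifs with hk
  · subst hk
    rw [← sum_fibre mu (g := fun p : ℝ × ℝ => lab M a p.1) ((meas_lab M a).comp measurable_fst),
      ← sum_fibre mu (g := fun p : ℝ × ℝ => ylab M p.2) ((meas_ylab M).comp measurable_snd) B,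
      Finset.mul_sum]
    exact Finset.sum_congr rfl fun k _ => left_piece hM ha k B hB
  · have hkM : (k : ℕ) < M := by
      have := k.2
      have : (k : ℕ) ≠ M := fun h => hk (Fin.ext (by simpa using h))
      omega
    have hm : MeasurableSet (glab M a ⁻¹' {k} ∩ faMap M a ⁻¹' B) :=
      (meas_glab M a (measurableSet_singleton _)).inter (meas_fa M a hB)
    unfold mu
    rw [measureReal_restrict_apply hm, measureReal_restrict_apply hB]
    have hs : glab M a ⁻¹' {k} ∩ faMap M a ⁻¹' B ∩ G =
        (fun p : ℝ × ℝ => ((1 - M * a)⁻¹ * p.1 + -(M * a) / (1 - M * a),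
          (M:ℝ) * p.2 + -(k : ℕ))) ⁻¹' (B ∩ G) := by
      ext ⟨x, y⟩
      have he : (1 - M * a)⁻¹ * x + -(M * a) / (1 - M * a) = (x - M * a) / (1 - M * a) := by
        field_simp; ring
      have hk1 : ((k : ℕ) : ℝ) + 1 ≤ M := by exact_mod_cast hkM
      have hk0 : (0:ℝ) ≤ (k : ℕ) := by positivity
      have hfa : M * a ≤ x → (k : ℕ) ≤ M * y → M * y < (k : ℕ) + 1 → y < 1 →
          faMap M a (x, y) = ((1 - M * a)⁻¹ * x + -(M * a) / (1 - M * a),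
          (M:ℝ) * y + -(k : ℕ)) := by
        intro h1 h2 h3 h4
        have hfl : ⌊(M:ℝ) * y⌋ = ((k : ℕ) : ℤ) := by
          rw [Int.floor_eq_iff]; exact ⟨by exact_mod_cast h2, by exact_mod_cast h3⟩
        unfold faMap
        simp only [if_neg (not_lt.2 h1), if_neg h4.ne, Int.fract, hfl, he]
        push_cast
        congr 1
      simp only [Set.mem_inter_iff, Set.mem_preimage, Set.mem_singleton_iff, G, Set.mem_prod,
        Set.mem_Ico]
      constructor
      · rintro ⟨⟨h1, h2⟩, ⟨h4, h5⟩, h6, h7⟩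
        have h8 : M * a ≤ x := by
          by_contra hc
          apply hk
          rw [← h1, glab, if_pos (not_le.1 hc)]
        rw [glab, if_neg (not_lt.2 h8)] at h1
        have h9 := (ylab_iff hM ha h6 k hkM).1 (by rw [← h1])
        rw [hfa h8 h9.1 h9.2 h7] at h2
        refine ⟨h2, ⟨?_, ?_⟩, by linarith, by linarith⟩
        · rw [he, le_div_iff₀ (by linarith)]; linarith
        · rw [he, div_lt_iff₀ (by linarith)]; linarith
      · rintro ⟨h1, ⟨h3, h4⟩, h5, h6⟩
        rw [he, le_div_iff₀ (by linarith)] at h3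
        rw [he, div_lt_iff₀ (by linarith)] at h4
        have hy0 : 0 ≤ y := by
          by_contra hc; nlinarith
        have hy1 : y < 1 := by
          by_contra hc; nlinarith
        have hx : M * a ≤ x := by linarith
        have := Ma_pos hM ha
        refine ⟨⟨?_, ?_⟩, ⟨by linarith, by linarith⟩, hy0, hy1⟩
        · rw [glab, if_neg (not_lt.2 hx)]; apply Fin.ext
          exact (ylab_iff hM ha hy0 k hkM).2 ⟨by linarith, by linarith⟩
        · rw [hfa hx (by linarith) (by linarith) hy1]; exact h1
    rw [hs, scale2 _ _ _ _ (inv_pos.2 (by linarith)) hMp (hB.inter mG), inv_inv]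
    ring

lemma sum_p1 : ∑ k : Fin (M+1), (if k = Fin.last M then 1 - M * a else a) = 1 := by
  rw [Fin.sum_univ_castSucc]
  simp [Fin.castSucc_ne_last]

lemma sum_p2 : ∑ k : Fin (M+1), (if k = Fin.last M then M * a else (1 - M * a) / M) = 1 := by
  have := (Mpos hM).ne'
  rw [Fin.sum_univ_castSucc]
  simp [Fin.castSucc_ne_last]
  field_simp; ring

lemma mp : MeasurePreserving (faMap M a) mu mu := by
  refine ⟨meas_fa M a, ?_⟩
  ext B hB
  rw [Measure.map_apply (meas_fa M a) hB]
  have : mu.real (faMap M a ⁻¹' B) = mu.real B := by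
    rw [← sum_fibre mu (meas_glab M a)]
    calc _ = ∑ k : Fin (M+1), (if k = Fin.last M then M * a else (1 - M * a) / M) * mu.real B := by
          refine Finset.sum_congr rfl fun k _ => ?_
          rw [Set.inter_comm, bern2 hM ha k B hB]
      _ = _ := by rw [← Finset.sum_mul, sum_p2 hM ha, one_mul]
  unfold Measure.real at this
  rwa [ENNReal.toReal_eq_toReal_iff' (measure_ne_top _ _) (measure_ne_top _ _)] at this

lemma mu_word (n : ℕ) (v : Fin n → Fin (M+1)) :
    mu.real (fN (faMap M a) (fun p => lab M a p.1) n ⁻¹' {v}) =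
      ∏ i, (if v i = Fin.last M then 1 - M * a else a) := by
  have h1 : fN (faMap M a) (fun p => lab M a p.1) n ⁻¹' {v} =
      Prod.fst ⁻¹' (fN (tmap M a) (lab M a) n ⁻¹' {v}) := by
    ext p
    have : fN (faMap M a) (fun p => lab M a p.1) n p = fN (tmap M a) (lab M a) n p.1 :=
      funext fun i => by simp only [fN, fst_fa_iter]
    simp only [Set.mem_preimage, Set.mem_singleton_iff, this]
  rw [h1, ← bern_prod nu (meas_t M a) (meas_lab M a) _ (bern1 hM ha) n v, mu_prod]
  exact measurePreserving_fst.measureReal_preimage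
    (measurable_fN (meas_t M a) (meas_lab M a) n (measurableSet_singleton v)).nullMeasurableSet

lemma H_lab (n : ℕ) : H mu (fN (faMap M a) (fun p => lab M a p.1) n) =
    n * (-(M * a) * Real.log a - (1 - M * a) * Real.log (1 - M * a)) := by
  unfold H
  simp_rw [mu_word hM ha]
  rw [bern_sum _ (sum_p1 hM ha), Fin.sum_univ_castSucc]
  simp [Fin.castSucc_ne_last, Real.negMulLog]
  ring_nf
  simp

lemma H_glab (n : ℕ) : H mu (fN (faMap M a) (glab M a) n) =
    n * (-(1 - M * a) * Real.log ((1 - M * a) / M) - M * a * Real.log (M * a)) := by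
  rw [bern_H mu (meas_fa M a) (meas_glab M a) _ (sum_p2 hM ha) (bern2 hM ha),
    Fin.sum_univ_castSucc]
  simp only [Fin.castSucc_ne_last, if_false, if_true, Real.negMulLog, Finset.sum_const,
    Finset.card_univ, Fintype.card_fin, nsmul_eq_mul]
  have := (Mpos hM).ne'
  have e : (M:ℝ) * (-((1 - M * a) / M) * Real.log ((1 - M * a) / M)) =
    -(1 - M * a) * Real.log ((1 - M * a) / M) := by field_simp
  rw [e]; ring

end
end HB
namespace HB

section
variable {M : ℕ} (hM : 2 ≤ M) {a : ℝ} (ha : a ∈ Set.Ioo (0 : ℝ) (1 / M))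
include hM ha

lemma lab_cases {x : ℝ} (hx : 0 ≤ x) :
    (lab M a x = Fin.last M ∧ M * a ≤ x) ∨ (∃ k : ℕ, k < M ∧ (lab M a x : ℕ) = k ∧
      lab M a x ≠ Fin.last M ∧ k * a ≤ x ∧ x < (k+1) * a ∧ x < M * a) := by
  by_cases h : (lab M a x : ℕ) = M
  · left; exact ⟨Fin.ext (by simpa using h), (lab_right hM ha hx).1 h⟩
  · right
    have h1 : (lab M a x : ℕ) < M := by have := (lab M a x).2; omega
    have h2 := (lab_left hM ha hx _ h1).1 rfl
    exact ⟨_, h1, rfl, fun h' => h (by rw [h']; simp), h2.1, h2.2, left_lt hM ha _ h1 h2.2⟩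

lemma t_mem {x : ℝ} (hx : x ∈ Set.Ico (0:ℝ) 1) : tmap M a x ∈ Set.Ico (0:ℝ) 1 := by
  have hlt := Ma_lt hM ha
  unfold tmap
  split_ifs with h
  · exact ⟨Int.fract_nonneg _, Int.fract_lt_one _⟩
  · push Not at h
    constructor
    · exact div_nonneg (by linarith) (by linarith)
    · rw [div_lt_one (by linarith)]; linarith [hx.2]

lemma fa_mem {p : ℝ × ℝ} (hp : p ∈ G) : faMap M a p ∈ G := by
  have hMp := Mpos hM
  obtain ⟨h1, h2⟩ := hp
  refine ⟨by rw [fst_fa]; exact t_mem hM ha h1, ?_⟩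
  rcases lab_cases hM ha h1.1 with ⟨_, h⟩ | ⟨k, hk, _, _, h3, h4, h5⟩
  · unfold faMap
    rw [if_neg (not_lt.2 h)]
    simp only [if_neg h2.2.ne]
    exact ⟨Int.fract_nonneg _, Int.fract_lt_one _⟩
  · unfold faMap
    rw [if_pos h5]
    simp only [floor_left hM ha k h3 h4, Int.cast_natCast]
    rw [← add_div]
    have hk1 : (k : ℝ) + 1 ≤ M := by exact_mod_cast hk
    constructor
    · exact div_nonneg (add_nonneg h2.1 (by positivity)) hMp.le
    · rw [div_lt_one hMp]; linarith [h2.2]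

lemma fa_iter_mem {p : ℝ × ℝ} (hp : p ∈ G) (n : ℕ) : (faMap M a)^[n] p ∈ G := by
  induction n with
  | zero => exact hp
  | succ n ih => rw [Function.iterate_succ_apply']; exact fa_mem hM ha ih

lemma x_contract (m : ℕ) : ∀ x ∈ Set.Ico (0:ℝ) 1, ∀ x' ∈ Set.Ico (0:ℝ) 1,
    (∀ i < m, lab M a ((tmap M a)^[i] x) = lab M a ((tmap M a)^[i] x')) →
    |x - x'| ≤ (max a (1 - M * a)) ^ m := by
  have hlt := Ma_lt hM ha
  have hap := ha.1
  induction m with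
  | zero =>
    intro x hx x' hx' _
    rw [pow_zero, abs_le]
    constructor <;> linarith [hx.1, hx.2, hx'.1, hx'.2]
  | succ m ih =>
    intro x hx x' hx' h
    have h0 := h 0 (by omega)
    simp only [Function.iterate_zero, id] at h0
    have h1 := ih _ (t_mem hM ha hx) _ (t_mem hM ha hx') (fun i hi => by
      have := h (i+1) (by omega)
      simpa only [Function.iterate_succ_apply] using this)
    have hpos : 0 < max a (1 - M * a) := lt_max_of_lt_left hap
    have h2 : |x - x'| ≤ max a (1 - M * a) * |tmap M a x - tmap M a x'| := by
      rcases lab_cases hM ha hx.1 with ⟨e1, e2⟩ | ⟨k, hk, e0, e1, e3, e4, e5⟩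
      · rcases lab_cases hM ha hx'.1 with ⟨e1', e2'⟩ | ⟨k', hk', e0', e1', e3', e4', e5'⟩
        · have : x - x' = (1 - M * a) * (tmap M a x - tmap M a x') := by
            rw [tmap, tmap, if_neg (not_lt.2 e2), if_neg (not_lt.2 e2')]
            have : 1 - M * a ≠ 0 := by linarith
            field_simp; ring
          rw [this, abs_mul, abs_of_pos (by linarith : 0 < 1 - M * a)]
          exact mul_le_mul_of_nonneg_right (le_max_right _ _) (abs_nonneg _)
        · exact absurd (h0 ▸ e1) e1'
      · rcases lab_cases hM ha hx'.1 with ⟨e1', e2'⟩ | ⟨k', hk', e0', e1', e3', e4', e5'⟩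
        · exact absurd (h0.trans e1') e1
        · have hkk : k' = k := by rw [← e0, ← e0', h0]
          subst hkk
          have : x - x' = a * (tmap M a x - tmap M a x') := by
            rw [tmap, tmap, if_pos e5, if_pos e5', Int.fract, Int.fract,
              floor_left hM ha k' e3 e4, floor_left hM ha k' e3' e4']
            field_simp; ring
          rw [this, abs_mul, abs_of_pos hap]
          exact mul_le_mul_of_nonneg_right (le_max_left _ _) (abs_nonneg _)
    calc |x - x'| ≤ _ := h2
      _ ≤ max a (1 - M * a) * (max a (1 - M * a)) ^ m := mul_le_mul_of_nonneg_left h1 hpos.le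
      _ = _ := by ring

lemma y_left {p p' : ℝ × ℝ} (hp : p ∈ G) (hp' : p' ∈ G) (hl : lab M a p.1 = lab M a p'.1)
    (hk : lab M a p.1 ≠ Fin.last M) (r : ℕ) (h : ⌊(M:ℝ)^r * p.2⌋ = ⌊(M:ℝ)^r * p'.2⌋) :
    ⌊(M:ℝ)^(r+1) * (faMap M a p).2⌋ = ⌊(M:ℝ)^(r+1) * (faMap M a p').2⌋ := by
  have hMp := Mpos hM
  have key : ∀ (q : ℝ × ℝ) (k : ℕ), k * a ≤ q.1 → q.1 < (k+1) * a → q.1 < M * a →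
      ⌊(M:ℝ)^(r+1) * (faMap M a q).2⌋ = ⌊(M:ℝ)^r * q.2⌋ + ((k * M^r : ℕ) : ℤ) := by
    intro q k h1 h2 h3
    unfold faMap
    rw [if_pos h3]
    simp only [floor_left hM ha k h1 h2]
    rw [← Int.floor_add_intCast]
    congr 1
    push_cast
    rw [pow_succ]
    field_simp
  rcases lab_cases hM ha hp.1.1 with ⟨e1, e2⟩ | ⟨k, _, e0, e1, e3, e4, e5⟩
  · exact absurd e1 hk
  rcases lab_cases hM ha hp'.1.1 with ⟨e1', e2'⟩ | ⟨k', _, e0', e1', e3', e4', e5'⟩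
  · exact absurd (hl.trans e1') hk
  have hkk : k' = k := by rw [← e0, ← e0', hl]
  subst hkk
  rw [key p k' e3 e4 e5, key p' k' e3' e4' e5', h]

lemma y_right {p p' : ℝ × ℝ} (hp : p ∈ G) (hp' : p' ∈ G) (hl : lab M a p.1 = lab M a p'.1)
    (hk : lab M a p.1 = Fin.last M) (r : ℕ) (h : ⌊(M:ℝ)^(r+1) * p.2⌋ = ⌊(M:ℝ)^(r+1) * p'.2⌋) :
    ⌊(M:ℝ)^r * (faMap M a p).2⌋ = ⌊(M:ℝ)^r * (faMap M a p').2⌋ := by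
  have hMp := Mpos hM
  have key : ∀ q ∈ G, lab M a q.1 = Fin.last M →
      ⌊(M:ℝ)^r * (faMap M a q).2⌋ =
        ⌊(M:ℝ)^(r+1) * q.2⌋ - (M^r : ℕ) * (⌊(M:ℝ)^(r+1) * q.2⌋ / ((M^r : ℕ) : ℤ)) := by
    intro q hq h1
    rcases lab_cases hM ha hq.1.1 with ⟨e1, e2⟩ | ⟨k, _, e0, e1, e3, e4, e5⟩
    · have e : (M:ℝ)^(r+1) * q.2 = (M^r : ℕ) * ((M:ℝ) * q.2) := by push_cast; ring
      rw [e, Int.natCast_mul_floor_div_cancel (by positivity)]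
      unfold faMap
      rw [if_neg (not_lt.2 e2)]
      simp only [if_neg hq.2.2.ne, Int.fract]
      have e3 : (M:ℝ)^r * (M * q.2 - ⌊(M:ℝ) * q.2⌋) =
        (M^r : ℕ) * ((M:ℝ) * q.2) - (((M^r : ℕ) * ⌊(M:ℝ) * q.2⌋ : ℤ) : ℝ) := by push_cast; ring
      rw [e3, Int.floor_sub_intCast]
    · exact absurd h1 e1
  rw [key p hp hk, key p' hp' (hl ▸ hk), h]

end

def sg {M : ℕ} (k : Fin (M+1)) : ℤ := if k = Fin.last M then 1 else -1

def S {M N : ℕ} (w : Fin N → Fin (M+1)) (j : ℕ) : ℤ := ∑ i : Fin N, if (i : ℕ) < j then sg (w i) else 0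

lemma S_zero {M N : ℕ} (w : Fin N → Fin (M+1)) : S w 0 = 0 := by simp [S]

lemma S_succ {M N : ℕ} (w : Fin N → Fin (M+1)) (j : ℕ) (hj : j < N) :
    S w (j+1) = S w j + sg (w ⟨j, hj⟩) := by
  unfold S
  have : sg (w ⟨j, hj⟩) = ∑ i : Fin N, if i = ⟨j, hj⟩ then sg (w i) else 0 := by simp
  rw [this, ← Finset.sum_add_distrib]
  refine Finset.sum_congr rfl fun i _ => ?_
  have h3 : i = ⟨j, hj⟩ ↔ (i:ℕ) = j := by simp [Fin.ext_iff]
  by_cases h1 : (i:ℕ) < j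
  · have : ¬ (i:ℕ) = j := by omega
    simp [h1, h3, this, Nat.lt_succ_of_lt h1]
  · by_cases h2 : (i:ℕ) = j
    · simp [h2, h3]
    · have : ¬ (i:ℕ) < j+1 := by omega
      simp [h1, h3, h2, this]

lemma S_le {M N : ℕ} (w : Fin N → Fin (M+1)) (j : ℕ) : S w j ≤ N := by
  unfold S
  calc _ ≤ ∑ i : Fin N, (1:ℤ) := Finset.sum_le_sum fun i _ => by
        unfold sg; split_ifs <;> norm_num
    _ = N := by simp

lemma exists_Z {M N : ℕ} (w : Fin N → Fin (M+1)) :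
    ∃ Z : ℕ, (∀ j ≤ N, S w j ≤ Z) ∧ (∃ j ≤ N, S w j = Z) := by
  obtain ⟨j, hj, h⟩ := Finset.exists_max_image (Finset.range (N+1)) (S w) ⟨0, by simp⟩
  have h0 := h 0 (by simp)
  rw [S_zero] at h0
  refine ⟨(S w j).toNat, ?_, j, by simpa [Nat.lt_succ_iff] using hj, by omega⟩
  intro i hi
  have := h i (by simpa [Nat.lt_succ_iff] using hi)
  omega

section
variable {M : ℕ} (hM : 2 ≤ M) {a : ℝ} (ha : a ∈ Set.Ioo (0 : ℝ) (1 / M))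
include hM ha

lemma det {N m : ℕ} {p p' : ℝ × ℝ} (hp : p ∈ G) (hp' : p' ∈ G) (w : Fin N → Fin (M+1))
    (hw : fN (faMap M a) (fun p => lab M a p.1) N p = w)
    (hw' : fN (faMap M a) (fun p => lab M a p.1) N p' = w) (D : ℕ)
    (hD : ∀ j ≤ N, S w j + m ≤ D) (hf : ⌊(M:ℝ)^D * p.2⌋ = ⌊(M:ℝ)^D * p'.2⌋) (η : ℝ)
    (h1 : (max a (1 - M * a)) ^ m < η) (h2 : ((M:ℝ)^m)⁻¹ < η) (i : ℕ) (hi : i + m ≤ N) :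
    dist ((faMap M a)^[i] p) ((faMap M a)^[i] p') < η := by
  have hMp := Mpos hM
  have hlab : ∀ j, ∀ hj : j < N, lab M a ((faMap M a)^[j] p).1 = w ⟨j, hj⟩ :=
    fun j hj => congrFun hw ⟨j, hj⟩
  have hlab' : ∀ j, ∀ hj : j < N, lab M a ((faMap M a)^[j] p').1 = w ⟨j, hj⟩ :=
    fun j hj => congrFun hw' ⟨j, hj⟩
  have hy : ∀ i ≤ N, ∀ r : ℕ, (r : ℤ) = D - S w i →
      ⌊(M:ℝ)^r * ((faMap M a)^[i] p).2⌋ = ⌊(M:ℝ)^r * ((faMap M a)^[i] p').2⌋ := by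
    intro i
    induction i with
    | zero =>
      intro _ r hr
      rw [S_zero] at hr
      have : r = D := by omega
      subst this
      exact hf
    | succ i ih =>
      intro hi r hr
      have hiN : i < N := by omega
      rw [S_succ w i hiN] at hr
      rw [Function.iterate_succ_apply', Function.iterate_succ_apply']
      have hDi := hD i (by omega)
      have hm := fa_iter_mem hM ha hp i
      have hm' := fa_iter_mem hM ha hp' i
      have hll := (hlab i hiN).trans (hlab' i hiN).symm
      by_cases hk : w ⟨i, hiN⟩ = Fin.last M
      · rw [sg, if_pos hk] at hr
        exact y_right hM ha hm hm' hll (by rw [hlab i hiN, hk]) r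
          (ih (by omega) (r+1) (by push_cast; omega))
      · rw [sg, if_neg hk] at hr
        obtain ⟨r', rfl⟩ : ∃ r', r = r' + 1 := ⟨r - 1, by omega⟩
        exact y_left hM ha hm hm' hll (by rw [hlab i hiN]; exact hk) r'
          (ih (by omega) r' (by push_cast at hr; omega))
  have hG := fa_iter_mem hM ha hp i
  have hG' := fa_iter_mem hM ha hp' i
  rw [Prod.dist_eq, max_lt_iff, Real.dist_eq, Real.dist_eq]
  constructor
  · refine lt_of_le_of_lt (x_contract hM ha m _ hG.1 _ hG'.1 ?_) h1
    intro j hj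
    rw [fst_fa_iter, fst_fa_iter, ← Function.iterate_add_apply, ← Function.iterate_add_apply,
      ← fst_fa_iter, ← fst_fa_iter, hlab (j+i) (by omega), hlab' (j+i) (by omega)]
  · have hDi := hD i (by omega)
    have := hy i (by omega) ((D:ℤ) - S w i).toNat (by omega)
    set r := ((D:ℤ) - S w i).toNat with hr
    have hrm : m ≤ r := by omega
    have h3 := Int.abs_sub_lt_one_of_floor_eq_floor this
    rw [← mul_sub, abs_mul, abs_of_pos (by positivity)] at h3
    refine lt_trans ?_ h2
    have h4 : (M:ℝ)^m ≤ (M:ℝ)^r :=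
      pow_le_pow_right₀ (by exact_mod_cast (by omega : 1 ≤ M)) hrm
    rw [← one_div, lt_div_iff₀ (by positivity)]
    nlinarith [mul_le_mul_of_nonneg_right h4 (abs_nonneg (((faMap M a)^[i] p).2 - ((faMap M a)^[i] p').2))]

end
end HB
namespace HB

lemma exp_walk {ι : Type*} [Fintype ι] (N : ℕ) (p : ι → ℝ) (hp : ∑ k, p k = 1) (τ : ι → ℝ) (c : ℝ)
    (hc : ∑ k, p k * Real.exp (c * τ k) = 1) (Q : Fin N → Prop) [DecidablePred Q] :
    ∑ w : Fin N → ι, (∏ i, p (w i)) * Real.exp (c * ∑ i, if Q i then τ (w i) else 0) = 1 := by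
  have : ∀ w : Fin N → ι, (∏ i, p (w i)) * Real.exp (c * ∑ i, if Q i then τ (w i) else 0) =
      ∏ i, (fun i k => if Q i then p k * Real.exp (c * τ k) else p k) i (w i) := by
    intro w
    rw [Finset.mul_sum, Real.exp_sum, ← Finset.prod_mul_distrib]
    refine Finset.prod_congr rfl fun i _ => ?_
    by_cases h : Q i <;> simp [h]
  simp_rw [this]
  classical
  have e := Finset.prod_univ_sum (fun _ : Fin N => (Finset.univ : Finset ι))
    (fun i k => if Q i then p k * Real.exp (c * τ k) else p k)
  rw [Fintype.piFinset_univ] at e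
  rw [← e]
  refine Finset.prod_eq_one fun i _ => ?_
  by_cases h : Q i <;> simp [h, hc, hp]

lemma mean_walk {ι : Type*} [Fintype ι] (N : ℕ) (p : ι → ℝ) (hp : ∑ k, p k = 1) (τ : ι → ℝ) :
    ∑ w : Fin N → ι, (∏ i, p (w i)) * ∑ i, τ (w i) = N * ∑ k, p k * τ k := by
  classical
  simp_rw [Finset.mul_sum]
  rw [Finset.sum_comm]
  have : ∀ j : Fin N, ∑ w : Fin N → ι, (∏ i, p (w i)) * τ (w j) = ∑ k, p k * τ k := by
    intro j
    have e1 : ∀ w : Fin N → ι, (∏ i, p (w i)) * τ (w j) =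
        ∏ i, (fun i k => p k * if i = j then τ k else 1) i (w i) := by
      intro w
      simp only [Finset.prod_mul_distrib, Finset.prod_ite_eq', Finset.mem_univ, if_true]
    simp_rw [e1]
    have e := Finset.prod_univ_sum (fun _ : Fin N => (Finset.univ : Finset ι))
      (fun i k => p k * if i = j then τ k else 1)
    rw [Fintype.piFinset_univ] at e
    rw [← e, Finset.prod_eq_single j]
    · simp
    · intro i _ hi; simp [hi, hp]
    · simp
  simp_rw [this]
  simp [Finset.mul_sum]

lemma jensen {W : Type*} [Fintype W] (N : ℕ) (P : W → ℝ) (hP : ∀ w, 0 ≤ P w) (hP1 : ∑ w, P w = 1)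
    (A : ℕ → W → ℝ) (Z : W → ℝ) (hZ : ∀ w, ∃ j ≤ N, Z w = A j w) (c : ℝ) (hc : 0 < c)
    (hA : ∀ j ≤ N, ∑ w, P w * Real.exp (c * A j w) = 1) :
    ∑ w, P w * Z w ≤ Real.log (N+1) / c := by
  have hN : (0:ℝ) < N + 1 := by positivity
  rw [le_div_iff₀ hc, Finset.sum_mul]
  have h1 : ∀ w, P w * Z w * c ≤
      P w * (∑ j ∈ Finset.range (N+1), Real.exp (c * A j w)) / (N+1) - P w + P w * Real.log (N+1) := by
    intro w
    have h2 : Real.exp (c * Z w) ≤ ∑ j ∈ Finset.range (N+1), Real.exp (c * A j w) := by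
      obtain ⟨j, hj, h⟩ := hZ w
      rw [h]
      exact Finset.single_le_sum (f := fun j => Real.exp (c * A j w))
        (fun j _ => (Real.exp_pos _).le) (by simpa [Nat.lt_succ_iff] using hj)
    have h3 := Real.log_le_sub_one_of_pos (div_pos (Real.exp_pos (c * Z w)) hN)
    rw [Real.log_div (Real.exp_pos _).ne' hN.ne', Real.log_exp] at h3
    have h4 : c * Z w ≤ (∑ j ∈ Finset.range (N+1), Real.exp (c * A j w)) / (N+1) - 1
        + Real.log (N+1) := by
      have := div_le_div_of_nonneg_right h2 hN.le
      linarith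
    have h5 := mul_le_mul_of_nonneg_left h4 (hP w)
    calc _ = P w * (c * Z w) := by ring
      _ ≤ _ := h5
      _ = _ := by ring
  calc _ ≤ ∑ w, _ := Finset.sum_le_sum fun w _ => h1 w
    _ = Real.log (N+1) := by
      rw [Finset.sum_add_distrib, Finset.sum_sub_distrib, ← Finset.sum_mul, hP1,
        ← Finset.sum_div]
      simp_rw [Finset.mul_sum]
      rw [Finset.sum_comm, Finset.sum_congr rfl (fun j hj => hA j (by
        simpa [Nat.lt_succ_iff] using hj))]
      simp
      field_simp
      norm_num

section
variable {M : ℕ} (hM : 2 ≤ M) {a : ℝ} (ha : a ∈ Set.Ioo (0 : ℝ) (1 / M))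
include hM ha

lemma emax (hq : M * a ≠ 1/2) : ∃ C : ℝ, 0 ≤ C ∧ ∀ (N : ℕ) (Z : (Fin N → Fin (M+1)) → ℕ),
    (∀ w, ∃ j ≤ N, S w j = Z w) →
    ∑ w : Fin N → Fin (M+1), (∏ i, (if w i = Fin.last M then 1 - M * a else a)) * (Z w : ℝ) ≤
      N * max (1 - 2 * (M * a)) 0 + C * Real.log (N+1) := by
  have hlt := Ma_lt hM ha
  have hpos := Ma_pos hM ha
  have hap := ha.1
  have hr0 : 0 < 1 - M * a := by linarith
  have hpr := sum_p1 hM ha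
  set pr : Fin (M+1) → ℝ := fun k => if k = Fin.last M then 1 - M * a else a with hprdef
  have hpr0 : ∀ k, 0 ≤ pr k := by
    intro k; simp only [hprdef]; split_ifs <;> linarith
  have hP0 : ∀ N, ∀ w : Fin N → Fin (M+1), 0 ≤ ∏ i, pr (w i) :=
    fun N w => Finset.prod_nonneg fun i _ => hpr0 _
  have hP1 : ∀ N, ∑ w : Fin N → Fin (M+1), ∏ i, pr (w i) = 1 := by
    intro N; rw [sum_prod_eq N (fun _ => pr)]; simp [hpr]
  have hsum : ∀ u v : ℝ, ∑ k, pr k * (if k = Fin.last M then u else v) =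
      (1 - M * a) * u + M * a * v := by
    intro u v
    rw [Fin.sum_univ_castSucc]
    simp [hprdef, Fin.castSucc_ne_last]
    ring
  have hsg : ∀ k : Fin (M+1), ((sg k : ℤ) : ℝ) = if k = Fin.last M then 1 else -1 := by
    intro k; unfold sg; split_ifs <;> simp
  have hScast : ∀ N (w : Fin N → Fin (M+1)) j, ((S w j : ℤ) : ℝ) =
      ∑ i : Fin N, if (i:ℕ) < j then ((sg (w i) : ℤ) : ℝ) else 0 := by
    intro N w j; unfold S; push_cast; rfl
  rcases lt_or_gt_of_ne hq with h | h
  · -- case 1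
    set c := Real.log ((1 - M * a) / (M * a)) with hc
    have hcpos : 0 < c := Real.log_pos (by rw [lt_div_iff₀ hpos]; linarith)
    have hexp : Real.exp c = (1 - M * a) / (M * a) := Real.exp_log (by positivity)
    refine ⟨1 / c, by positivity, fun N Z hZ => ?_⟩
    have hwalk : ∀ j ≤ N, ∑ w : Fin N → Fin (M+1), (∏ i, pr (w i)) *
        Real.exp (c * ((S w j : ℝ) - S w N)) = 1 := by
      intro j hj
      have := exp_walk N pr hpr (fun k => -((sg k : ℤ) : ℝ)) c (by
        have e : ∀ k : Fin (M+1), Real.exp (c * -((sg k : ℤ) : ℝ)) =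
            if k = Fin.last M then (Real.exp c)⁻¹ else Real.exp c := by
          intro k; rw [hsg]; split_ifs <;> simp [Real.exp_neg]
        simp_rw [e, hsum, hexp]
        field_simp; ring) (fun i => ¬ ((i:ℕ) < j))
      rw [← this]
      refine Finset.sum_congr rfl fun w _ => ?_
      congr 3
      rw [hScast, hScast, ← Finset.sum_sub_distrib]
      refine Finset.sum_congr rfl fun i _ => ?_
      by_cases h' : (i:ℕ) < j <;> simp [h']
    have hj := jensen N (fun w : Fin N → Fin (M+1) => ∏ i, pr (w i)) (hP0 N) (hP1 N)
      (fun j w => (S w j : ℝ) - S w N) (fun w => (Z w : ℝ) - S w N) (fun w => by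
        obtain ⟨j, hj, h'⟩ := hZ w
        refine ⟨j, hj, ?_⟩
        have : ((S w j : ℤ) : ℝ) = (Z w : ℝ) := by rw [h']; simp
        rw [this]) c hcpos hwalk
    have hmean := mean_walk N pr hpr (fun k => ((sg k : ℤ) : ℝ))
    simp_rw [hsg, hsum] at hmean
    have hSN : ∀ w : Fin N → Fin (M+1), ((S w N : ℤ) : ℝ) =
        ∑ i, if w i = Fin.last M then (1:ℝ) else -1 := by
      intro w; rw [hScast]; exact Finset.sum_congr rfl fun i _ => by simp [hsg]
    simp only [mul_sub, Finset.sum_sub_distrib, hSN] at hj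
    rw [hmean] at hj
    rw [max_eq_left (by linarith)]
    calc _ = ∑ w : Fin N → Fin (M+1), (∏ i, pr (w i)) * (Z w : ℝ) := rfl
      _ ≤ _ := by
        have : 1 / c * Real.log (N+1) = Real.log (N+1) / c := by ring
        rw [this]; linarith
  · -- case 2
    set c := Real.log ((M * a) / (1 - M * a)) with hc
    have hcpos : 0 < c := Real.log_pos (by rw [lt_div_iff₀ hr0]; linarith)
    have hexp : Real.exp c = (M * a) / (1 - M * a) := Real.exp_log (by positivity)
    refine ⟨1 / c, by positivity, fun N Z hZ => ?_⟩
    have hwalk : ∀ j ≤ N, ∑ w : Fin N → Fin (M+1), (∏ i, pr (w i)) *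
        Real.exp (c * (S w j : ℝ)) = 1 := by
      intro j hj
      have := exp_walk N pr hpr (fun k => ((sg k : ℤ) : ℝ)) c (by
        have e : ∀ k : Fin (M+1), Real.exp (c * ((sg k : ℤ) : ℝ)) =
            if k = Fin.last M then (Real.exp c) else (Real.exp c)⁻¹ := by
          intro k; rw [hsg]; split_ifs <;> simp [Real.exp_neg]
        simp_rw [e, hsum, hexp]
        field_simp; ring) (fun i => ((i:ℕ) < j))
      rw [← this]
      refine Finset.sum_congr rfl fun w _ => ?_
      rw [hScast]
    have hj := jensen N (fun w : Fin N → Fin (M+1) => ∏ i, pr (w i)) (hP0 N) (hP1 N)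
      (fun j w => (S w j : ℝ)) (fun w => (Z w : ℝ)) (fun w => by
        obtain ⟨j, hj, h'⟩ := hZ w
        refine ⟨j, hj, ?_⟩
        have : ((S w j : ℤ) : ℝ) = (Z w : ℝ) := by rw [h']; simp
        rw [this]) c hcpos hwalk
    rw [max_eq_right (by linarith)]
    calc _ = ∑ w : Fin N → Fin (M+1), (∏ i, pr (w i)) * (Z w : ℝ) := rfl
      _ ≤ _ := by
        have : 1 / c * Real.log (N+1) = Real.log (N+1) / c := by ring
        rw [this]; linarith

/-- joint code bound -/
lemma code (hq : M * a ≠ 1/2) : ∃ C : ℝ, 0 ≤ C ∧ ∀ (N m : ℕ) (η : ℝ),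
    (max a (1 - M * a)) ^ m < η → ((M:ℝ)^m)⁻¹ < η →
    ∃ (L : ℕ) (K : ℝ × ℝ → (Fin N → Fin (M+1)) × Fin L), Measurable K ∧
      (∀ p ∈ G, ∀ p' ∈ G, K p = K p' → ∀ i, i + m ≤ N →
        dist ((faMap M a)^[i] p) ((faMap M a)^[i] p') < η) ∧
      H mu K ≤ N * (-(M * a) * Real.log a - (1 - M * a) * Real.log (1 - M * a)) +
        Real.log M * (m + (N * max (1 - 2 * (M * a)) 0 + C * Real.log (N+1))) := by
  obtain ⟨C, hC, hE⟩ := emax hM ha hq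
  refine ⟨C, hC, fun N m η h1 h2 => ?_⟩
  have hMp := Mpos hM
  choose Z hZ1 hZ2 using fun w : Fin N → Fin (M+1) => exists_Z w
  have hZN : ∀ w, Z w ≤ N := by
    intro w
    obtain ⟨j, _, hj⟩ := hZ2 w
    have := S_le w j
    omega
  let wd := fN (faMap M a) (fun p => lab M a p.1) N
  have hwd : Measurable wd :=
    measurable_fN (meas_fa M a) ((meas_lab M a).comp measurable_fst) N
  let L := M^(m+N) + 1
  let fl : ℝ × ℝ → ℕ := fun p => ⌊(M:ℝ)^(m + Z (wd p)) * p.2⌋₊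
  have hfl : Measurable fl := by
    apply Nat.measurable_floor.comp
    refine Measurable.mul ?_ measurable_snd
    exact (measurable_of_countable (fun w => (M:ℝ)^(m + Z w))).comp hwd
  let v : ℝ × ℝ → Fin L := fun p => Fin.ofNat L (fl p)
  have hv : Measurable v := (measurable_of_countable (fun n : ℕ => Fin.ofNat L n)).comp hfl
  have hflt : ∀ p ∈ G, fl p < M^(m + Z (wd p)) := by
    intro p hp
    have : (0:ℝ) < (M:ℝ)^(m + Z (wd p)) := by positivity
    rw [Nat.floor_lt (mul_nonneg this.le hp.2.1)]
    push_cast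
    nlinarith [hp.2.2]
  refine ⟨L, fun p => (wd p, v p), hwd.prodMk hv, ?_, ?_⟩
  · intro p hp p' hp' hK i hi
    simp only [Prod.mk.injEq] at hK
    have hww := hK.1
    have hlt : ∀ p ∈ G, fl p < L := by
      intro p hp
      have := hflt p hp
      have h3 : M^(m + Z (wd p)) ≤ M^(m+N) :=
        Nat.pow_le_pow_right (by omega) (by have := hZN (wd p); omega)
      omega
    have hvv : fl p = fl p' := by
      have := congrArg Fin.val hK.2
      simp only [v, Fin.ofNat, Nat.mod_eq_of_lt (hlt p hp), Nat.mod_eq_of_lt (hlt p' hp')] at this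
      exact this
    refine det hM ha hp hp' (wd p) rfl hww.symm (m + Z (wd p)) ?_ ?_ η h1 h2 i hi
    · intro j hj
      have := hZ1 (wd p) j hj
      push_cast; omega
    · have hnn : ∀ q ∈ G, (0:ℝ) ≤ (M:ℝ)^(m + Z (wd p)) * q.2 :=
        fun q hq => mul_nonneg (by positivity) hq.2.1
      rw [← Int.natCast_floor_eq_floor (hnn p hp), ← Int.natCast_floor_eq_floor (hnn p' hp')]
      have hvv' : ⌊(M:ℝ)^(m + Z (wd p)) * p.2⌋₊ = ⌊(M:ℝ)^(m + Z (wd p')) * p'.2⌋₊ := hvv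
      rw [← hww] at hvv'
      rw [hvv']
  · have hc := H_count mu mu_compl hwd hv
      (fun w => (Finset.range (M^(m + Z w))).image (fun n => Fin.ofNat L n))
      (fun w => (M:ℝ)^(m + Z w)) (fun w => by positivity)
      (fun w => by
        have := Finset.card_image_le (s := Finset.range (M^(m + Z w))) (f := fun n => Fin.ofNat L n)
        rw [Finset.card_range] at this
        exact_mod_cast this)
      (fun p hp => Finset.mem_image_of_mem _ (Finset.mem_range.2 (hflt p hp)))
    refine hc.trans ?_
    have hH : H mu wd = _ := H_lab hM ha N
    rw [hH]
    have hlog : 0 ≤ Real.log M := Real.log_nonneg (by exact_mod_cast (by omega : 1 ≤ M))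
    have hP1 : ∑ w : Fin N → Fin (M+1), ∏ i, (if w i = Fin.last M then 1 - M * a else a) = 1 := by
      rw [sum_prod_eq N (fun _ k => if k = Fin.last M then 1 - M * a else a)]
      simp [sum_p1 hM ha]
    have e : ∑ w, mu.real (wd ⁻¹' {w}) * Real.log ((M:ℝ)^(m + Z w)) =
        Real.log M * (m + ∑ w : Fin N → Fin (M+1),
          (∏ i, (if w i = Fin.last M then 1 - M * a else a)) * (Z w : ℝ)) := by
      have e1 : (m:ℝ) = ∑ w : Fin N → Fin (M+1),
          (∏ i, (if w i = Fin.last M then 1 - M * a else a)) * (m:ℝ) := by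
        rw [← Finset.sum_mul, hP1, one_mul]
      rw [e1, ← Finset.sum_add_distrib, Finset.mul_sum]
      refine Finset.sum_congr rfl fun w _ => ?_
      rw [← mu_word hM ha, Real.log_pow]
      push_cast
      ring
    rw [e]
    have := hE N Z hZ2
    gcongr
end
end HB
namespace HB

lemma H_small (k : ℕ) (ε : ℝ) (hε : 0 < ε) : ∃ δ > 0, ∀ {X : Type} [MeasurableSpace X]
    (μ : Measure X) [IsProbabilityMeasure μ] (e : X → Fin (k+1)), Measurable e →
    μ.real {x | e x ≠ 0} < δ → H μ e ≤ ε := by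
  have hk : (0:ℝ) < k + 1 := by positivity
  have hcont := Real.continuous_negMulLog
  have h0 := Metric.continuousAt_iff.1 (hcont.continuousAt (x := 0)) (ε / (k+1)) (by positivity)
  have h1 := Metric.continuousAt_iff.1 (hcont.continuousAt (x := 1)) (ε / (k+1)) (by positivity)
  obtain ⟨δ0, hδ0, h0⟩ := h0
  obtain ⟨δ1, hδ1, h1⟩ := h1
  refine ⟨min δ0 δ1, lt_min hδ0 hδ1, ?_⟩
  intro X _ μ _ e he hlt
  have hterm : ∀ i, Real.negMulLog (μ.real (e ⁻¹' {i})) ≤ ε / (k+1) := by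
    intro i
    by_cases hi : i = 0
    · subst hi
      have hm : MeasurableSet (e ⁻¹' {0}) := he (measurableSet_singleton 0)
      have hc : {x | e x ≠ 0} = (e ⁻¹' {0})ᶜ := by ext x; simp
      rw [hc, probReal_compl_eq_one_sub hm] at hlt
      have hle : μ.real (e ⁻¹' {0}) ≤ 1 := measureReal_le_one
      have := h1 (x := μ.real (e ⁻¹' {0})) (by
        rw [Real.dist_eq, abs_lt]; constructor <;> linarith [min_le_right δ0 δ1])
      rw [Real.negMulLog_one, Real.dist_eq, sub_zero] at this
      exact (le_abs_self _).trans this.le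
    · have hle : μ.real (e ⁻¹' {i}) ≤ μ.real {x | e x ≠ 0} :=
        measureReal_mono (fun x hx => by
          simp only [Set.mem_preimage, Set.mem_singleton_iff] at hx
          simp [hx, hi])
      have hnn : 0 ≤ μ.real (e ⁻¹' {i}) := measureReal_nonneg
      have := h0 (x := μ.real (e ⁻¹' {i})) (by
        rw [Real.dist_eq, abs_lt]; constructor <;> linarith [min_le_left δ0 δ1])
      rw [Real.negMulLog_zero, Real.dist_eq, sub_zero] at this
      exact (le_abs_self _).trans this.le
  unfold H
  calc _ ≤ ∑ i : Fin (k+1), ε / (k+1) := Finset.sum_le_sum fun i _ => hterm i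
    _ = ε := by simp; field_simp

lemma approx (k : ℕ) (f : ℝ × ℝ → Fin k) (hf : Measurable f) (ε : ℝ) (hε : 0 < ε) :
    ∃ (e : ℝ × ℝ → Fin (k+1)) (η : ℝ), 0 < η ∧ Measurable e ∧ H mu e ≤ ε ∧
      ∀ p p', dist p p' < η → e p = e p' → f p = f p' := by
  obtain ⟨δ, hδ, hH⟩ := H_small k ε hε
  let F : ℝ × ℝ → ℝ := fun p => ((f p : ℕ) : ℝ)
  have hF : Measurable F := (measurable_of_countable (fun i : Fin k => ((i : ℕ) : ℝ))).comp hf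
  have hFi : Integrable F mu := by
    refine Integrable.of_bound hF.aestronglyMeasurable k (Filter.Eventually.of_forall fun p => ?_)
    rw [Real.norm_eq_abs, abs_of_nonneg (by positivity)]
    show ((f p : ℕ) : ℝ) ≤ k
    exact_mod_cast (f p).2.le
  obtain ⟨φ, hφc, hφe, hφ, hφi⟩ := hFi.exists_hasCompactSupport_integral_sub_le
    (ε := δ / 8) (by positivity)
  have hu := hφc.uniformContinuous_of_continuous hφ
  obtain ⟨η, hη, hη'⟩ := Metric.uniformContinuous_iff.1 hu (1/2) (by norm_num)
  have hms : MeasurableSet {p | |F p - φ p| < 1/4} :=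
    measurableSet_lt (hF.sub hφ.measurable).abs measurable_const
  classical
  let e : ℝ × ℝ → Fin (k+1) := fun p => if |F p - φ p| < 1/4 then 0 else (f p).succ
  have he : Measurable e :=
    Measurable.ite hms measurable_const ((measurable_of_countable (fun i : Fin k => i.succ)).comp hf)
  refine ⟨e, η, hη, he, ?_, ?_⟩
  · apply hH mu e he
    have hmk := mul_meas_ge_le_integral_of_nonneg (μ := mu) (f := fun p => ‖F p - φ p‖)
      (Filter.Eventually.of_forall fun p => norm_nonneg _) (hFi.sub hφi).norm (1/4)
    have hsub : mu.real {x | e x ≠ 0} ≤ mu.real {x | 1/4 ≤ ‖F x - φ x‖} := by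
      refine measureReal_mono (fun x hx => ?_)
      simp only [Set.mem_ofPred_eq, e] at hx ⊢
      by_contra hc
      apply hx
      rw [if_pos]
      simpa [Real.norm_eq_abs] using hc
    linarith
  · intro p p' hd hee
    simp only [e] at hee
    by_cases h1 : |F p - φ p| < 1/4
    · by_cases h2 : |F p' - φ p'| < 1/4
      · have h3 := hη' hd
        rw [Real.dist_eq] at h3
        rw [abs_lt] at h1 h2 h3
        have h4 : |F p - F p'| < 1 := by rw [abs_lt]; constructor <;> linarith
        have h5 : |((f p : ℕ) : ℤ) - ((f p' : ℕ) : ℤ)| < 1 := by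
          have : |(((f p : ℕ) : ℤ) : ℝ) - (((f p' : ℕ) : ℤ) : ℝ)| < 1 := by
            push_cast; exact h4
          exact_mod_cast this
        apply Fin.ext
        rw [Int.abs_lt_one_iff] at h5
        omega
      · rw [if_pos h1, if_neg h2] at hee
        exact absurd hee.symm (Fin.succ_ne_zero _)
    · by_cases h2 : |F p' - φ p'| < 1/4
      · rw [if_neg h1, if_pos h2] at hee
        exact absurd hee (Fin.succ_ne_zero _)
      · rw [if_neg h1, if_neg h2] at hee
        exact Fin.succ_injective _ hee

lemma exists_n (A B ε : ℝ) (hB : 0 ≤ B) (hε : 0 < ε) (m : ℕ) : ∃ n : ℕ,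
    A + B * Real.log ((n + 1 + m : ℕ) + 1) ≤ ε * (n + 1) := by
  have hB' : 0 < B + 1 := by linarith
  have h1 := Real.isLittleO_log_id_atTop.bound (c := ε / 2 / (B + 1)) (by positivity)
  have h2 : Filter.Tendsto (fun n : ℕ => (((n + 1 + m : ℕ) : ℝ) + 1)) Filter.atTop Filter.atTop := by
    apply Filter.tendsto_atTop_add_const_right
    apply tendsto_natCast_atTop_atTop.comp
    exact (Filter.tendsto_add_atTop_nat (1 + m)).congr (fun n => by omega)
  have h3 := h2.eventually h1
  have h4 : Filter.Tendsto (fun n : ℕ => (n : ℝ)) Filter.atTop Filter.atTop :=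
    tendsto_natCast_atTop_atTop
  have h5 := h4.eventually_ge_atTop ((A + ε / 2 * (m + 1)) * 2 / ε)
  obtain ⟨n, h6, h7⟩ := (h3.and h5).exists
  refine ⟨n, ?_⟩
  have hpos : (0:ℝ) < ((n + 1 + m : ℕ) : ℝ) + 1 := by positivity
  simp only [id, Real.norm_eq_abs, abs_of_pos hpos] at h6
  have h8 := (le_abs_self _).trans h6
  have hlog : 0 ≤ Real.log (((n + 1 + m : ℕ) : ℝ) + 1) :=
    Real.log_nonneg (by have : (0:ℝ) ≤ ((n + 1 + m : ℕ) : ℝ) := by positivity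
                        linarith)
  have h9 : B * Real.log (((n + 1 + m : ℕ) : ℝ) + 1) ≤ ε / 2 * (((n + 1 + m : ℕ) : ℝ) + 1) := by
    calc _ ≤ (B + 1) * Real.log (((n + 1 + m : ℕ) : ℝ) + 1) := by nlinarith
      _ ≤ (B + 1) * (ε / 2 / (B + 1) * (((n + 1 + m : ℕ) : ℝ) + 1)) :=
        mul_le_mul_of_nonneg_left h8 hB'.le
      _ = _ := by field_simp
  rw [div_le_iff₀ hε] at h7
  push_cast at h9 ⊢
  nlinarith

section
variable {M : ℕ} (hM : 2 ≤ M) {a : ℝ} (ha : a ∈ Set.Ioo (0 : ℝ) (1 / M))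
include hM ha

lemma upper (hq : M * a ≠ 1/2) (k : ℕ) (f : ℝ × ℝ → Fin k) (hf : Measurable f) (ε : ℝ)
    (hε : 0 < ε) : ∃ n : ℕ, H mu (fN (faMap M a) f (n+1)) ≤
      ((-(M * a) * Real.log a - (1 - M * a) * Real.log (1 - M * a) +
        Real.log M * max (1 - 2 * (M * a)) 0) + ε) * (n + 1) := by
  have hlt := Ma_lt hM ha
  have hMa := Ma_pos hM ha
  have hMp := Mpos hM
  have hM1 : (1:ℝ) < M := by exact_mod_cast (by omega : 1 < M)
  obtain ⟨C, hC, hcode⟩ := code hM ha hq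
  obtain ⟨e, η, hη, he, hHe, hdet⟩ := approx k f hf (ε / 2) (by positivity)
  obtain ⟨m1, hm1⟩ := exists_pow_lt_of_lt_one hη
    (max_lt (a_lt hM ha) (by linarith) : max a (1 - M * a) < 1)
  obtain ⟨m2, hm2⟩ := exists_pow_lt_of_lt_one hη (inv_lt_one_of_one_lt₀ hM1)
  have hmax0 : 0 ≤ max a (1 - M * a) := le_max_of_le_left ha.1.le
  have hmax1 : max a (1 - M * a) ≤ 1 := max_le (a_lt hM ha).le (by linarith)
  have hm1' : (max a (1 - M * a)) ^ (m1 + m2) < η :=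
    (pow_le_pow_of_le_one hmax0 hmax1 (by omega)).trans_lt hm1
  have hm2' : ((M:ℝ) ^ (m1 + m2))⁻¹ < η := by
    rw [← inv_pow]
    exact (pow_le_pow_of_le_one (by positivity) (inv_le_one_of_one_le₀ hM1.le) (by omega)).trans_lt hm2
  set m := m1 + m2
  set hx := -(M * a) * Real.log a - (1 - M * a) * Real.log (1 - M * a) with hhx
  set d := max (1 - 2 * (M * a)) 0 with hd
  have hlog : 0 ≤ Real.log M := Real.log_nonneg hM1.le
  obtain ⟨n, hn⟩ := exists_n (m * hx + Real.log M * (m + m * d)) (Real.log M * C) (ε / 2)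
    (by positivity) (by positivity) m
  refine ⟨n, ?_⟩
  obtain ⟨L, K, hK, hKd, hKH⟩ := hcode (n + 1 + m) m η hm1' hm2'
  have hmp := mp hM ha
  have hme := measurable_fN hmp.measurable he (n+1)
  have h1 : H mu (fN (faMap M a) f (n+1)) ≤ H mu (fun p => (K p, fN (faMap M a) e (n+1) p)) := by
    apply H_le mu mu_compl (measurable_fN hmp.measurable hf (n+1)) (hK.prodMk hme)
    intro p hp p' hp' hpp
    simp only [Prod.mk.injEq] at hpp
    funext i
    refine hdet _ _ (hKd p hp p' hp' hpp.1 i (by have := i.2; omega)) ?_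
    exact congrFun hpp.2 i
  have h2 := H_pair mu hK hme
  have h3 := H_fN_le mu hmp he (n+1)
  have h4 : ((n+1 : ℕ) : ℝ) * H mu e ≤ (n+1) * (ε / 2) := by
    push_cast
    exact mul_le_mul_of_nonneg_left hHe (by positivity)
  have h5 : ((n + 1 + m : ℕ) : ℝ) = n + 1 + m := by push_cast; ring
  rw [h5] at hn hKH
  nlinarith

end

lemma entropy_iff (M : ℕ) (hM : 2 ≤ M) (q : ℝ) (h0 : 0 < q) (h1 : q < 1) :
    -(1 - q) * Real.log ((1 - q) / M) - q * Real.log q = Real.log (M + 1) ↔ q = 1 / (M + 1) := by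
  have hMp := Mpos hM
  have hM1 : (0:ℝ) < M + 1 := by positivity
  have hr : 0 < 1 - q := by linarith
  rw [Real.log_div hr.ne' hMp.ne']
  constructor
  · intro h
    by_contra hne
    have hne1 : 1 / ((M + 1) * q) ≠ 1 := by
      intro h'
      apply hne
      field_simp at h' ⊢
      linarith
    have l1 := Real.log_lt_sub_one_of_pos (by positivity) hne1
    have l2 := Real.log_le_sub_one_of_pos (show 0 < M / ((M + 1) * (1 - q)) by positivity)
    rw [Real.log_div one_ne_zero (by positivity), Real.log_mul hM1.ne' h0.ne', Real.log_one] at l1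
    rw [Real.log_div hMp.ne' (by positivity), Real.log_mul hM1.ne' hr.ne'] at l2
    have l3 := mul_lt_mul_of_pos_left l1 h0
    have l4 := mul_le_mul_of_nonneg_left l2 hr.le
    have e1 : q * (1 / ((M + 1) * q) - 1) = 1 / (M + 1) - q := by field_simp
    have e2 : (1 - q) * (M / ((M + 1) * (1 - q)) - 1) = M / (M + 1) - (1 - q) := by field_simp
    have e3 : 1 / ((M:ℝ) + 1) + M / (M + 1) = 1 := by field_simp; ring
    rw [e1] at l3
    rw [e2] at l4
    nlinarith
  · intro h
    have e1 : 1 - q = M / (M + 1) := by rw [h]; field_simp; ring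
    rw [e1, h, Real.log_div hMp.ne' hM1.ne', Real.log_div one_ne_zero hM1.ne', Real.log_one]
    field_simp
    ring

end HB
/-- the entropy of Lebesgue measure for the heterochaos baker map `F_a`:
for `a ∈ (0, 1/(2M))` it equals `-(1-Ma) log((1-Ma)/M) - Ma log(Ma)`, and equals
`log(M+1)` iff `a = 1/(M(M+1))`; for `a ∈ (1/(2M), 1/M)` it equals
`-Ma log a - (1-Ma) log(1-Ma)`, and equals `log(M+1)` iff `a = 1/(M+1)`. -/
theorem lebesgue_entropy_formula (M : ℕ) (hM : 2 ≤ M) (a : ℝ)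
    (ha : a ∈ Set.Ioo (0 : ℝ) (1 / M)) :
    (a < 1 / (2 * M) →
      kolSinaiEntropy (faMap M a)
          (volume.restrict (Set.Icc 0 1 ×ˢ Set.Icc (0:ℝ) 1)) =
        -(1 - M * a) * Real.log ((1 - M * a) / M) - M * a * Real.log (M * a) ∧
      (kolSinaiEntropy (faMap M a)
          (volume.restrict (Set.Icc 0 1 ×ˢ Set.Icc (0:ℝ) 1)) = Real.log (M + 1) ↔
        a = 1 / (M * (M + 1)))) ∧
    (1 / (2 * M) < a →
      kolSinaiEntropy (faMap M a)
          (volume.restrict (Set.Icc 0 1 ×ˢ Set.Icc (0:ℝ) 1)) =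
        -(M * a) * Real.log a - (1 - M * a) * Real.log (1 - M * a) ∧
      (kolSinaiEntropy (faMap M a)
          (volume.restrict (Set.Icc 0 1 ×ˢ Set.Icc (0:ℝ) 1)) = Real.log (M + 1) ↔
        a = 1 / (M + 1))) := by
  have hMp := HB.Mpos hM
  have hlt := HB.Ma_lt hM ha
  have hMa := HB.Ma_pos hM ha
  have hap := ha.1
  rw [HB.mu_eq]
  constructor
  · intro h
    rw [lt_div_iff₀ (by positivity)] at h
    have hK : kolSinaiEntropy (faMap M a) HB.mu =
        -(1 - M * a) * Real.log ((1 - M * a) / M) - M * a * Real.log (M * a) := by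
      apply HB.KS_eq HB.mu _ (HB.meas_fa M a)
      · intro k f hf ε hε
        obtain ⟨n, hn⟩ := HB.upper hM ha (by linarith) k f hf ε hε
        refine ⟨n, hn.trans (le_of_eq ?_)⟩
        rw [max_eq_left (by linarith), Real.log_div (by linarith) hMp.ne',
          Real.log_mul hMp.ne' hap.ne']
        ring
      · exact ⟨_, HB.glab M a, HB.meas_glab M a, HB.H_glab hM ha⟩
    refine ⟨hK, ?_⟩
    rw [hK, HB.entropy_iff M hM (M * a) hMa hlt]
    constructor
    · intro h'
      field_simp at h' ⊢
      linarith
    · intro h'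
      rw [h']; field_simp
  · intro h
    rw [div_lt_iff₀ (by positivity)] at h
    have hK : kolSinaiEntropy (faMap M a) HB.mu =
        -(M * a) * Real.log a - (1 - M * a) * Real.log (1 - M * a) := by
      apply HB.KS_eq HB.mu _ (HB.meas_fa M a)
      · intro k f hf ε hε
        obtain ⟨n, hn⟩ := HB.upper hM ha (by linarith) k f hf ε hε
        refine ⟨n, hn.trans (le_of_eq ?_)⟩
        rw [max_eq_right (by linarith)]
        ring
      · exact ⟨_, fun p => HB.lab M a p.1, (HB.meas_lab M a).comp measurable_fst, HB.H_lab hM ha⟩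
    refine ⟨hK, ?_⟩
    have e := HB.entropy_iff M hM (1 - M * a) (by linarith) (by linarith)
    have e1 : (1 - (1 - M * a)) / M = a := by field_simp; ring
    rw [e1] at e
    have e2 : -(1 - (1 - M * a)) * Real.log a = -(M * a) * Real.log a := by ring
    rw [e2] at e
    rw [hK, e]
    constructor
    · intro h'
      field_simp at h' ⊢
      nlinarith
    · intro h'
      rw [h']; field_simp; ring
end
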